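/- (Fadell–Husseini, Zhang–Zhou) Under conditions (V1)–(V6) — in particular the non-positivity condition (V4): V_{ij}(t,ξ) ≤ 0 for all t and all ξ ≠ 0 — there exists a sequence (X^n) of non-collision T-periodic solutions of the N-body-type system ẍ_i + ∇_{x_i} V(t, x_1,…,x_N) = 0, each satisfying x_i^n(t + T/2) = −x_i^n(t), whose action values f(X^n) tend to +∞. -/

import Mathlib

open MeasureTheory Filter

noncomputable section

/-- The total potential `V(t,x) = (1/2) ∑_{i ≠ j} V_{ij}(t, x_i - x_j)`. -/
def Vtot {N k : ℕ} (Vij : Fin N → Fin N → ℝ → EuclideanSpace ℝ (Fin k) → ℝ)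
    (t : ℝ) (x : Fin N → EuclideanSpace ℝ (Fin k)) : ℝ :=
  (1 / 2) * ∑ i, ∑ j, if i ≠ j then Vij i j t (x i - x j) else 0

/-- The Lagrangian action of a `T`-periodic path. -/
def action {N k : ℕ} (T : ℝ) (m : Fin N → ℝ)
    (Vij : Fin N → Fin N → ℝ → EuclideanSpace ℝ (Fin k) → ℝ)
    (X : ℝ → Fin N → EuclideanSpace ℝ (Fin k)) : ℝ :=
  (∑ i, m i / 2 * ∫ t in (0:ℝ)..T, ‖deriv (fun s => X s i) t‖ ^ 2)
    - ∫ t in (0:ℝ)..T, Vtot Vij t (X t)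

namespace Kuhn

variable {G : Type*}

/-- The sequence `x` with its `i`-th entry removed. -/
def skip (i : ℕ) (x : ℕ → G) : ℕ → G := fun j => if j < i then x j else x (j + 1)

/-- The coboundary of a cochain of degree `k`, modulo two. -/
def cobd (k : ℕ) (f : (ℕ → G) → ZMod 2) (x : ℕ → G) : ZMod 2 :=
  ∑ i ∈ Finset.range (k + 2), f (skip i x)

/-- The cup product of the coboundaries of `θ 0, …, θ (D - 1)`. -/
def cup : ℕ → (ℕ → G → ZMod 2) → (ℕ → G) → ZMod 2
  | 0, _, _ => 1
  | D + 1, θ, x => (θ 0 (x 0) + θ 0 (x 1)) * cup D (fun a => θ (a + 1)) (fun j => x (j + 1))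

/-- The cup product of the coboundaries of `θ 0, …, θ (m + D)`, except that the coboundary
of `θ m` is replaced by the function `η`. -/
def cupIns : ℕ → ℕ → (ℕ → G → ZMod 2) → (G → ZMod 2) → (ℕ → G) → ZMod 2
  | 0, D, θ, η, x => η (x 0) * cup D (fun a => θ (a + 1)) x
  | m + 1, D, θ, η, x =>
    (θ 0 (x 0) + θ 0 (x 1)) * cupIns m D (fun a => θ (a + 1)) η (fun j => x (j + 1))

lemma skip_zero (x : ℕ → G) : skip 0 x = fun j => x (j + 1) := by
  funext j; simp [skip]

lemma skip_succ_shift (i : ℕ) (x : ℕ → G) :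
    (fun j => skip (i + 1) x (j + 1)) = skip i (fun j => x (j + 1)) := by
  funext j; simp [skip]

lemma add_self_zmod (a : ZMod 2) : a + a = 0 := CharTwo.add_self_eq_zero a

lemma cobd_mul (k : ℕ) (χ : G → ZMod 2) (f : (ℕ → G) → ZMod 2) (x : ℕ → G) :
    cobd k (fun x => χ (x 0) * f x) x
      = (χ (x 0) + χ (x 1)) * f (fun j => x (j + 1)) + χ (x 0) * cobd k f x := by
  unfold cobd
  rw [Finset.sum_range_succ', Finset.sum_range_succ' (fun i => f (skip i x)), skip_zero]
  have : ∀ i, skip (i + 1) x 0 = x 0 := fun i => by simp [skip]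
  simp only [this, mul_add, Finset.mul_sum]
  linear_combination -add_self_zmod (χ (x 0) * f fun j => x (j + 1))

lemma cobd_edge (k : ℕ) (θ : G → ZMod 2) (f : (ℕ → G) → ZMod 2) (x : ℕ → G) :
    cobd (k + 1) (fun x => (θ (x 0) + θ (x 1)) * f (fun j => x (j + 1))) x
      = (θ (x 0) + θ (x 1)) * cobd k f (fun j => x (j + 1)) := by
  unfold cobd
  rw [Finset.sum_range_succ', Finset.sum_range_succ', Finset.sum_range_succ' _ (k + 1)]
  have h0 : ∀ i, skip (i + 1 + 1) x 0 = x 0 := fun i => by simp [skip]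
  have h1 : ∀ i, skip (i + 1 + 1) x 1 = x 1 := fun i => by simp [skip]
  simp only [skip_succ_shift, h0, h1, mul_add, Finset.mul_sum, skip_zero, zero_add]
  have h2 : skip 1 x 0 = x 0 := by simp [skip]
  have h3 : skip 1 x 1 = x 2 := by simp [skip]
  simp only [h2, h3]
  linear_combination add_self_zmod (θ (x 2) * f fun j => x (j + 2))

lemma cobd_cup (D : ℕ) (θ : ℕ → G → ZMod 2) (x : ℕ → G) : cobd D (cup D θ) x = 0 := by
  induction D generalizing θ x with
  | zero => simp only [cobd, cup]; decide
  | succ D ih =>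
    have := cobd_edge D (θ 0) (cup D (fun a => θ (a + 1))) x
    rw [ih, mul_zero] at this
    exact this

lemma cobd_cupIns (m D : ℕ) (θ : ℕ → G → ZMod 2) (η : G → ZMod 2) (x : ℕ → G) :
    cobd (m + D) (cupIns m D θ η) x = cup (m + D + 1) (Function.update θ m η) x := by
  induction m generalizing θ x with
  | zero =>
    have h := cobd_mul D η (cup D (fun a => θ (a + 1))) x
    rw [cobd_cup, mul_zero, add_zero] at h
    simp only [zero_add]
    refine h.trans ?_
    simp [cup, Function.update]
  | succ m ih =>
    have h := cobd_edge (m + D) (θ 0) (cupIns m D (fun a => θ (a + 1)) η) x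
    rw [ih] at h
    rw [Nat.add_right_comm m 1 D]
    refine h.trans ?_
    have e : (fun a => Function.update θ (m + 1) η (a + 1))
        = Function.update (fun a => θ (a + 1)) m η := by
      funext a; simp [Function.update]
    rw [← e]
    conv_rhs => rw [cup]
    simp [Function.update]

lemma cup_add_update (D : ℕ) (m : ℕ) (hm : m < D) (θ : ℕ → G → ZMod 2) (η η' : G → ZMod 2)
    (x : ℕ → G) : cup D (Function.update θ m (fun g => η g + η' g)) x
      = cup D (Function.update θ m η) x + cup D (Function.update θ m η') x := by
  induction D generalizing θ x m with
  | zero => omega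
  | succ D ih =>
    cases m with
    | zero => simp [cup, Function.update]; ring
    | succ m =>
      have e : ∀ η : G → ZMod 2, (fun a => Function.update θ (m + 1) η (a + 1))
          = Function.update (fun a => θ (a + 1)) m η := by
        intro η; funext a; simp [Function.update]
      simp only [cup, e, ih m (by omega)]
      simp [Function.update]; ring

lemma cup_ne_zero {D : ℕ} {θ : ℕ → G → ZMod 2} {x : ℕ → G} (h : cup D θ x ≠ 0) :
    ∀ a < D, θ a (x a) ≠ θ a (x (a + 1)) := by
  induction D generalizing θ x with
  | zero => intro a ha; omega
  | succ D ih =>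
    intro a ha
    simp only [cup] at h
    cases a with
    | zero =>
      intro e; apply h; rw [zero_add] at e; rw [← e, add_self_zmod, zero_mul]
    | succ a => exact ih (right_ne_zero_of_mul h) a (by omega)

lemma cup_eq_one {D : ℕ} {θ : ℕ → G → ZMod 2} {x : ℕ → G}
    (h : ∀ a < D, θ a (x a) ≠ θ a (x (a + 1))) : cup D θ x = 1 := by
  induction D generalizing θ x with
  | zero => rfl
  | succ D ih =>
    simp only [cup]
    rw [ih (fun a ha => h (a + 1) (by omega)), mul_one]
    have := h 0 (by omega)
    revert this
    generalize θ 0 (x 0) = a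
    rw [zero_add]
    generalize θ 0 (x 1) = b
    revert a b; decide

lemma cupIns_ne_zero {m D : ℕ} {θ : ℕ → G → ZMod 2} {η : G → ZMod 2} {x : ℕ → G}
    (h : cupIns m D θ η x ≠ 0) :
    η (x m) ≠ 0 ∧ ∀ a < m + 1 + D, a ≠ m →
      ∃ j < m + D, θ a (x j) ≠ θ a (x (j + 1)) := by
  induction m generalizing θ x with
  | zero =>
    simp only [cupIns] at h
    refine ⟨left_ne_zero_of_mul h, fun a ha ham => ?_⟩
    have := cup_ne_zero (right_ne_zero_of_mul h) (a - 1) (by omega)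
    refine ⟨a - 1, by omega, ?_⟩
    rwa [show a - 1 + 1 = a by omega] at this ⊢
  | succ m ih =>
    simp only [cupIns] at h
    obtain ⟨h1, h2⟩ := ih (right_ne_zero_of_mul h)
    refine ⟨h1, fun a ha ham => ?_⟩
    cases a with
    | zero =>
      refine ⟨0, by omega, fun e => left_ne_zero_of_mul h ?_⟩
      rw [zero_add] at e; rw [← e, add_self_zmod]
    | succ a =>
      obtain ⟨j, hj, hj'⟩ := h2 a (by omega) (by omega)
      exact ⟨j + 1, by omega, hj'⟩

lemma cup_congr {D : ℕ} {θ : ℕ → G → ZMod 2} {x y : ℕ → G} (h : ∀ j ≤ D, x j = y j) :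
    cup D θ x = cup D θ y := by
  induction D generalizing θ x y with
  | zero => rfl
  | succ D ih =>
    simp only [cup]
    rw [h 0 (by omega), h 1 (by omega), ih (fun j hj => h (j + 1) (by omega))]

lemma cup_congr_fun {D : ℕ} {θ θ' : ℕ → G → ZMod 2} {x : ℕ → G} (h : ∀ a < D, θ a = θ' a) :
    cup D θ x = cup D θ' x := by
  induction D generalizing θ θ' x with
  | zero => rfl
  | succ D ih =>
    simp only [cup]
    rw [h 0 (by omega), ih (fun j hj => h (j + 1) (by omega))]

lemma cupIns_congr {m D : ℕ} {θ : ℕ → G → ZMod 2} {η : G → ZMod 2} {x y : ℕ → G}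
    (h : ∀ j ≤ m + D, x j = y j) : cupIns m D θ η x = cupIns m D θ η y := by
  induction m generalizing θ x y with
  | zero =>
    simp only [cupIns]
    rw [h 0 (by omega), cup_congr (fun j hj => h j (by omega))]
  | succ m ih =>
    simp only [cupIns]
    rw [h 0 (by omega), h 1 (by omega), ih (fun j hj => h (j + 1) (by omega))]

variable [AddCommGroup G]

/-- The lattice path from `g` taking the steps `e (π 0), e (π 1), …`. -/
def kpath {D : ℕ} (e : Fin D → G) (g : G) (π : Equiv.Perm (Fin D)) (j : ℕ) : G :=
  g + ∑ i : Fin D, if i.val < j then e (π i) else 0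

lemma kpath_zero {D : ℕ} (e : Fin D → G) (g : G) (π : Equiv.Perm (Fin D)) :
    kpath e g π 0 = g := by simp [kpath]

lemma kpath_swap {k : ℕ} (e : Fin (k + 1) → G) (g : G) (π : Equiv.Perm (Fin (k + 1)))
    (i : ℕ) (hi : i + 1 < k + 1) (j : ℕ) (hj : j ≠ i + 1) :
    kpath e g (π * Equiv.swap ⟨i, by omega⟩ ⟨i + 1, hi⟩) j = kpath e g π j := by
  unfold kpath
  congr 1
  refine Fintype.sum_equiv (Equiv.swap ⟨i, by omega⟩ ⟨i + 1, hi⟩) _ _ (fun a => ?_)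
  simp only [Equiv.Perm.mul_apply]
  congr 1
  rw [Equiv.swap_apply_def]
  simp only [Fin.ext_iff, eq_iff_iff]
  split_ifs <;> simp <;> omega

lemma kpath_rotate {k : ℕ} (e : Fin (k + 1) → G) (g : G) (π : Equiv.Perm (Fin (k + 1)))
    (j : ℕ) (hj : j ≤ k) :
    kpath e g π (j + 1) = kpath e (g + e (π 0)) (π * finRotate (k + 1)) j := by
  unfold kpath
  rw [Fin.sum_univ_succ, Fin.sum_univ_castSucc (n := k)]
  simp only [Fin.val_zero, Nat.succ_pos, if_true, Fin.val_succ, Nat.add_lt_add_iff_right,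
    Equiv.Perm.mul_apply, Fin.val_castSucc, Fin.val_last]
  rw [if_neg (by omega : ¬ k < j), add_zero, add_assoc]
  congr 2
  refine Finset.sum_congr rfl (fun i _ => ?_)
  rw [finRotate_apply, Fin.coeSucc_eq_succ]

theorem sum_cobd_eq_zero [Fintype G] {k : ℕ} (e : Fin (k + 1) → G) (f : (ℕ → G) → ZMod 2)
    (hf : ∀ x y : ℕ → G, (∀ j ≤ k, x j = y j) → f x = f y) :
    ∑ g : G, ∑ π : Equiv.Perm (Fin (k + 1)), cobd k f (kpath e g π) = 0 := by
  unfold cobd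
  simp only [Finset.sum_range_succ' _ (k + 1), Finset.sum_range_succ _ k]
  simp only [Finset.sum_add_distrib]
  have h1 : ∑ g : G, ∑ π : Equiv.Perm (Fin (k + 1)),
      ∑ i ∈ Finset.range k, f (skip (i + 1) (kpath e g π)) = 0 := by
    refine Finset.sum_eq_zero (fun g _ => ?_)
    rw [Finset.sum_comm]
    refine Finset.sum_eq_zero (fun i hi => ?_)
    have hi' : i + 1 < k + 1 := by simpa using hi
    refine Finset.sum_involution (fun π _ => π * Equiv.swap ⟨i, by omega⟩ ⟨i + 1, hi'⟩)
      ?_ ?_ ?_ ?_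
    · intro π _
      rw [hf (skip (i + 1) (kpath e g (π * _))) (skip (i + 1) (kpath e g π)), add_self_zmod]
      intro j _
      unfold skip
      split_ifs with h
      · exact kpath_swap e g π i hi' j (by omega)
      · exact kpath_swap e g π i hi' (j + 1) (by omega)
    · intro π _ _ h
      have := mul_eq_left.mp h
      rw [Equiv.swap_eq_one_iff] at this
      simp at this
    · intro π _; simp
    · intro π _; simp [mul_assoc]
  have h2 : ∑ g : G, ∑ π : Equiv.Perm (Fin (k + 1)), f (skip 0 (kpath e g π))
      = ∑ g : G, ∑ π : Equiv.Perm (Fin (k + 1)), f (skip (k + 1) (kpath e g π)) := by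
    rw [Finset.sum_comm, Finset.sum_comm (s := Finset.univ (α := G))]
    rw [← Equiv.sum_comp (Equiv.mulRight (finRotate (k + 1)))
      (fun π => ∑ g : G, f (skip (k + 1) (kpath e g π)))]
    refine Finset.sum_congr rfl (fun π _ => ?_)
    rw [← Equiv.sum_comp (Equiv.addRight (e (π 0)))
      (fun g => f (skip (k + 1) (kpath e g _)))]
    refine Finset.sum_congr rfl (fun g _ => hf _ _ (fun j hj => ?_))
    have : skip (k + 1) (kpath e (Equiv.addRight (e (π 0)) g)
        (Equiv.mulRight (finRotate (k + 1)) π)) j =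
          kpath e (g + e (π 0)) (π * finRotate (k + 1)) j := by
      simp [skip, Nat.lt_succ_of_le hj]
    rw [this, ← kpath_rotate e g π j hj, skip_zero]
  rw [h1, h2, zero_add, add_self_zmod]

/-- The mod 2 degree of the labelling `θ` on the region where `χ = 1`. -/
def deg [Fintype G] {D : ℕ} (e : Fin D → G) (χ : G → ZMod 2) (θ : ℕ → G → ZMod 2) : ZMod 2 :=
  ∑ g : G, ∑ π : Equiv.Perm (Fin D), χ g * cup D θ (kpath e g π)

lemma deg_update_eq_zero [Fintype G] {m d : ℕ} (e : Fin (m + d + 1) → G) (χ : G → ZMod 2)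
    (θ : ℕ → G → ZMod 2) (η : G → ZMod 2)
    (H : ∀ g π, cupIns m d θ η (fun j => kpath e g π (j + 1)) ≠ 0 →
      χ (kpath e g π 0) = χ (kpath e g π 1)) :
    deg e χ (Function.update θ m η) = 0 := by
  have h := sum_cobd_eq_zero e (fun x => χ (x 0) * cupIns m d θ η x) (fun x y hxy => by
    rw [hxy 0 (by omega), cupIns_congr hxy])
  rw [← h]
  unfold deg
  refine Finset.sum_congr rfl fun g _ => Finset.sum_congr rfl fun π _ => ?_
  rw [cobd_mul, cobd_cupIns]
  by_cases h0 : cupIns m d θ η (fun j => kpath e g π (j + 1)) = 0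
  · rw [h0, mul_zero, zero_add, kpath_zero]
  · rw [← H g π h0, add_self_zmod, zero_mul, zero_add, kpath_zero]

lemma deg_add_update [Fintype G] {D : ℕ} (e : Fin D → G) (χ : G → ZMod 2) {m : ℕ} (hm : m < D)
    (θ : ℕ → G → ZMod 2) (η η' : G → ZMod 2) :
    deg e χ (Function.update θ m (fun g => η g + η' g))
      = deg e χ (Function.update θ m η) + deg e χ (Function.update θ m η') := by
  simp only [deg, cup_add_update D m hm, mul_add, Finset.sum_add_distrib]

theorem deg_eq_deg [Fintype G] {D : ℕ} (e : Fin D → G) (χ χ' : G → ZMod 2)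
    (θ θ' : ℕ → G → ZMod 2)
    (H : ∀ g π, (∀ a < D, ¬ ∃ c, ∀ j ≤ D, θ a (kpath e g π j) = c ∧ θ' a (kpath e g π j) = c) →
      ∃ c, ∀ j ≤ D, χ (kpath e g π j) = c ∧ χ' (kpath e g π j) = c) :
    deg e χ θ = deg e χ' θ' := by
  have key : ∀ m ≤ D, deg e χ (fun a => if a < m then θ' a else θ a) = deg e χ θ := by
    intro m
    induction m with
    | zero => intro _; simp
    | succ m ih =>
      intro hm
      rw [← ih (by omega)]
      set μ : ℕ → G → ZMod 2 := fun a => if a < m then θ' a else θ a with hμ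
      have e1 : (fun a => if a < m + 1 then θ' a else θ a) = Function.update μ m (θ' m) := by
        funext a
        rcases lt_trichotomy a m with h | h | h
        · simp [hμ, Function.update, h, h.ne, Nat.lt_succ_of_lt h]
        · subst h; simp
        · simp [hμ, Function.update, h.ne', not_lt.2 h.le, Nat.not_lt.2 (Nat.succ_le_of_lt h)]
      have e2 : μ = Function.update μ m (θ m) := by
        rw [eq_comm, Function.update_eq_self_iff]; simp [hμ]
      have h0 : deg e χ (Function.update μ m (fun g => θ' m g + θ m g)) = 0 := by
        obtain ⟨d, rfl⟩ : ∃ d, D = m + d + 1 := ⟨D - m - 1, by omega⟩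
        refine deg_update_eq_zero e χ μ _ fun g π hne => ?_
        obtain ⟨hη, hc⟩ := cupIns_ne_zero hne
        obtain ⟨c, hc'⟩ := H g π (fun a ha ⟨c, hc'⟩ => by
          by_cases ham : a = m
          · subst ham
            refine hη ?_
            simp only [(hc' (a + 1) (by omega)).1, (hc' (a + 1) (by omega)).2, add_self_zmod]
          · obtain ⟨j, hj, hne⟩ := hc a (by omega) ham
            refine hne ?_
            simp only [hμ]
            split_ifs
            · rw [(hc' (j + 1) (by omega)).2, (hc' (j + 1 + 1) (by omega)).2]
            · rw [(hc' (j + 1) (by omega)).1, (hc' (j + 1 + 1) (by omega)).1])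
        rw [(hc' 0 (by omega)).1, (hc' 1 (by omega)).1]
      rw [deg_add_update e χ (by omega)] at h0
      rw [e1]
      conv_rhs => rw [e2]
      exact CharTwo.add_eq_zero.1 h0
  have h1 : deg e χ θ = deg e χ θ' := by
    rw [← key D le_rfl]
    unfold deg
    refine Finset.sum_congr rfl fun g _ => Finset.sum_congr rfl fun π _ => ?_
    rw [cup_congr_fun (θ' := θ') (fun a ha => by simp [ha])]
  rw [h1]
  unfold deg
  refine Finset.sum_congr rfl fun g _ => Finset.sum_congr rfl fun π _ => ?_
  by_cases h0 : cup D θ' (kpath e g π) = 0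
  · rw [h0, mul_zero, mul_zero]
  · have := cup_ne_zero h0
    obtain ⟨c, hc⟩ := H g π (fun a ha ⟨c, hc'⟩ => this a ha
      (by rw [(hc' a (by omega)).2, (hc' (a + 1) (by omega)).2]))
    rw [← kpath_zero e g π, (hc 0 (by omega)).1, (hc 0 (by omega)).2]

end Kuhn

namespace Kuhn

/-- The point of the real grid with step `1 / L` that represents `g`. -/
def pt {D L : ℕ} (g : Fin D → ZMod L) : Fin D → ℝ := fun a => (g a).val / L

/-- The labelling of grid points by the signs of the components of `z`. -/
def sgnLabel {D L : ℕ} (z : (Fin D → ℝ) → Fin D → ℝ) (a : ℕ) (g : Fin D → ZMod L) : ZMod 2 :=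
  open Classical in if h : a < D then (if 0 < z (pt g) ⟨a, h⟩ then 1 else 0) else 0

/-- The labelling of grid points by the sign of `w`. -/
def posLabel {D L : ℕ} (w : (Fin D → ℝ) → ℝ) (g : Fin D → ZMod L) : ZMod 2 :=
  open Classical in if 0 < w (pt g) then 1 else 0

/-- The real lattice path that lifts `kpath`. -/
def liftPath {D L : ℕ} (g : Fin D → ZMod L) (π : Equiv.Perm (Fin D)) (j : ℕ) : Fin D → ℝ :=
  fun a => pt g a + if (π⁻¹ a).val < j then 1 / (L : ℝ) else 0

lemma liftPath_zero {D L : ℕ} (g : Fin D → ZMod L) (π : Equiv.Perm (Fin D)) :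
    liftPath g π 0 = pt g := by
  funext a; simp [liftPath]

lemma kpath_single {D L : ℕ} (g : Fin D → ZMod L) (π : Equiv.Perm (Fin D)) (j : ℕ) (a : Fin D) :
    kpath (fun a => Pi.single a (1 : ZMod L)) g π j a
      = g a + if (π⁻¹ a).val < j then 1 else 0 := by
  simp only [kpath, Pi.add_apply, Finset.sum_apply]
  congr 1
  rw [Finset.sum_eq_single (π⁻¹ a)]
  · split_ifs <;> simp
  · intro b _ hb
    have : a ≠ π b := fun h => hb (by rw [h]; simp)
    split_ifs <;> simp [this]
  · simp

lemma exists_pt_kpath {D L : ℕ} [NeZero L] (g : Fin D → ZMod L) (π : Equiv.Perm (Fin D)) (j : ℕ) :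
    ∃ v : Fin D → ℤ, liftPath g π j
      = fun a => pt (kpath (fun a => Pi.single a (1 : ZMod L)) g π j) a + v a := by
  have hL : (L : ℝ) ≠ 0 := Nat.cast_ne_zero.2 (NeZero.ne L)
  refine ⟨fun a => (((g a).val : ℤ) + if (π⁻¹ a).val < j then 1 else 0) / (L : ℤ), ?_⟩
  funext a
  set n : ℤ := ((g a).val : ℤ) + if (π⁻¹ a).val < j then 1 else 0 with hn
  have h1 : kpath (fun a => Pi.single a (1 : ZMod L)) g π j a = (n : ZMod L) := by
    rw [kpath_single, hn]; push_cast; simp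
  have h2 : ((kpath (fun a => Pi.single a (1 : ZMod L)) g π j a).val : ℤ) = n % L := by
    rw [h1, ZMod.val_intCast]
  have h3 : ((kpath (fun a => Pi.single a (1 : ZMod L)) g π j a).val : ℝ) = ((n % L : ℤ) : ℝ) := by
    rw [← h2]; simp
  have h4 : (n : ℝ) = ((n % L : ℤ) : ℝ) + L * ((n / L : ℤ) : ℝ) := by
    exact_mod_cast (Int.emod_add_mul_ediv n L).symm
  have h5 : liftPath g π j a = n / L := by
    simp only [liftPath, pt, hn]; push_cast
    split_ifs
    · field_simp
    · field_simp; ring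
  change _ = pt _ a + ((n / L : ℤ) : ℝ)
  rw [h5, pt, h3, h4]
  field_simp

lemma abs_liftPath_sub {D L : ℕ} (g : Fin D → ZMod L) (π : Equiv.Perm (Fin D)) (j : ℕ)
    (a : Fin D) : |liftPath g π j a - pt g a| ≤ 1 / L := by
  simp only [liftPath, add_sub_cancel_left]
  split_ifs
  · rw [abs_of_nonneg (by positivity)]
  · simp

lemma exists_mem_Icc_add_int {D : ℕ} (x : Fin D → ℝ) :
    ∃ y ∈ Set.Icc (0 : Fin D → ℝ) 1, ∃ v : Fin D → ℤ, x = fun a => y a + v a :=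
  ⟨fun a => Int.fract (x a), ⟨fun a => Int.fract_nonneg _, fun a => (Int.fract_lt_one _).le⟩,
    fun a => ⌊x a⌋, by funext a; simp⟩

lemma sgnLabel_kpath {D L : ℕ} [NeZero L] {z : (Fin D → ℝ) → Fin D → ℝ}
    (hz : ∀ x (v : Fin D → ℤ), z (fun a => x a + v a) = z x)
    (g : Fin D → ZMod L) (π : Equiv.Perm (Fin D)) (j : ℕ) (a : Fin D) :
    open Classical in
    sgnLabel z a (kpath (fun a => Pi.single a (1 : ZMod L)) g π j)
      = if 0 < z (liftPath g π j) a then 1 else 0 := by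
  obtain ⟨v, hv⟩ := exists_pt_kpath g π j
  rw [hv, hz]
  simp [sgnLabel]

lemma posLabel_kpath {D L : ℕ} [NeZero L] {w : (Fin D → ℝ) → ℝ}
    (hw : ∀ x (v : Fin D → ℤ), w (fun a => x a + v a) = w x)
    (g : Fin D → ZMod L) (π : Equiv.Perm (Fin D)) (j : ℕ) :
    open Classical in
    posLabel w (kpath (fun a => Pi.single a (1 : ZMod L)) g π j)
      = if 0 < w (liftPath g π j) then 1 else 0 := by
  obtain ⟨v, hv⟩ := exists_pt_kpath g π j
  rw [hv, hw]
  simp [posLabel]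


lemma pos_iff_pos_of_abs_sub_lt {a b ε : ℝ} (ha : ε ≤ |a|) (h : |b - a| < ε) : 0 < b ↔ 0 < a := by
  rw [abs_sub_lt_iff] at h
  rcases le_abs.1 ha with h1 | h1 <;> constructor <;> intro h2 <;> linarith

/-- If all the labels of the components of `z` change along a lattice path, then `z` is small at
its starting point. -/
lemma norm_lt_of_label_change {D : ℕ} {ε : ℝ} (hε : 0 < ε) {ι : Type*} {z₀ : Fin D → ℝ}
    {Z : ι → Fin D → ℝ} (hZ : ∀ i a, |Z i a - z₀ a| < ε)
    (h : ∀ a, ¬ ∃ c : ZMod 2, open Classical in ∀ i, (if 0 < Z i a then (1 : ZMod 2) else 0) = c) :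
    ‖z₀‖ < ε := by
  classical
  rw [pi_norm_lt_iff hε]
  intro a
  by_contra! hle
  refine h a ⟨if 0 < z₀ a then 1 else 0, fun i => ?_⟩
  simp only [pos_iff_pos_of_abs_sub_lt hle (hZ i a)]

variable {D L : ℕ}

lemma norm_lt_of_cup_ne_zero [NeZero L] {ε : ℝ} (hε : 0 < ε) {z : (Fin D → ℝ) → Fin D → ℝ}
    (hz : ∀ x (v : Fin D → ℤ), z (fun a => x a + v a) = z x)
    {g : Fin D → ZMod L} {π : Equiv.Perm (Fin D)}
    (hu : ∀ j a, |z (liftPath g π j) a - z (pt g) a| < ε)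
    (h : cup D (sgnLabel z) (kpath (fun a => Pi.single a (1 : ZMod L)) g π) ≠ 0) :
    ‖z (pt g)‖ < ε := by
  classical
  refine norm_lt_of_label_change hε hu fun a ⟨c, hc⟩ => ?_
  refine cup_ne_zero h a a.2 ?_
  rw [sgnLabel_kpath hz, sgnLabel_kpath hz, hc, hc]

lemma deg_step [NeZero L] {ε : ℝ} (hε : 0 < ε) {z z' : (Fin D → ℝ) → Fin D → ℝ}
    {w w' : (Fin D → ℝ) → ℝ}
    (hz : ∀ x (v : Fin D → ℤ), z (fun a => x a + v a) = z x)
    (hz' : ∀ x (v : Fin D → ℤ), z' (fun a => x a + v a) = z' x)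
    (hw : ∀ x (v : Fin D → ℤ), w (fun a => x a + v a) = w x)
    (hw' : ∀ x (v : Fin D → ℤ), w' (fun a => x a + v a) = w' x)
    (hne : ∀ x, ε ≤ ‖z x‖ ∨ ε ≤ |w x|)
    (hu : ∀ (g : Fin D → ZMod L) π j a, |z (liftPath g π j) a - z (pt g) a| < ε)
    (hu' : ∀ (g : Fin D → ZMod L) π j a, |z' (liftPath g π j) a - z (pt g) a| < ε)
    (hv : ∀ (g : Fin D → ZMod L) π j, |w (liftPath g π j) - w (pt g)| < ε)
    (hv' : ∀ (g : Fin D → ZMod L) π j, |w' (liftPath g π j) - w (pt g)| < ε) :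
    deg (fun a => Pi.single a (1 : ZMod L)) (posLabel w) (sgnLabel z)
      = deg (fun a => Pi.single a (1 : ZMod L)) (posLabel w') (sgnLabel z') := by
  classical
  refine deg_eq_deg _ _ _ _ _ fun g π h => ?_
  have h1 : ‖z (pt g)‖ < ε := by
    refine norm_lt_of_label_change hε (ι := ℕ ⊕ ℕ)
      (Z := Sum.elim (fun j => z (liftPath g π j)) (fun j => z' (liftPath g π j))) ?_ ?_
    · rintro (j | j) a
      · exact hu g π j a
      · exact hu' g π j a
    · rintro a ⟨c, hc⟩
      refine h a a.2 ⟨c, fun j _ => ?_⟩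
      rw [sgnLabel_kpath hz, sgnLabel_kpath hz']
      exact ⟨hc (Sum.inl j), hc (Sum.inr j)⟩
  have h2 : ε ≤ |w (pt g)| := (hne _).resolve_left (not_le.2 h1)
  refine ⟨if 0 < w (pt g) then 1 else 0, fun j _ => ?_⟩
  rw [posLabel_kpath hw, posLabel_kpath hw']
  simp only [pos_iff_pos_of_abs_sub_lt h2 (hv g π j), pos_iff_pos_of_abs_sub_lt h2 (hv' g π j),
    and_self]

/-- The degree at the standard stage is one. -/
lemma deg_standard [NeZero L] {ε δ : ℝ} (hε : 0 < ε) (hL : 1 / (L : ℝ) < δ / 2) (hδ : δ ≤ 1)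
    {z : (Fin D → ℝ) → Fin D → ℝ} {w : (Fin D → ℝ) → ℝ}
    (hz : ∀ x (v : Fin D → ℤ), z (fun a => x a + v a) = z x)
    (hu : ∀ (g : Fin D → ZMod L) π j a, |z (liftPath g π j) a - z (pt g) a| < ε)
    (hfar : ∀ x ∈ Set.Icc (0 : Fin D → ℝ) 1, 0 < w x → ‖z x‖ < ε →
      ∀ a, x a < δ / 2 ∨ 1 - δ / 2 < x a)
    (hloc : ∀ x : Fin D → ℝ, (∀ a, |x a| < δ) → (∀ a, 0 < z x a ↔ 0 < x a) ∧ 0 < w x) :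
    deg (fun a => Pi.single a (1 : ZMod L)) (posLabel w) (sgnLabel z) = 1 := by
  classical
  have hL0 : (0 : ℝ) < L := Nat.cast_pos.2 (NeZero.pos L)
  have hL1 : 0 < 1 / (L : ℝ) := by positivity
  have hpt0 : (pt (0 : Fin D → ZMod L)) = 0 := by funext a; simp [pt]
  unfold deg
  rw [Finset.sum_eq_single (0 : Fin D → ZMod L)]
  rotate_left
  · intro g _ hg
    refine Finset.sum_eq_zero fun π _ => ?_
    by_contra hne
    refine hg ?_
    have hχ : 0 < w (pt g) := by
      by_contra h
      exact left_ne_zero_of_mul hne (by simp [posLabel, h])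
    have hcup := right_ne_zero_of_mul hne
    have hzs := norm_lt_of_cup_ne_zero hε hz (hu g π) hcup
    have hmem : pt g ∈ Set.Icc (0 : Fin D → ℝ) 1 := by
      refine ⟨fun a => by simp only [pt]; positivity, fun a => ?_⟩
      simp only [pt, Pi.one_apply]
      rw [div_le_one hL0]
      exact_mod_cast (ZMod.val_lt (g a)).le
    have hnear := hfar _ hmem hχ hzs
    set n : Fin D → ℤ := fun a => if pt g a < δ / 2 then 0 else -1 with hn
    have hy : ∀ j, (∀ a, |liftPath g π j a + n a| < δ) := by
      intro j a
      have h1 := abs_liftPath_sub g π j a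
      have h2 : |pt g a + n a| < δ / 2 := by
        simp only [hn]
        have h3 := hmem.1 a
        have h4 := hmem.2 a
        simp only [Pi.zero_apply, Pi.one_apply] at h3 h4
        rw [abs_lt]
        rcases hnear a with h | h
        · rw [if_pos h]; push_cast; constructor <;> linarith
        · rw [if_neg (by linarith)]; push_cast; constructor <;> linarith
      calc |liftPath g π j a + n a| = |(liftPath g π j a - pt g a) + (pt g a + n a)| := by ring_nf
        _ ≤ _ := abs_add_le _ _
        _ < δ := by linarith
    funext a
    have hch := cup_ne_zero hcup a a.2
    rw [sgnLabel_kpath hz, sgnLabel_kpath hz, ← hz _ n, ← hz (liftPath g π (a + 1)) n] at hch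
    simp only [(hloc _ (hy _)).1] at hch
    have h5 : pt g a + n a = 0 := by
      simp only [liftPath, pt] at hch ⊢
      have hLn : (((g a).val : ℤ) + L * n a : ℝ) / L = ((g a).val : ℝ) / L + n a := by
        field_simp; push_cast; ring
      rw [← hLn]
      set q : ℤ := ((g a).val : ℤ) + L * n a with hq
      have hqq : (((g a).val : ℤ) + L * n a : ℝ) = q := by rw [hq]; push_cast; ring
      rw [hqq] at hLn ⊢
      have e1 : ∀ s : ℝ, 0 < ((g a).val : ℝ) / L + s + n a ↔ 0 < (q : ℝ) / L + s := by
        intro s; rw [hLn]; constructor <;> intro h <;> linarith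
      simp only [e1] at hch
      have e2 : (0 < (q : ℝ) / L + 1 / L) ↔ 0 ≤ q := by
        rw [← add_div, div_pos_iff_of_pos_right hL0]
        constructor
        · intro h
          have : (0 : ℤ) < q + 1 := by exact_mod_cast h
          omega
        · intro h
          have : (0 : ℝ) ≤ q := by exact_mod_cast h
          linarith
      have e3 : (0 < (q : ℝ) / L + 0) ↔ 0 < q := by
        rw [add_zero, div_pos_iff_of_pos_right hL0]; exact Int.cast_pos
      by_cases c1 : (π⁻¹ a).val < a.val
      · have c2 : (π⁻¹ a).val < a.val + 1 := by omega
        simp only [if_pos c1, if_pos c2, ne_eq, not_true] at hch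
      · by_cases c2 : (π⁻¹ a).val < a.val + 1
        · simp only [if_neg c1, if_pos c2, e2, e3] at hch
          have : q = 0 := by
            by_contra hq0
            apply hch
            by_cases h6 : 0 < q
            · rw [if_pos h6, if_pos h6.le]
            · rw [if_neg h6, if_neg (by omega)]
          rw [this]; simp
        · simp only [if_neg c1, if_neg c2, ne_eq, not_true] at hch
    have h6 : pt g a < 1 := by
      simp only [pt]
      rw [div_lt_one hL0]
      exact_mod_cast ZMod.val_lt (g a)
    have h7 : n a = 0 := by
      simp only [hn] at h5 ⊢
      split_ifs at h5 ⊢ with h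
      · rfl
      · push_cast at h5; linarith
    rw [h7] at h5
    simp only [pt, Int.cast_zero, add_zero, div_eq_zero_iff, hL0.ne', or_false,
      Nat.cast_eq_zero] at h5
    simpa using h5
  · simp
  have hlift : ∀ (π : Equiv.Perm (Fin D)) j a, |liftPath (0 : Fin D → ZMod L) π j a| < δ := by
    intro π j a
    have := abs_liftPath_sub (0 : Fin D → ZMod L) π j a
    rw [hpt0] at this
    simp only [Pi.zero_apply, sub_zero] at this
    linarith
  have hpos : posLabel w (0 : Fin D → ZMod L) = 1 := by
    have := (hloc _ (hlift 1 0)).2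
    rw [liftPath_zero] at this
    simp [posLabel, this]
  simp only [hpos, one_mul]
  have hlab : ∀ (π : Equiv.Perm (Fin D)) (a : Fin D) j,
      sgnLabel z a (kpath (fun a => Pi.single a (1 : ZMod L)) 0 π j)
        = if (π⁻¹ a).val < j then 1 else 0 := by
    intro π a j
    rw [sgnLabel_kpath hz]
    simp only [(hloc _ (hlift π j)).1, liftPath, hpt0, Pi.zero_apply, zero_add]
    by_cases c : (π⁻¹ a).val < j
    · simp only [if_pos c, if_pos hL1]
    · simp only [if_neg c, lt_irrefl, if_false]
  rw [Finset.sum_eq_single (1 : Equiv.Perm (Fin D))]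
  · refine cup_eq_one fun a ha => ?_
    have h1 := hlab 1 ⟨a, ha⟩ a
    have h2 := hlab 1 ⟨a, ha⟩ (a + 1)
    simp only at h1 h2
    rw [h1, h2]
    simp
  · intro π _ hπ
    by_contra hne
    refine hπ ?_
    have h : ∀ a : Fin D, (π⁻¹ a).val = a.val := by
      intro a
      have h1 := cup_ne_zero hne a a.2
      rw [hlab, hlab] at h1
      by_cases c1 : (π⁻¹ a).val < a.val
      · rw [if_pos c1, if_pos (by omega)] at h1; exact absurd rfl h1
      · by_cases c2 : (π⁻¹ a).val < a.val + 1
        · omega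
        · rw [if_neg c1, if_neg c2] at h1; exact absurd rfl h1
    have : π⁻¹ = 1 := by ext a; exact h a
    rwa [inv_eq_one] at this
  · simp

/-- The existence theorem for zeros on a torus, under a homotopy to a standard map. -/
theorem exists_zero_of_homotopy (z : ℝ → (Fin D → ℝ) → Fin D → ℝ) (w : ℝ → (Fin D → ℝ) → ℝ)
    (hzc : Continuous fun p : ℝ × (Fin D → ℝ) => z p.1 p.2)
    (hwc : Continuous fun p : ℝ × (Fin D → ℝ) => w p.1 p.2)
    (hz : ∀ s x (v : Fin D → ℤ), z s (fun a => x a + v a) = z s x)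
    (hw : ∀ s x (v : Fin D → ℤ), w s (fun a => x a + v a) = w s x)
    (hne : ∀ s ∈ Set.Icc (0 : ℝ) 1, ∀ x, z s x = 0 → w s x ≠ 0)
    (hstd : ∀ x, z 0 x = 0 → 0 ≤ w 0 x → ∃ v : Fin D → ℤ, x = fun a => (v a : ℝ))
    {δ : ℝ} (hδ : 0 < δ)
    (hloc : ∀ x : Fin D → ℝ, (∀ a, |x a| < δ) → (∀ a, 0 < z 0 x a ↔ 0 < x a) ∧ 0 < w 0 x) :
    ∃ x, z 1 x = 0 ∧ 0 < w 1 x := by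
  classical
  by_contra! hno
  wlog hδ1 : δ ≤ 1 generalizing δ
  · exact this one_pos (fun x hx => hloc x fun a => (hx a).trans (not_le.1 hδ1)) le_rfl
  have hzs : ∀ s, Continuous (z s) := fun s => hzc.comp (by fun_prop : Continuous fun x => (s, x))
  have hws : ∀ s, Continuous (w s) := fun s => hwc.comp (by fun_prop : Continuous fun x => (s, x))
  obtain ⟨ε₁, hε₁, h₁⟩ := ((isCompact_Icc (a := (0 : ℝ)) (b := 1)).prod
    (isCompact_Icc (a := (0 : Fin D → ℝ)) (b := 1))).exists_forall_le'
    (f := fun p => max ‖z p.1 p.2‖ |w p.1 p.2|) (a := 0)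
    (by fun_prop) (by
      rintro ⟨s, x⟩ ⟨hs, _⟩
      by_cases h : z s x = 0
      · exact lt_max_of_lt_right (abs_pos.2 (hne s hs x h))
      · exact lt_max_of_lt_left (norm_pos_iff.2 h))
  obtain ⟨ε₂, hε₂, h₂⟩ := (((isCompact_Icc (a := (0 : Fin D → ℝ)) (b := 1)).inter_right
    (isClosed_le continuous_const (hws 1)))).exists_forall_le' (f := fun x => ‖z 1 x‖) (a := 0)
    (by fun_prop) (by
      rintro x ⟨_, hx⟩
      refine norm_pos_iff.2 fun h => ?_
      exact hne 1 (by simp) x h (le_antisymm (hno x h) hx))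
  obtain ⟨ε₃, hε₃, h₃⟩ := ((((isCompact_Icc (a := (0 : Fin D → ℝ)) (b := 1)).inter_right
    (isClosed_le continuous_const (hws 0)))).inter_right
    (isClosed_iUnion_of_finite (s := fun a : Fin D => {x : Fin D → ℝ | δ / 2 ≤ x a} ∩
      {x | x a ≤ 1 - δ / 2}) fun a => (isClosed_le continuous_const (continuous_apply a)).inter
        (isClosed_le (continuous_apply a) continuous_const))).exists_forall_le'
    (f := fun x => ‖z 0 x‖) (a := 0) (by fun_prop) (by
      rintro x ⟨⟨_, hx⟩, hx'⟩
      refine norm_pos_iff.2 fun h => ?_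
      obtain ⟨v, hv⟩ := hstd x h hx
      obtain ⟨a, ha1, ha2⟩ := Set.mem_iUnion.1 hx'
      rw [hv] at ha1 ha2
      simp only [Set.mem_ofPred_eq] at ha1 ha2
      have h1 : (0 : ℤ) < v a := by
        have : (0 : ℝ) < v a := by linarith
        exact_mod_cast this
      have h2 : v a < (1 : ℤ) := by
        have : (v a : ℝ) < 1 := by linarith
        exact_mod_cast this
      omega)
  obtain ⟨ε, hε, hεle⟩ : ∃ ε > 0, ε ≤ ε₁ ∧ ε ≤ ε₂ ∧ ε ≤ ε₃ :=
    ⟨min ε₁ (min ε₂ ε₃), lt_min hε₁ (lt_min hε₂ hε₃), min_le_left _ _,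
      (min_le_right _ _).trans (min_le_left _ _), (min_le_right _ _).trans (min_le_right _ _)⟩
  have huc := (((isCompact_Icc (a := (0 : ℝ)) (b := 1)).prod
    (isCompact_Icc (a := (0 : Fin D → ℝ)) (b := 2))).uniformContinuousOn_of_continuous
    (f := fun p => (z p.1 p.2, w p.1 p.2)) (by fun_prop))
  rw [Metric.uniformContinuousOn_iff] at huc
  obtain ⟨ρ, hρ, hu⟩ := huc ε hε
  obtain ⟨L, hL⟩ := exists_nat_gt (1 / min (ρ) (δ / 2))
  have hm : 0 < min ρ (δ / 2) := lt_min hρ (by linarith)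
  have hL0 : (0 : ℝ) < L := lt_trans (by positivity) hL
  have : NeZero L := ⟨by rintro rfl; simp at hL0⟩
  have hLm : 1 / (L : ℝ) < min ρ (δ / 2) := by
    rw [div_lt_iff₀ hL0]; rwa [div_lt_iff₀ hm, mul_comm] at hL
  have hLρ := hLm.trans_le (min_le_left _ _)
  have hLδ := hLm.trans_le (min_le_right _ _)
  have hptmem : ∀ g : Fin D → ZMod L, pt g ∈ Set.Icc (0 : Fin D → ℝ) 1 := by
    refine fun g => ⟨fun a => by simp only [pt, Pi.zero_apply]; positivity, fun a => ?_⟩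
    simp only [pt, Pi.one_apply]
    rw [div_le_one hL0]
    exact_mod_cast (ZMod.val_lt (g a)).le
  have hmain : ∀ s ∈ Set.Icc (0 : ℝ) 1, ∀ s' ∈ Set.Icc (0 : ℝ) 1, |s' - s| < ρ →
      ∀ (g : Fin D → ZMod L) π j, dist (z s' (liftPath g π j), w s' (liftPath g π j))
        (z s (pt g), w s (pt g)) < ε := by
    intro s hs s' hs' hss g π j
    refine hu (s', liftPath g π j) ⟨hs', ?_⟩ (s, pt g) ⟨hs, (hptmem g).1, ?_⟩ ?_
    · have h3 := fun a => (abs_le.1 (abs_liftPath_sub g π j a)).2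
      have h4 := fun a => (hptmem g).2 a
      have h5 := fun a => (hptmem g).1 a
      simp only [Pi.one_apply, Pi.zero_apply] at h4 h5
      refine ⟨fun a => ?_, fun a => ?_⟩
      · have h6 : (0 : ℝ) ≤ if (π⁻¹ a).val < j then 1 / (L : ℝ) else 0 := by positivity
        exact add_nonneg (h5 a) h6
      · have : (2 : Fin D → ℝ) a = 2 := rfl
        rw [this]
        linarith [h3 a, h4 a]
    · intro a
      have : (2 : Fin D → ℝ) a = 2 := rfl
      have h4 := (hptmem g).2 a
      rw [this]
      simp only [Pi.one_apply] at h4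
      linarith
    · rw [Prod.dist_eq, max_lt_iff]
      refine ⟨by rwa [Real.dist_eq], ?_⟩
      rw [dist_pi_lt_iff hρ]
      exact fun a => by
        rw [Real.dist_eq]; exact (abs_liftPath_sub g π j a).trans_lt hLρ
  have hmz : ∀ s ∈ Set.Icc (0 : ℝ) 1, ∀ s' ∈ Set.Icc (0 : ℝ) 1, |s' - s| < ρ →
      ∀ (g : Fin D → ZMod L) π j a, |z s' (liftPath g π j) a - z s (pt g) a| < ε := by
    intro s hs s' hs' hss g π j a
    have := hmain s hs s' hs' hss g π j
    rw [Prod.dist_eq, max_lt_iff, dist_pi_lt_iff hε] at this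
    have := this.1 a
    rwa [Real.dist_eq] at this
  have hmw : ∀ s ∈ Set.Icc (0 : ℝ) 1, ∀ s' ∈ Set.Icc (0 : ℝ) 1, |s' - s| < ρ →
      ∀ (g : Fin D → ZMod L) π j, |w s' (liftPath g π j) - w s (pt g)| < ε := by
    intro s hs s' hs' hss g π j
    have := hmain s hs s' hs' hss g π j
    rw [Prod.dist_eq, max_lt_iff] at this
    have := this.2
    rwa [Real.dist_eq] at this
  have hself : ∀ s : ℝ, |s - s| < ρ := fun s => by simpa using hρ
  have hne' : ∀ s ∈ Set.Icc (0 : ℝ) 1, ∀ x, ε ≤ ‖z s x‖ ∨ ε ≤ |w s x| := by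
    intro s hs x
    obtain ⟨y, hy, v, rfl⟩ := exists_mem_Icc_add_int x
    rw [hz, hw]
    exact le_max_iff.1 (hεle.1.trans (h₁ (s, y) ⟨hs, hy⟩))
  have hstep : ∀ s ∈ Set.Icc (0 : ℝ) 1, ∀ s' ∈ Set.Icc (0 : ℝ) 1, |s' - s| < ρ →
      deg (fun a => Pi.single a (1 : ZMod L)) (posLabel (w s)) (sgnLabel (z s))
        = deg (fun a => Pi.single a (1 : ZMod L)) (posLabel (w s')) (sgnLabel (z s')) :=
    fun s hs s' hs' hss => deg_step hε (hz s) (hz s') (hw s) (hw s') (hne' s hs)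
      (hmz s hs s hs (hself s)) (hmz s hs s' hs' hss) (hmw s hs s hs (hself s))
      (hmw s hs s' hs' hss)
  have hdeg0 : deg (fun a => Pi.single a (1 : ZMod L)) (posLabel (w 0)) (sgnLabel (z 0)) = 1 := by
    refine deg_standard hε hLδ hδ1 (hz 0) (hmz 0 (by simp) 0 (by simp) (hself 0)) ?_ hloc
    intro x hx hwx hzx a
    by_contra! hcon
    have := h₃ x ⟨⟨hx, hwx.le⟩, Set.mem_iUnion.2 ⟨a, hcon.1, hcon.2⟩⟩
    linarith [hεle.2.2]
  have hdeg1 : deg (fun a => Pi.single a (1 : ZMod L)) (posLabel (w 1)) (sgnLabel (z 1)) = 0 := by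
    unfold deg
    refine Finset.sum_eq_zero fun g _ => Finset.sum_eq_zero fun π _ => ?_
    by_contra hcon
    have hχ : 0 < w 1 (pt g) := by
      by_contra h
      exact left_ne_zero_of_mul hcon (by simp [posLabel, h])
    have h4 := norm_lt_of_cup_ne_zero hε (hz 1) (hmz 1 (by simp) 1 (by simp) (hself 1) g π)
      (right_ne_zero_of_mul hcon)
    have := h₂ (pt g) ⟨hptmem g, hχ.le⟩
    linarith [hεle.2.1]
  obtain ⟨S, hS⟩ := exists_nat_gt (1 / ρ)
  have hS0 : (0 : ℝ) < S := lt_trans (by positivity) hS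
  have hchain : ∀ i ≤ S, deg (fun a => Pi.single a (1 : ZMod L)) (posLabel (w ((i : ℝ) / S)))
      (sgnLabel (z ((i : ℝ) / S))) = 1 := by
    intro i
    induction i with
    | zero => intro _; simpa using hdeg0
    | succ i ih =>
      intro hi
      rw [← ih (by omega)]
      have hi' : ((i : ℝ) + 1) ≤ S := by exact_mod_cast hi
      refine (hstep _ ⟨by positivity, ?_⟩ _ ⟨by positivity, ?_⟩ ?_).symm
      · rw [div_le_one hS0]; linarith
      · rw [div_le_one hS0]; push_cast; exact hi'
      · rw [← sub_div]; push_cast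
        rw [add_sub_cancel_left, abs_of_pos (by positivity), div_lt_iff₀ hS0]
        rwa [div_lt_iff₀ hρ, mul_comm] at hS
  have := hchain S le_rfl
  rw [div_self hS0.ne', hdeg1] at this
  exact zero_ne_one this

end Kuhn

namespace Kuhn

/-- `exists_zero_of_homotopy` for an arbitrary finite index type. -/
theorem exists_zero_of_homotopy_fintype {ι : Type*} [Fintype ι]
    (z : ℝ → (ι → ℝ) → ι → ℝ) (w : ℝ → (ι → ℝ) → ℝ)
    (hzc : Continuous fun p : ℝ × (ι → ℝ) => z p.1 p.2)
    (hwc : Continuous fun p : ℝ × (ι → ℝ) => w p.1 p.2)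
    (hz : ∀ s x (v : ι → ℤ), z s (fun a => x a + v a) = z s x)
    (hw : ∀ s x (v : ι → ℤ), w s (fun a => x a + v a) = w s x)
    (hne : ∀ s ∈ Set.Icc (0 : ℝ) 1, ∀ x, z s x = 0 → w s x ≠ 0)
    (hstd : ∀ x, z 0 x = 0 → 0 ≤ w 0 x → ∃ v : ι → ℤ, x = fun a => (v a : ℝ))
    (hloc : ∀ᶠ x in nhds (0 : ι → ℝ), (∀ a, 0 < z 0 x a ↔ 0 < x a) ∧ 0 < w 0 x) :
    ∃ x, z 1 x = 0 ∧ 0 < w 1 x := by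
  let e := Fintype.equivFin ι
  obtain ⟨δ, hδ, hball⟩ := Metric.eventually_nhds_iff.1 hloc
  have hc : ∀ {x : Fin (Fintype.card ι) → ℝ} {s : ℝ},
      (fun a => z s (x ∘ e) (e.symm a)) = 0 → z s (x ∘ e) = 0 := fun h => by
    funext a; simpa using congrFun h (e a)
  obtain ⟨x, h1, h2⟩ := exists_zero_of_homotopy (δ := δ)
    (fun s x a => z s (x ∘ e) (e.symm a)) (fun s x => w s (x ∘ e))
    (continuous_pi fun a => (continuous_apply (e.symm a)).comp
      (hzc.comp (continuous_fst.prodMk (continuous_pi fun b =>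
        (continuous_apply (e b)).comp continuous_snd))))
    (hwc.comp (continuous_fst.prodMk (continuous_pi fun b =>
        (continuous_apply (e b)).comp continuous_snd)))
    (fun s x v => by funext a; exact congrFun (hz s (x ∘ e) (v ∘ e)) (e.symm a))
    (fun s x v => hw s (x ∘ e) (v ∘ e))
    (fun s hs x h => hne s hs _ (hc h))
    (fun x h h' => by
      obtain ⟨v, hv⟩ := hstd _ (hc h) h'
      exact ⟨v ∘ e.symm, by funext a; simpa using congrFun hv (e.symm a)⟩)
    hδ
    (fun x hx => by
      obtain ⟨h1, h2⟩ := hball (y := x ∘ e) (by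
        rw [dist_zero_right, pi_norm_lt_iff hδ]; exact fun a => hx (e a))
      exact ⟨fun a => by rw [h1]; simp, h2⟩)
  exact ⟨x ∘ e, hc h1, h2⟩

end Kuhn

namespace Alternation

open unitInterval

/-- The midpoint of the `m`-th of `2 * q + 1` equal windows in `[0, 1]`. -/
def mid (q m : ℕ) : ℝ := (2 * m + 1) / (2 * (2 * q + 1))

/-- A bump function in the `m`-th window. -/
def windowBump (q m : ℕ) : ContDiffBump (mid q m) where
  rIn := 1 / (8 * (2 * q + 1))
  rOut := 1 / (4 * (2 * q + 1))
  rIn_pos := by positivity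
  rIn_lt_rOut := by gcongr; norm_num

/-- The alternating combination of the bump functions. -/
def amp (q : ℕ) (c : Fin (2 * q + 1) → ℝ) (t : ℝ) : ℝ :=
  ∑ m : Fin (2 * q + 1), (-1) ^ m.val * windowBump q m t * c m

lemma windowBump_eq_zero {q i m : ℕ} (h : i ≠ m) {t : ℝ}
    (ht : |t - mid q i| ≤ 1 / (4 * (2 * q + 1))) : windowBump q m t = 0 := by
  refine (windowBump q m).zero_of_le_dist ?_
  change (1 / (4 * (2 * (q : ℝ) + 1))) ≤ _
  rw [Real.dist_eq]
  have hq : (0 : ℝ) < 2 * q + 1 := by positivity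
  have h1 : 1 / (2 * q + 1 : ℝ) ≤ |mid q i - mid q m| := by
    have : mid q i - mid q m = ((i : ℝ) - m) / (2 * q + 1) := by
      unfold mid; field_simp; ring
    rw [this, abs_div, abs_of_pos hq]
    gcongr
    have : (1 : ℤ) ≤ |(i : ℤ) - m| := Int.one_le_abs (by omega)
    exact_mod_cast this
  have h2 : |mid q i - mid q m| ≤ |t - mid q m| + |t - mid q i| := by
    rw [abs_sub_comm t (mid q i), add_comm]
    exact abs_sub_le _ _ _
  have h3 : 1 / (2 * q + 1 : ℝ) = 1 / (4 * (2 * q + 1)) + 3 * (1 / (4 * (2 * q + 1))) := by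
    field_simp; norm_num
  have h4 : 0 < 1 / (4 * (2 * q + 1) : ℝ) := by positivity
  linarith

lemma amp_near {q : ℕ} (c : Fin (2 * q + 1) → ℝ) (i : Fin (2 * q + 1)) {t : ℝ}
    (ht : |t - mid q i| ≤ 1 / (4 * (2 * q + 1))) :
    amp q c t = (-1) ^ i.val * windowBump q i t * c i := by
  unfold amp
  refine Finset.sum_eq_single i (fun m _ hm => ?_) (by simp)
  rw [windowBump_eq_zero (fun h => hm (Fin.ext h.symm)) ht]
  ring

lemma amp_mid {q : ℕ} (c : Fin (2 * q + 1) → ℝ) (i : Fin (2 * q + 1)) :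
    amp q c (mid q i) = (-1) ^ i.val * c i := by
  rw [amp_near c i (by simp; positivity), (windowBump q i).one_of_mem_closedBall
    (Metric.mem_closedBall_self (by exact (windowBump q i).rIn_pos.le)), mul_one]

/-- The vanishing locus of `cos (π r t)` on `[0, 1]`. -/
lemma exists_mid_of_cos_eq_zero {q : ℕ} {t : ℝ} (ht : t ∈ Set.Icc (0 : ℝ) 1)
    (h : Real.cos (Real.pi * (2 * q + 1) * t) = 0) : ∃ m : Fin (2 * q + 1), t = mid q m := by
  rw [Real.cos_eq_zero_iff] at h
  obtain ⟨k, hk⟩ := h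
  have hq : (0 : ℝ) < 2 * q + 1 := by positivity
  have h1 : (2 * q + 1) * t = (2 * k + 1) / 2 := by
    have := Real.pi_pos
    have h2 : Real.pi * ((2 * q + 1) * t) = Real.pi * ((2 * k + 1) / 2) := by linarith
    exact mul_left_cancel₀ this.ne' h2
  have h3 : (0 : ℝ) ≤ (2 * k + 1) / 2 := by rw [← h1]; exact mul_nonneg hq.le ht.1
  have h4 : ((2 * k + 1) / 2 : ℝ) ≤ 2 * q + 1 := by
    rw [← h1]; nlinarith [ht.2]
  have h5 : (0 : ℤ) ≤ k := by
    have : (0 : ℝ) ≤ 2 * k + 1 := by linarith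
    have : (0 : ℤ) ≤ 2 * k + 1 := by exact_mod_cast this
    omega
  have h6 : k < 2 * q + 1 := by
    have : (2 * k + 1 : ℝ) ≤ 2 * (2 * q + 1) := by linarith
    have : (2 * k + 1 : ℤ) ≤ 2 * (2 * q + 1) := by exact_mod_cast this
    omega
  lift k to ℕ using h5
  refine ⟨⟨k, by omega⟩, ?_⟩
  unfold mid
  push_cast at h1
  field_simp
  linarith

lemma cos_near_mid (q : ℕ) (i : ℕ) (u : ℝ) :
    (-1) ^ i * -Real.cos (Real.pi * (2 * q + 1) * (mid q i + u))
      = Real.sin (Real.pi * (2 * q + 1) * u) := by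
  have h : Real.pi * (2 * q + 1) * (mid q i + u)
      = (Real.pi * (2 * q + 1) * u + Real.pi / 2) + i * Real.pi := by
    unfold mid
    have hq : (0 : ℝ) < 2 * q + 1 := by positivity
    field_simp
    ring
  rw [h, Real.cos_add_nat_mul_pi, Real.cos_add_pi_div_two]
  have : ((-1 : ℝ) ^ i) * (-1) ^ i = 1 := by rw [← mul_pow]; simp
  linear_combination Real.sin (Real.pi * (2 * q + 1) * u) * this

lemma mid_pos (q i : ℕ) : 0 < mid q i := by unfold mid; positivity

lemma mid_lt_one {q : ℕ} (i : Fin (2 * q + 1)) : mid q i < 1 := by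
  have hq : (0 : ℝ) < 2 * q + 1 := by positivity
  have h : (i.val : ℝ) + 1 ≤ 2 * q + 1 := by exact_mod_cast i.2
  unfold mid
  rw [div_lt_one (by positivity)]
  linarith

lemma mid_lt_mid {q i j : ℕ} : mid q i < mid q j ↔ i < j := by
  unfold mid
  rw [div_lt_div_iff_of_pos_right (by positivity)]
  constructor
  · intro h
    have : (i : ℝ) < j := by linarith
    exact_mod_cast this
  · intro h
    have : (i : ℝ) < j := by exact_mod_cast h
    linarith

variable {n q : ℕ}

/-- The parameter torus. -/
abbrev Torus (n q : ℕ) : Type := Fin (2 * q + 1) → Fin n → Circle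

/-- A function on the torus which is odd integer valued where all the imaginary parts vanish. -/
def height (c : Fin n → Circle) : ℝ := 1 - ∑ j, (1 - (c j : ℂ).re)

lemma re_eq_of_im_eq_zero {c : Circle} (h : (c : ℂ).im = 0) : (c : ℂ).re = 1 ∨ (c : ℂ).re = -1 := by
  have := c.normSq_coe
  rw [Complex.normSq_apply, h] at this
  exact mul_self_eq_one_iff.1 (by linarith)

lemma exists_height_eq {c : Fin n → Circle} (h : ∀ j, (c j : ℂ).im = 0) :
    ∃ s : Finset (Fin n), (∀ j, j ∉ s → c j = 1) ∧ height c = 1 - 2 * s.card := by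
  classical
  refine ⟨Finset.univ.filter fun j => (c j : ℂ).re = -1, fun j hj => ?_, ?_⟩
  · have h1 : (c j : ℂ).re = 1 := (re_eq_of_im_eq_zero (h j)).resolve_right (by simpa using hj)
    exact Circle.ext (Complex.ext (by simpa using h1) (by simpa using h j))
  · unfold height
    rw [Finset.card_filter]
    push_cast
    rw [Finset.mul_sum]
    congr 1
    refine Finset.sum_congr rfl fun j _ => ?_
    rcases re_eq_of_im_eq_zero (h j) with h1 | h1 <;> rw [h1] <;> norm_num

lemma height_ne_zero {c : Fin n → Circle} (h : ∀ j, (c j : ℂ).im = 0) : height c ≠ 0 := by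
  obtain ⟨s, -, hs⟩ := exists_height_eq h
  rw [hs]
  intro h0
  have : (1 : ℤ) - 2 * s.card = 0 := by exact_mod_cast h0
  omega

lemma eq_one_of_height_nonneg {c : Fin n → Circle} (h : ∀ j, (c j : ℂ).im = 0)
    (h0 : 0 ≤ height c) (j : Fin n) : c j = 1 := by
  obtain ⟨s, hs1, hs⟩ := exists_height_eq h
  rw [hs] at h0
  refine hs1 j ?_
  have : (0 : ℤ) ≤ 1 - 2 * s.card := by exact_mod_cast h0
  have : s.card = 0 := by omega
  rw [Finset.card_eq_zero] at this
  simp [this]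

lemma height_one : height (1 : Fin n → Circle) = 1 := by simp [height]

/-- The ambient Euclidean space. -/
abbrev Amb (n : ℕ) : Type := EuclideanSpace ℝ (Fin (n + 2))

/-- The explicit family of paths with alternating crossings. -/
def expl (p : Torus n q) (t : ℝ) : Amb n :=
  WithLp.toLp 2 (Fin.cons (amp q (fun m => height (p m)) t)
    (Fin.cons (-Real.cos (Real.pi * (2 * q + 1) * t))
      fun j => amp q (fun m => (p m j : ℂ).im) t))

@[simp] lemma expl_zero (p : Torus n q) (t : ℝ) :
    expl p t 0 = amp q (fun m => height (p m)) t := rfl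

@[simp] lemma expl_one (p : Torus n q) (t : ℝ) :
    expl p t 1 = -Real.cos (Real.pi * (2 * q + 1) * t) := rfl

@[simp] lemma expl_succ (p : Torus n q) (t : ℝ) (j : Fin n) :
    expl p t j.succ.succ = amp q (fun m => (p m j : ℂ).im) t := rfl

lemma expl_ne_zero (p : Torus n q) {t : ℝ} (ht : t ∈ Set.Icc (0 : ℝ) 1) : expl p t ≠ 0 := by
  intro h
  have h1 : expl p t 1 = 0 := by rw [h]; rfl
  rw [expl_one, neg_eq_zero] at h1
  obtain ⟨m, rfl⟩ := exists_mid_of_cos_eq_zero ht h1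
  have h2 : ∀ j, (p m j : ℂ).im = 0 := fun j => by
    have : expl p (mid q m) j.succ.succ = 0 := by rw [h]; rfl
    rw [expl_succ, amp_mid] at this
    simpa using this
  have h3 : expl p (mid q m) 0 = 0 := by rw [h]; rfl
  rw [expl_zero, amp_mid] at h3
  exact height_ne_zero h2 (by simpa using h3)

lemma continuous_expl : Continuous fun x : Torus n q × ℝ => expl x.1 x.2 := by
  refine (PiLp.continuous_toLp 2 _).comp ?_
  have hb : ∀ m : Fin (2 * q + 1), Continuous fun t => windowBump q m t :=
    fun m => (windowBump q m).continuous
  refine continuous_pi fun j => ?_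
  refine Fin.cases ?_ (fun j => ?_) j
  · simp only [Fin.cons_zero, amp, height]
    fun_prop
  · refine Fin.cases ?_ (fun j => ?_) j
    · simp only [Fin.cons_succ, Fin.cons_zero]
      fun_prop
    · simp only [Fin.cons_succ, amp]
      fun_prop

/-- The explicit family as a continuous map. -/
def explMap (n q : ℕ) : C(Torus n q × I, Amb n) :=
  ⟨fun x => expl x.1 x.2, by
    have h : Continuous fun x : Torus n q × I => (x.1, (x.2 : ℝ)) := by fun_prop
    exact continuous_expl.comp h⟩

/-- Families of nonvanishing paths, whose ends are off the hyperplane `x 1 = 0`. -/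
def Based (n q : ℕ) : Set C(Torus n q × I, Amb n) :=
  {η | (∀ x, η x ≠ 0) ∧ ∀ p, η (p, 0) 1 ≠ 0 ∧ η (p, 1) 1 ≠ 0}

lemma explMap_mem : explMap n q ∈ Based n q := by
  refine ⟨fun x => expl_ne_zero _ x.2.2, fun p => ⟨?_, ?_⟩⟩
  · change expl p ((0 : I) : ℝ) 1 ≠ 0
    simp
  · change expl p ((1 : I) : ℝ) 1 ≠ 0
    have : Real.pi * (2 * q + 1) * 1 = q * (2 * Real.pi) + Real.pi := by ring
    rw [expl_one, Set.Icc.coe_one, this, Real.cos_nat_mul_two_pi_add_pi]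
    norm_num

end Alternation

namespace Alternation

open unitInterval

variable {n q : ℕ}

/-- Reference angles, whose associated times are the midpoints of the windows. -/
def refAngle (q i : ℕ) : ℝ := Real.arccos (1 - 2 * mid q i)

lemma cos_refAngle (i : Fin (2 * q + 1)) : Real.cos (refAngle q i) = 1 - 2 * mid q i :=
  Real.cos_arccos (by linarith [mid_lt_one i]) (by linarith [mid_pos q i])

lemma refAngle_mem (i : Fin (2 * q + 1)) : refAngle q i ∈ Set.Ioo 0 Real.pi := by
  refine ⟨Real.arccos_pos.2 (by linarith [mid_pos q i]), ?_⟩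
  refine lt_of_le_of_ne (Real.arccos_le_pi _) fun h => ?_
  have := cos_refAngle i
  rw [show refAngle q i = Real.pi from h, Real.cos_pi] at this
  linarith [mid_lt_one i]

lemma sin_refAngle_pos (i : Fin (2 * q + 1)) : 0 < Real.sin (refAngle q i) :=
  Real.sin_pos_of_mem_Ioo (refAngle_mem i)

/-- The angle encoding the `i`-th time. -/
def ang (x : Fin (2 * q + 1) × Fin (n + 1) → ℝ) (i : Fin (2 * q + 1)) : ℝ :=
  2 * Real.pi * x (i, 0) + refAngle q i

/-- The `i`-th time. -/
def tm (x : Fin (2 * q + 1) × Fin (n + 1) → ℝ) (i : Fin (2 * q + 1)) : I :=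
  ⟨(1 - Real.cos (ang x i)) / 2, by
    constructor <;> linarith [Real.cos_le_one (ang x i), Real.neg_one_le_cos (ang x i)]⟩

/-- The point of the torus with the given arguments. -/
def tor (x : Fin (2 * q + 1) × Fin (n + 1) → ℝ) : Torus n q :=
  fun i j => Circle.exp (2 * Real.pi * x (i, j.succ))

lemma ang_add (x : Fin (2 * q + 1) × Fin (n + 1) → ℝ) (v : Fin (2 * q + 1) × Fin (n + 1) → ℤ) (i) :
    ang (fun a => x a + v a) i = ang x i + v (i, 0) * (2 * Real.pi) := by
  simp only [ang]; ring

lemma tm_add (x : Fin (2 * q + 1) × Fin (n + 1) → ℝ) (v : Fin (2 * q + 1) × Fin (n + 1) → ℤ) :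
    tm (fun a => x a + v a) = tm x := by
  funext i
  simp only [tm, ang_add, Real.cos_add_int_mul_two_pi]

lemma tor_add (x : Fin (2 * q + 1) × Fin (n + 1) → ℝ) (v : Fin (2 * q + 1) × Fin (n + 1) → ℤ) :
    tor (fun a => x a + v a) = tor x := by
  funext i j
  simp only [tor]
  rw [Circle.exp_eq_exp]
  exact ⟨v (i, j.succ), by ring⟩

lemma continuous_ang (i : Fin (2 * q + 1)) :
    Continuous fun x : Fin (2 * q + 1) × Fin (n + 1) → ℝ => ang x i := by
  unfold ang; fun_prop

lemma continuous_tm (i : Fin (2 * q + 1)) :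
    Continuous fun x : Fin (2 * q + 1) × Fin (n + 1) → ℝ => tm x i := by
  have := continuous_ang (n := n) i
  unfold tm
  fun_prop

lemma continuous_tor : Continuous fun x : Fin (2 * q + 1) × Fin (n + 1) → ℝ => tor x := by
  unfold tor; fun_prop

/-- The components whose common zeros are the crossings. -/
def crossZ (η : C(Torus n q × I, Amb n)) (x : Fin (2 * q + 1) × Fin (n + 1) → ℝ)
    (a : Fin (2 * q + 1) × Fin (n + 1)) : ℝ :=
  (-1) ^ a.1.val * η (tor x, tm x a.1) a.2.succ

/-- The gap between consecutive angles. -/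
def gap (x : Fin (2 * q + 1) × Fin (n + 1) → ℝ) (i : Fin (2 * q + 1)) : ℝ :=
  if h : i.val + 1 < 2 * q + 1 then Real.cos (ang x i) - Real.cos (ang x ⟨i.val + 1, h⟩) else 1

/-- The quantities which are positive at alternating increasing crossings. -/
def crossParts (η : C(Torus n q × I, Amb n)) (x : Fin (2 * q + 1) × Fin (n + 1) → ℝ)
    (i : Fin (2 * q + 1)) : ℝ :=
  min (Real.sin (ang x i)) (min (gap x i) ((-1) ^ i.val * η (tor x, tm x i) 0))

/-- The function which is positive at alternating increasing crossings. -/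
def crossW (η : C(Torus n q × I, Amb n)) (x : Fin (2 * q + 1) × Fin (n + 1) → ℝ) : ℝ :=
  Finset.univ.inf' Finset.univ_nonempty (crossParts η x)

lemma eval_ne_zero {η : C(Torus n q × I, Amb n)} (hη : η ∈ Based n q)
    {x : Fin (2 * q + 1) × Fin (n + 1) → ℝ} (hz : crossZ η x = 0) (i : Fin (2 * q + 1)) :
    (∀ j : Fin (n + 1), η (tor x, tm x i) j.succ = 0) ∧ η (tor x, tm x i) 0 ≠ 0 := by
  have h1 : ∀ j : Fin (n + 1), η (tor x, tm x i) j.succ = 0 := fun j => by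
    have := congrFun hz (i, j)
    simpa [crossZ] using this
  refine ⟨h1, fun h0 => hη.1 (tor x, tm x i) ?_⟩
  ext j
  exact Fin.cases h0 h1 j

lemma strict_of_crossW_nonneg {η : C(Torus n q × I, Amb n)} (hη : η ∈ Based n q)
    {x : Fin (2 * q + 1) × Fin (n + 1) → ℝ} (hz : crossZ η x = 0) (hw : 0 ≤ crossW η x)
    (i : Fin (2 * q + 1)) : 0 < crossParts η x i := by
  have hle : ∀ i, 0 ≤ crossParts η x i := fun i => by
    rw [crossW, Finset.le_inf'_iff] at hw
    exact hw i (Finset.mem_univ i)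
  have hy : ∀ i : Fin (2 * q + 1), 0 < (-1) ^ i.val * η (tor x, tm x i) 0 := fun i => by
    refine lt_of_le_of_ne ((hle i).trans ((min_le_right _ _).trans (min_le_right _ _)))
      (Ne.symm ?_)
    exact mul_ne_zero (by simp) (eval_ne_zero hη hz i).2
  refine lt_min ?_ (lt_min ?_ (hy i))
  · refine lt_of_le_of_ne ((hle i).trans (min_le_left _ _)) (fun h => ?_)
    have hcos := Real.sin_eq_zero_iff_cos_eq.1 h.symm
    have h1 := (eval_ne_zero hη hz i).1 0
    have h2 : tm x i = 0 ∨ tm x i = 1 := by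
      rcases hcos with h | h
      · left; ext; simp [tm, h]
      · right; ext; simp [tm, h]
    rcases h2 with h2 | h2
    · rw [h2] at h1; exact (hη.2 (tor x)).1 h1
    · rw [h2] at h1; exact (hη.2 (tor x)).2 h1
  · refine lt_of_le_of_ne ((hle i).trans ((min_le_right _ _).trans (min_le_left _ _)))
      (fun h => ?_)
    unfold gap at h
    split_ifs at h with hi
    · have h1 : tm x i = tm x ⟨i.val + 1, hi⟩ := by
        ext
        simp only [tm]
        linarith
      have h2 := hy i
      have h3 := hy ⟨i.val + 1, hi⟩
      rw [← h1, pow_succ] at h3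
      linarith
    · exact zero_ne_one h

lemma continuous_crossZ {Y : Type*} [TopologicalSpace Y] {η : Y → C(Torus n q × I, Amb n)}
    {x : Y → Fin (2 * q + 1) × Fin (n + 1) → ℝ} (hη : Continuous η) (hx : Continuous x) :
    Continuous fun y => crossZ (η y) (x y) := by
  refine continuous_pi fun a => ?_
  unfold crossZ
  have h1 : Continuous fun y => (tor (x y), tm (x y) a.1) :=
    (continuous_tor.comp hx).prodMk ((continuous_tm a.1).comp hx)
  have h2 : Continuous fun y => η y (tor (x y), tm (x y) a.1) := hη.eval h1
  fun_prop

lemma continuous_crossW {Y : Type*} [TopologicalSpace Y] {η : Y → C(Torus n q × I, Amb n)}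
    {x : Y → Fin (2 * q + 1) × Fin (n + 1) → ℝ} (hη : Continuous η) (hx : Continuous x) :
    Continuous fun y => crossW (η y) (x y) := by
  refine Continuous.finset_inf'_apply _ fun i _ => ?_
  have h1 : Continuous fun y => (tor (x y), tm (x y) i) :=
    (continuous_tor.comp hx).prodMk ((continuous_tm i).comp hx)
  have h2 : Continuous fun y => η y (tor (x y), tm (x y) i) := hη.eval h1
  have h3 : ∀ i : Fin (2 * q + 1), Continuous fun y => ang (x y) i :=
    fun i => (continuous_ang i).comp hx
  have h4 : Continuous fun y => gap (x y) i := by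
    unfold gap
    split_ifs with h
    · exact (Real.continuous_cos.comp (h3 _)).sub (Real.continuous_cos.comp (h3 _))
    · exact continuous_const
  unfold crossParts
  have h5 := h3 i
  fun_prop

lemma crossZ_add (η : C(Torus n q × I, Amb n)) (x : Fin (2 * q + 1) × Fin (n + 1) → ℝ)
    (v : Fin (2 * q + 1) × Fin (n + 1) → ℤ) :
    crossZ η (fun a => x a + v a) = crossZ η x := by
  funext a
  simp only [crossZ, tm_add, tor_add]

lemma crossW_add (η : C(Torus n q × I, Amb n)) (x : Fin (2 * q + 1) × Fin (n + 1) → ℝ)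
    (v : Fin (2 * q + 1) × Fin (n + 1) → ℤ) :
    crossW η (fun a => x a + v a) = crossW η x := by
  unfold crossW
  congr 1
  funext i
  simp only [crossParts, tm_add, tor_add, gap, ang_add, Real.cos_add_int_mul_two_pi,
    Real.sin_add_int_mul_two_pi]

lemma strictMono_tm {η : C(Torus n q × I, Amb n)} {x : Fin (2 * q + 1) × Fin (n + 1) → ℝ}
    (h : ∀ i, 0 < crossParts η x i) : StrictMono fun i => (tm x i : ℝ) := by
  refine Fin.strictMono_iff_lt_succ.2 fun i => ?_
  have h1 := (h i.castSucc).trans_le ((min_le_right _ _).trans (min_le_left _ _))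
  unfold gap at h1
  rw [dif_pos (by simp)] at h1
  have : (⟨i.castSucc.val + 1, by simp⟩ : Fin (2 * q + 1)) = i.succ := rfl
  rw [this] at h1
  simp only [tm]
  linarith

lemma explMap_standard (x : Fin (2 * q + 1) × Fin (n + 1) → ℝ) (hz : crossZ (explMap n q) x = 0)
    (hw : 0 ≤ crossW (explMap n q) x) :
    ∃ v : Fin (2 * q + 1) × Fin (n + 1) → ℤ, x = fun a => (v a : ℝ) := by
  have hpos := strict_of_crossW_nonneg explMap_mem hz hw
  have hmono := strictMono_tm hpos
  have hev : ∀ i, explMap n q (tor x, tm x i) = expl (tor x) (tm x i) := fun i => rfl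
  have hmid : ∀ i, ∃ m : Fin (2 * q + 1), (tm x i : ℝ) = mid q m := fun i => by
    refine exists_mid_of_cos_eq_zero (tm x i).2 ?_
    have := (eval_ne_zero explMap_mem hz i).1 0
    rw [hev, Fin.succ_zero_eq_one', expl_one] at this
    linarith
  choose m hm using hmid
  have hmm : StrictMono m := fun i j hij => by
    have := hmono hij
    simp only [hm] at this
    exact mid_lt_mid.1 this
  have hid : ∀ i, m i = i := fun i => by
    have := (hmm.range_inj strictMono_id).1 (by
      rw [Set.range_id, (Finite.injective_iff_surjective.1 hmm.injective).range_eq])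
    rw [this]; rfl
  simp only [hid] at hm
  have him : ∀ i j, (tor x i j : ℂ).im = 0 := fun i j => by
    have := (eval_ne_zero explMap_mem hz i).1 j.succ
    rw [hev, expl_succ, hm, amp_mid] at this
    simpa using this
  have hone : ∀ i j, tor x i j = 1 := fun i j => by
    refine eq_one_of_height_nonneg (him i) ?_ j
    have := (hpos i).trans_le ((min_le_right _ _).trans (min_le_right _ _))
    rw [hev, expl_zero, hm, amp_mid, ← mul_assoc, ← mul_pow] at this
    simpa using this.le
  have hang : ∀ i, ∃ k : ℤ, x (i, 0) = k := fun i => by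
    have h1 := (hpos i).trans_le (min_le_left _ _)
    have h2 : Real.cos (ang x i) = Real.cos (refAngle q i) := by
      rw [cos_refAngle, ← hm i]; simp [tm]; ring
    have h3 : Real.sin (ang x i) = Real.sin (refAngle q i) := by
      have e1 := Real.sin_sq_add_cos_sq (ang x i)
      have e2 := Real.sin_sq_add_cos_sq (refAngle q i)
      rw [h2] at e1
      exact (sq_eq_sq₀ h1.le (sin_refAngle_pos i).le).1 (by linarith)
    have h4 := Real.Angle.cos_sin_inj h2 h3
    rw [Real.Angle.angle_eq_iff_two_pi_dvd_sub] at h4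
    obtain ⟨k, hk⟩ := h4
    refine ⟨k, ?_⟩
    simp only [ang, add_sub_cancel_right] at hk
    exact mul_left_cancel₀ Real.two_pi_pos.ne' hk
  have hcirc : ∀ i (j : Fin n), ∃ k : ℤ, x (i, j.succ) = k := fun i j => by
    have h1 := hone i j
    rw [tor, Circle.exp_eq_one] at h1
    obtain ⟨k, hk⟩ := h1
    exact ⟨k, mul_left_cancel₀ Real.two_pi_pos.ne' (by linarith)⟩
  have : ∀ a, ∃ k : ℤ, x a = k := by
    rintro ⟨i, j⟩
    exact Fin.cases (hang i) (hcirc i) j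
  choose v hv using this
  exact ⟨v, funext hv⟩

lemma zero_ang (i : Fin (2 * q + 1)) :
    ang (0 : Fin (2 * q + 1) × Fin (n + 1) → ℝ) i = refAngle q i := by simp [ang]

lemma zero_tm (i : Fin (2 * q + 1)) :
    (tm (0 : Fin (2 * q + 1) × Fin (n + 1) → ℝ) i : ℝ) = mid q i := by
  simp [tm, zero_ang, cos_refAngle]

lemma zero_tor : tor (0 : Fin (2 * q + 1) × Fin (n + 1) → ℝ) = 1 := by
  funext i j; simp [tor]

lemma crossW_zero_pos : 0 < crossW (explMap n q) (0 : Fin (2 * q + 1) × Fin (n + 1) → ℝ) := by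
  rw [crossW, Finset.lt_inf'_iff]
  intro i _
  refine lt_min ?_ (lt_min ?_ ?_)
  · rw [zero_ang]; exact sin_refAngle_pos i
  · unfold gap
    split_ifs with h
    · rw [zero_ang, zero_ang, cos_refAngle, cos_refAngle]
      have := (mid_lt_mid (q := q) (i := i.val) (j := i.val + 1)).2 (by omega)
      simp only
      linarith
    · exact one_pos
  · change 0 < (-1) ^ i.val * expl (tor 0) (tm 0 i) 0
    rw [expl_zero, zero_tm, amp_mid, zero_tor, ← mul_assoc, ← mul_pow]
    change 0 < (-1 * -1) ^ i.val * height (1 : Fin n → Circle)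
    rw [height_one]; simp

lemma tm_gt_iff {x : Fin (2 * q + 1) × Fin (n + 1) → ℝ} {i : Fin (2 * q + 1)}
    (h : ang x i ∈ Set.Icc 0 Real.pi) : mid q i < tm x i ↔ 0 < x (i, 0) := by
  have h1 : mid q i < tm x i ↔ Real.cos (ang x i) < Real.cos (refAngle q i) := by
    rw [cos_refAngle]; simp only [tm]; constructor <;> intro h <;> linarith
  have h2 := refAngle_mem i
  rw [h1, Real.strictAntiOn_cos.lt_iff_gt h ⟨h2.1.le, h2.2.le⟩]
  simp only [ang, lt_add_iff_pos_left]
  exact mul_pos_iff_of_pos_left Real.two_pi_pos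

lemma crossZ_time_pos_iff {x : Fin (2 * q + 1) × Fin (n + 1) → ℝ} {i : Fin (2 * q + 1)}
    (h : ang x i ∈ Set.Icc 0 Real.pi) (ht : |(tm x i : ℝ) - mid q i| < 1 / (4 * (2 * q + 1))) :
    0 < crossZ (explMap n q) x (i, 0) ↔ 0 < x (i, 0) := by
  rw [← tm_gt_iff h]
  set u := (tm x i : ℝ) - mid q i with hu
  have hq : (0 : ℝ) < 2 * q + 1 := by positivity
  have h1 : crossZ (explMap n q) x (i, 0) = Real.sin (Real.pi * (2 * q + 1) * u) := by
    rw [← cos_near_mid q i u, hu, add_sub_cancel]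
    rfl
  rw [h1, show mid q i < tm x i ↔ 0 < u by rw [hu, sub_pos]]
  have h2 : |Real.pi * (2 * q + 1) * u| < Real.pi := by
    rw [abs_mul, abs_of_pos (by positivity)]
    rw [lt_div_iff₀ (by positivity)] at ht
    have := Real.pi_pos
    have h4 : (2 * q + 1) * |u| < 1 := by nlinarith [abs_nonneg u]
    nlinarith
  rw [abs_lt] at h2
  constructor
  · intro h3
    by_contra hcon
    have : Real.pi * (2 * q + 1) * u ≤ 0 :=
      mul_nonpos_of_nonneg_of_nonpos (by positivity) (not_lt.1 hcon)
    linarith [Real.sin_nonpos_of_nonpos_of_neg_pi_le this h2.1.le]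
  · intro h3
    exact Real.sin_pos_of_pos_of_lt_pi (by positivity) h2.2

lemma crossZ_space_pos_iff {x : Fin (2 * q + 1) × Fin (n + 1) → ℝ} {i : Fin (2 * q + 1)}
    (j : Fin n) (hx : |x (i, j.succ)| < 1 / 2)
    (ht : |(tm x i : ℝ) - mid q i| < 1 / (4 * (2 * q + 1))) :
    0 < crossZ (explMap n q) x (i, j.succ) ↔ 0 < x (i, j.succ) := by
  have h1 : crossZ (explMap n q) x (i, j.succ)
      = windowBump q i (tm x i) * Real.sin (2 * Real.pi * x (i, j.succ)) := by
    change (-1) ^ i.val * expl (tor x) (tm x i) j.succ.succ = _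
    rw [expl_succ, amp_near _ _ ht.le, ← mul_assoc, ← mul_assoc, ← mul_pow]
    simp only [tor, mul_neg, mul_one, neg_neg, one_pow, one_mul, Circle.coe_exp]
    congr 1
    rw [Complex.exp_ofReal_mul_I_im]
  rw [h1, mul_pos_iff_of_pos_left ((windowBump q i).pos_of_mem_ball
    (by rw [Metric.mem_ball, Real.dist_eq]; exact ht))]
  have := Real.pi_pos
  rw [abs_lt] at hx
  constructor
  · intro h3
    by_contra hcon
    have h4 : 2 * Real.pi * x (i, j.succ) ≤ 0 :=
      mul_nonpos_of_nonneg_of_nonpos (by positivity) (not_lt.1 hcon)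
    linarith [Real.sin_nonpos_of_nonpos_of_neg_pi_le h4 (by nlinarith)]
  · intro h3
    exact Real.sin_pos_of_pos_of_lt_pi (by positivity) (by nlinarith)

lemma explMap_local :
    ∀ᶠ x in nhds (0 : Fin (2 * q + 1) × Fin (n + 1) → ℝ),
      (∀ a, 0 < crossZ (explMap n q) x a ↔ 0 < x a) ∧ 0 < crossW (explMap n q) x := by
  have hW : ∀ᶠ x in nhds (0 : Fin (2 * q + 1) × Fin (n + 1) → ℝ), 0 < crossW (explMap n q) x :=
    (continuous_crossW continuous_const continuous_id).continuousAt.eventually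
      (lt_mem_nhds crossW_zero_pos)
  have hA : ∀ᶠ x in nhds (0 : Fin (2 * q + 1) × Fin (n + 1) → ℝ), ∀ i,
      ang x i ∈ Set.Ioo 0 Real.pi :=
    eventually_all.2 fun i => (continuous_ang i).continuousAt.eventually
      (isOpen_Ioo.mem_nhds (by beta_reduce; rw [zero_ang]; exact refAngle_mem i))
  have hT : ∀ᶠ x in nhds (0 : Fin (2 * q + 1) × Fin (n + 1) → ℝ), ∀ i : Fin (2 * q + 1),
      |(tm x i : ℝ) - mid q i| < 1 / (4 * (2 * q + 1)) :=
    eventually_all.2 fun i => by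
      have hc : Continuous fun x : Fin (2 * q + 1) × Fin (n + 1) → ℝ =>
          |(tm x i : ℝ) - mid q i| :=
        ((continuous_subtype_val.comp (continuous_tm (n := n) i)).sub continuous_const).abs
      refine hc.continuousAt.eventually (gt_mem_nhds ?_)
      beta_reduce
      rw [zero_tm, sub_self, abs_zero]
      positivity
  have hX : ∀ᶠ x in nhds (0 : Fin (2 * q + 1) × Fin (n + 1) → ℝ), ∀ a, |x a| < 1 / 2 :=
    eventually_all.2 fun a => ((continuous_apply a).abs).continuousAt.eventually
      (gt_mem_nhds (by simp))
  filter_upwards [hW, hA, hT, hX] with x h1 h2 h3 h4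
  refine ⟨?_, h1⟩
  rintro ⟨i, j⟩
  exact Fin.cases (crossZ_time_pos_iff ⟨(h2 i).1.le, (h2 i).2.le⟩ (h3 i))
    (fun j => crossZ_space_pos_iff j (h4 _) (h3 i)) j

/-- Families joined to the explicit one have a member with alternating crossings. -/
theorem exists_alternating {η : C(Torus n q × I, Amb n)}
    (hη : JoinedIn (Based n q) (explMap n q) η) :
    ∃ (p : Torus n q) (t : Fin (2 * q + 1) → I), StrictMono t ∧ ∀ i, ∃ c > 0,
      η (p, t i) = ((-1) ^ i.val * c : ℝ) • EuclideanSpace.single 0 1 := by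
  obtain ⟨γ, hγ⟩ := hη
  have hmem : ∀ s, γ.extend s ∈ Based n q := fun s => by
    obtain ⟨y, hy⟩ := γ.extend_range ▸ Set.mem_range_self (f := γ.extend) s
    rw [← hy]; exact hγ y
  obtain ⟨x, hx1, hx2⟩ := Kuhn.exists_zero_of_homotopy_fintype
    (fun s => crossZ (γ.extend s)) (fun s => crossW (γ.extend s))
    (continuous_crossZ (γ.continuous_extend.comp continuous_fst) continuous_snd)
    (continuous_crossW (γ.continuous_extend.comp continuous_fst) continuous_snd)
    (fun s => crossZ_add _) (fun s => crossW_add _)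
    (fun s _ x hz hw => by
      have h1 := strict_of_crossW_nonneg (hmem s) hz hw.ge
      refine absurd hw (ne_of_gt ?_)
      rw [crossW, Finset.lt_inf'_iff]
      exact fun i _ => h1 i)
    (fun x hz hw => by
      simp only [Path.extend_zero] at hz hw
      exact explMap_standard x hz hw)
    (by simp only [Path.extend_zero]; exact explMap_local)
  simp only [Path.extend_one] at hx1 hx2
  have hη' : η ∈ Based n q := by simpa using hmem 1
  have hpos := strict_of_crossW_nonneg hη' hx1 hx2.le
  refine ⟨tor x, tm x, fun i j hij => strictMono_tm hpos hij, fun i => ?_⟩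
  have h1 := (hpos i).trans_le ((min_le_right _ _).trans (min_le_right _ _))
  refine ⟨_, h1, ?_⟩
  rw [← mul_assoc, ← mul_pow]
  ext j
  refine Fin.cases ?_ (fun j => ?_) j
  · simp
  · rw [(eval_ne_zero hη' hx1 i).1 j]
    simp

end Alternation

namespace Alternation

open unitInterval InnerProductSpace

section Shear

variable {E : Type*} [NormedAddCommGroup E] [InnerProductSpace ℝ E]

/-- The shear that sends `v` to `v₀`. -/
def shear (v₀ v : E) : E →L[ℝ] E :=
  ContinuousLinearMap.id ℝ E - (inner ℝ v₀ v)⁻¹ • rankOne ℝ (v - v₀) v₀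

lemma shear_apply (v₀ v x : E) :
    shear v₀ v x = x - (inner ℝ v₀ v)⁻¹ • (inner ℝ v₀ x : ℝ) • (v - v₀) := by
  simp [shear, smul_sub]

lemma shear_self (v₀ : E) : shear v₀ v₀ = ContinuousLinearMap.id ℝ E := by
  simp [shear]

lemma shear_map {v₀ v : E} (h : inner ℝ v₀ v ≠ (0 : ℝ)) : shear v₀ v v = v₀ := by
  rw [shear_apply, smul_smul, inv_mul_cancel₀ h, one_smul, sub_sub_cancel]

lemma shear_injective {v₀ v : E} (h : inner ℝ v₀ v ≠ (0 : ℝ)) :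
    Function.Injective (shear v₀ v) := by
  rw [injective_iff_map_eq_zero]
  intro x hx
  rw [shear_apply, sub_eq_zero, smul_smul] at hx
  have h0 : v₀ ≠ 0 := fun h0 => h (by rw [h0, inner_zero_left])
  have h1 : (inner ℝ v₀ x : ℝ) = 0 := by
    have := congrArg (fun y => (inner ℝ v₀ y : ℝ)) hx
    simp only [inner_smul_right, inner_sub_right] at this
    field_simp at this
    have h2 : inner ℝ v₀ x * (inner ℝ v₀ v₀ : ℝ) = 0 := by linarith
    exact (mul_eq_zero.1 h2).resolve_right (inner_self_ne_zero.2 h0)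
  rw [hx, h1]; simp

lemma continuous_shear {Y : Type*} [TopologicalSpace Y] {a b : Y → E} (ha : Continuous a)
    (hb : Continuous b) (h : ∀ y, inner ℝ (a y) (b y) ≠ (0 : ℝ)) :
    Continuous fun y => shear (a y) (b y) := by
  unfold shear
  refine continuous_const.sub (((ha.inner hb).inv₀ h).smul ?_)
  exact (((rankOne ℝ (E := E) (F := E)).continuous.comp (hb.sub ha)).clm_apply ha)

lemma inner_pos_of_norm_sub_lt {v₀ v : E} (h : ‖v - v₀‖ < ‖v₀‖) : 0 < inner ℝ v₀ v := by
  have h1 : inner ℝ v₀ v = ‖v₀‖ ^ 2 + inner ℝ v₀ (v - v₀) := by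
    rw [inner_sub_right, real_inner_self_eq_norm_sq]; ring
  have h2 := abs_real_inner_le_norm v₀ (v - v₀)
  have h3 := (abs_le.1 h2).1
  have h4 : 0 < ‖v₀‖ := (norm_nonneg _).trans_lt h
  nlinarith

end Shear

lemma joinedIn_of_homotopy {X Y : Type*} [TopologicalSpace X] [TopologicalSpace Y]
    {F : Set C(X, Y)} {a b : C(X, Y)} (H : C(I × X, Y)) (h0 : ∀ x, H (0, x) = a x)
    (h1 : ∀ x, H (1, x) = b x) (hF : ∀ s, H.curry s ∈ F) : JoinedIn F a b :=
  ⟨⟨H.curry, ContinuousMap.ext h0, ContinuousMap.ext h1⟩, hF⟩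

variable {n q : ℕ}

/-- A family transformed by linear maps depending on the parameter. -/
def twist (R : C(Torus n q, Amb n →L[ℝ] Amb n)) (ξ : C(Torus n q × I, Amb n)) :
    C(Torus n q × I, Amb n) :=
  ⟨fun x => R x.1 (ξ x), (R.continuous.comp continuous_fst).clm_apply ξ.continuous⟩

/-- Families equivalent to the explicit one by parameter dependent linear maps and homotopies. -/
def Standard (ξ : C(Torus n q × I, Amb n)) : Prop :=
  ∃ R : C(Torus n q, Amb n →L[ℝ] Amb n), (∀ p, Function.Injective (R p)) ∧
    JoinedIn (Based n q) (explMap n q) (twist R ξ)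

lemma standard_explMap : Standard (explMap n q) := by
  refine ⟨ContinuousMap.const _ (ContinuousLinearMap.id ℝ _), fun p => Function.injective_id, ?_⟩
  have : twist (ContinuousMap.const _ (ContinuousLinearMap.id ℝ _)) (explMap n q)
      = explMap n q := ContinuousMap.ext fun x => rfl
  rw [this]
  exact JoinedIn.refl explMap_mem

lemma Standard.of_near {ξ ξ' : C(Torus n q × I, Amb n)} (h : Standard ξ)
    (hξ : ∀ p, ξ (p, 1) = -ξ (p, 0)) (hξ' : ∀ p, ξ' (p, 1) = -ξ' (p, 0))
    (hd : ∀ x, ‖ξ' x - ξ x‖ < ‖ξ x‖) : Standard ξ' := by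
  obtain ⟨R, hR, hJ⟩ := h
  have hmid : ∀ (s : I) x, ‖ξ x + (s : ℝ) • (ξ' x - ξ x) - ξ x‖ < ‖ξ x‖ := fun s x => by
    rw [add_sub_cancel_left, norm_smul, Real.norm_of_nonneg s.2.1]
    exact (mul_le_of_le_one_left (norm_nonneg _) s.2.2).trans_lt (hd x)
  have hin : ∀ (s : I) x, inner ℝ (ξ x) (ξ x + (s : ℝ) • (ξ' x - ξ x)) ≠ 0 :=
    fun s x => (inner_pos_of_norm_sub_lt (hmid s x)).ne'
  have hin' : ∀ p, inner ℝ (ξ (p, 0)) (ξ' (p, 0)) ≠ 0 := fun p => by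
    simpa using hin 1 (p, 0)
  have c0 : Continuous fun p => ξ (p, 0) :=
    ξ.continuous.comp (continuous_id.prodMk continuous_const)
  have c0' : Continuous fun p => ξ' (p, 0) :=
    ξ'.continuous.comp (continuous_id.prodMk continuous_const)
  have cs : Continuous fun y : I × (Torus n q × I) => (y.1 : ℝ) :=
    continuous_subtype_val.comp continuous_fst
  have cp : Continuous fun y : I × (Torus n q × I) => y.2.1 := continuous_fst.comp continuous_snd
  have cl : Continuous fun y : I × (Torus n q × I) => ξ y.2 + (y.1 : ℝ) • (ξ' y.2 - ξ y.2) :=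
    (ξ.continuous.comp continuous_snd).add (cs.smul
      ((ξ'.continuous.comp continuous_snd).sub (ξ.continuous.comp continuous_snd)))
  have cl0 : Continuous fun y : I × (Torus n q × I) =>
      ξ (y.2.1, 0) + (y.1 : ℝ) • (ξ' (y.2.1, 0) - ξ (y.2.1, 0)) :=
    (c0.comp cp).add (cs.smul ((c0'.comp cp).sub (c0.comp cp)))
  let R' : C(Torus n q, Amb n →L[ℝ] Amb n) :=
    ⟨fun p => (R p).comp (shear (ξ (p, 0)) (ξ' (p, 0))),
      R.continuous.clm_comp (continuous_shear c0 c0' hin')⟩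
  refine ⟨R', fun p => (hR p).comp (shear_injective (hin' p)), hJ.trans ?_⟩
  let H : C(I × (Torus n q × I), Amb n) :=
    ⟨fun y => R y.2.1 (shear (ξ (y.2.1, 0)) (ξ (y.2.1, 0)
        + (y.1 : ℝ) • (ξ' (y.2.1, 0) - ξ (y.2.1, 0))) (ξ y.2 + (y.1 : ℝ) • (ξ' y.2 - ξ y.2))),
      (R.continuous.comp (continuous_fst.comp continuous_snd)).clm_apply
        ((continuous_shear (c0.comp cp) cl0 fun y => hin y.1 (y.2.1, 0)).clm_apply cl)⟩
  refine joinedIn_of_homotopy H (fun x => ?_) (fun x => ?_) (fun s => ⟨fun x => ?_, fun p => ?_⟩)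
  · simp [H, shear_self, twist]
  · simp [H, R', twist]
  · change R _ (shear _ _ _) ≠ 0
    rw [Ne, map_eq_zero_iff _ (hR _), map_eq_zero_iff _ (shear_injective (hin s (x.1, 0)))]
    intro h0
    have := hmid s x
    rw [h0, zero_sub, norm_neg] at this
    exact lt_irrefl _ this
  · have hm := hJ.target_mem.2 p
    have e0 : H.curry s (p, 0) = twist R ξ (p, 0) := by
      change R p (shear _ _ _) = R p _
      rw [shear_map (hin s (p, 0))]
    have e1 : H.curry s (p, 1) = twist R ξ (p, 1) := by
      change R p (shear _ _ (ξ (p, 1) + (s : ℝ) • (ξ' (p, 1) - ξ (p, 1)))) = R p (ξ (p, 1))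
      have : ξ (p, 1) + (s : ℝ) • (ξ' (p, 1) - ξ (p, 1))
          = -(ξ (p, 0) + (s : ℝ) • (ξ' (p, 0) - ξ (p, 0))) := by
        rw [hξ, hξ']; module
      rw [this, map_neg, shear_map (hin s (p, 0)), hξ]
    rw [e0, e1]
    exact hm

/-- Standard families have a member that visits opposite rays alternately. -/
theorem Standard.exists_alternating {ξ : C(Torus n q × I, Amb n)} (h : Standard ξ) :
    ∃ (p : Torus n q) (t : Fin (2 * q + 1) → I) (u : Amb n), StrictMono t ∧ u ≠ 0 ∧
      ∀ i, ∃ c > 0, ξ (p, t i) = ((-1) ^ i.val * c : ℝ) • u := by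
  obtain ⟨R, hR, hJ⟩ := h
  obtain ⟨p, t, ht, hc⟩ := Alternation.exists_alternating hJ
  have hsurj : Function.Surjective (R p) :=
    (LinearMap.injective_iff_surjective (f := (R p : Amb n →ₗ[ℝ] Amb n))).1 (hR p)
  obtain ⟨u, hu⟩ := hsurj (EuclideanSpace.single 0 1)
  refine ⟨p, t, u, ht, ?_, fun i => ?_⟩
  · rintro rfl
    rw [map_zero] at hu
    have := congrArg (fun v : Amb n => v 0) hu
    simp at this
  · obtain ⟨c, hc, h⟩ := hc i
    refine ⟨c, hc, hR p ?_⟩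
    rw [map_smul, hu, ← h]
    rfl

end Alternation

namespace Minimax

open Topology

/-- Ekeland's variational principle. -/
theorem exists_lt_add_dist {X : Type*} [MetricSpace X] [CompleteSpace X] [Nonempty X]
    {J : X → ℝ} (hJ : LowerSemicontinuous J) (hJ0 : ∀ x, 0 ≤ J x) {κ : ℝ} (hκ : 0 < κ) :
    ∃ x, ∀ y, y ≠ x → J x < J y + κ * dist x y := by
  let S : X → Set X := fun x => {y | J y + κ * dist x y ≤ J x}
  have hS : ∀ x, x ∈ S x := fun x => by simp [S]
  have htrans : ∀ {x y z}, y ∈ S x → z ∈ S y → z ∈ S x := by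
    intro x y z hy hz
    have := mul_le_mul_of_nonneg_left (dist_triangle x y z) hκ.le
    simp only [S, Set.mem_ofPred_eq] at *
    linarith
  have hbdd : ∀ x, BddBelow (J '' S x) := fun x => ⟨0, by rintro _ ⟨y, -, rfl⟩; exact hJ0 y⟩
  have hnext : ∀ (x : X) (n : ℕ), ∃ y ∈ S x, ∀ z ∈ S x, J y ≤ J z + 1 / (n + 1 : ℝ) := by
    intro x n
    have hpos : (0 : ℝ) < 1 / (n + 1 : ℝ) := by positivity
    obtain ⟨_, ⟨y, hy, rfl⟩, hlt⟩ :=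
      exists_lt_of_csInf_lt ((show (S x).Nonempty from ⟨x, hS x⟩).image J)
        (lt_add_of_pos_right _ hpos)
    exact ⟨y, hy, fun z hz => hlt.le.trans (by
      have := csInf_le (hbdd x) (Set.mem_image_of_mem J hz); linarith)⟩
  choose g hgS hg using hnext
  let a : ℕ → X := fun n => Nat.rec (Classical.arbitrary X) (fun n x => g x n) n
  have ha : ∀ n, a (n + 1) = g (a n) n := fun n => rfl
  have hmem : ∀ n m, n ≤ m → a m ∈ S (a n) := by
    intro n m hnm
    induction m, hnm using Nat.le_induction with
    | base => exact hS _
    | succ m _ ih => exact htrans ih (ha m ▸ hgS _ _)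
  have hanti : Antitone (J ∘ a) := fun n m hnm => by
    have := hmem n m hnm
    have h0 := mul_nonneg hκ.le (dist_nonneg (x := a n) (y := a m))
    simp only [S, Set.mem_ofPred_eq, Function.comp] at *
    linarith
  obtain ⟨c, hc⟩ : ∃ c, Tendsto (J ∘ a) atTop (𝓝 c) :=
    ⟨_, tendsto_atTop_ciInf hanti ⟨0, by rintro _ ⟨n, rfl⟩; exact hJ0 _⟩⟩
  have hcauchy : CauchySeq a := by
    have hJc := hc.cauchySeq
    rw [Metric.cauchySeq_iff'] at hJc ⊢
    intro ε hε
    obtain ⟨n, hn⟩ := hJc (κ * ε) (by positivity)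
    refine ⟨n, fun m hm => ?_⟩
    have h1 := hn m hm
    have h2 := hmem n m hm
    simp only [S, Set.mem_ofPred_eq, Function.comp, Real.dist_eq] at *
    have h3 := (abs_lt.1 h1).1
    rw [dist_comm]
    exact lt_of_mul_lt_mul_left (by linarith) hκ.le
  obtain ⟨z, hz⟩ := cauchySeq_tendsto_of_complete hcauchy
  have hzS : ∀ n, z ∈ S (a n) := by
    intro n
    have hlsc : LowerSemicontinuous fun y => J y + κ * dist (a n) y :=
      hJ.add (by fun_prop : Continuous fun y => κ * dist (a n) y).lowerSemicontinuous
    exact (lowerSemicontinuous_iff_isClosed_preimage.1 hlsc (J (a n))).mem_of_tendsto hz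
      ((eventually_ge_atTop n).mono fun m hm => hmem n m hm)
  refine ⟨z, fun y hy => ?_⟩
  by_contra! hcon
  have hyS : ∀ n, y ∈ S (a n) := fun n => htrans (hzS n) hcon
  have h1 : ∀ n : ℕ, J z ≤ J y + 1 / (n + 1 : ℝ) := fun n => by
    have h2 := hzS (n + 1)
    have h3 := hg (a n) n y (hyS n)
    have h0 := mul_nonneg hκ.le (dist_nonneg (x := a (n + 1)) (y := z))
    simp only [S, Set.mem_ofPred_eq] at h2
    rw [← ha] at h3
    linarith
  have h2 : J z ≤ J y := by
    have := (tendsto_const_nhds (x := J y)).add (tendsto_one_div_add_atTop_nhds_zero_nat (𝕜 := ℝ))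
    rw [add_zero] at this
    exact ge_of_tendsto' this h1
  have h3 := mul_pos hκ (dist_pos.2 (Ne.symm hy))
  linarith

lemma continuousOn_of_hasStrictFDerivAt {Y : Type*} [NormedAddCommGroup Y] [NormedSpace ℝ Y]
    {f : Y → ℝ} {f' : Y → Y →L[ℝ] ℝ} {Λ : Set Y} (hΛ : IsOpen Λ)
    (hf : ∀ w ∈ Λ, HasStrictFDerivAt f (f' w) w) : ContinuousOn f' Λ := by
  intro w hw
  refine ContinuousAt.continuousWithinAt ?_
  rw [Metric.continuousAt_iff]
  intro ε hε
  have hη : (0 : ℝ) < ε / 2 := by positivity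
  have h1 := (hf w hw).isLittleO.def hη
  obtain ⟨r, hr, hr'⟩ := Metric.eventually_nhds_iff_ball.1 (h1.and
    ((hΛ.prod hΛ).mem_nhds (Set.mk_mem_prod hw hw)))
  refine ⟨r, hr, fun {v} hv => ?_⟩
  have hvb : v ∈ Metric.ball w r := hv
  have hvΛ : v ∈ Λ := (hr' (v, v) (by rw [← ball_prod_same]; exact ⟨hvb, hvb⟩)).2.1
  have h2 : HasFDerivAt (fun x => f x - f' w x) (f' v - f' w) v :=
    (hf v hvΛ).hasFDerivAt.sub (f' w).hasFDerivAt
  have h3 : ‖f' v - f' w‖ ≤ ε / 2 := by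
    refine h2.le_of_lip' hη.le ?_
    filter_upwards [Metric.isOpen_ball.mem_nhds hvb] with x hx
    have := (hr' (x, v) (by rw [← ball_prod_same]; exact ⟨hx, hvb⟩)).1
    simpa [map_sub, sub_sub_sub_comm] using this
  rw [dist_eq_norm]
  linarith

section Hilbert

variable {H : Type*} [NormedAddCommGroup H] [InnerProductSpace ℝ H]

lemma continuousOn_gradient {f : H → ℝ} {G : H → H} {Λ : Set H} (hΛ : IsOpen Λ)
    (hf : ∀ w ∈ Λ, HasStrictFDerivAt f (innerSL ℝ (G w)) w) : ContinuousOn G Λ := by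
  have h := continuousOn_of_hasStrictFDerivAt hΛ hf
  have hi : Isometry (innerSL ℝ : H → H →L[ℝ] ℝ) :=
    AddMonoidHomClass.isometry_of_norm _ fun x => innerSL_apply_norm (𝕜 := ℝ) x
  exact hi.isEmbedding.continuousOn_iff.2 h

lemma exists_uniform_descent {f : H → ℝ} {G : H → H} {Λ : Set H} (hΛ : IsOpen Λ)
    (hf : ∀ w ∈ Λ, HasStrictFDerivAt f (innerSL ℝ (G w)) w) {K : Set H} (hK : IsCompact K)
    (hKΛ : K ⊆ Λ) {η : ℝ} (hη : 0 < η) :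
    ∃ δ > 0, ∀ w ∈ K, ∀ z, ‖z‖ < δ → f (w + z) ≤ f w + inner ℝ (G w) z + η * ‖z‖ := by
  refine hK.induction_on (p := fun K => ∃ δ > 0, ∀ w ∈ K, ∀ z, ‖z‖ < δ →
    f (w + z) ≤ f w + inner ℝ (G w) z + η * ‖z‖) ⟨1, one_pos, by simp⟩ ?_ ?_ ?_
  · rintro s t hst ⟨δ, hδ, h⟩
    exact ⟨δ, hδ, fun w hw => h w (hst hw)⟩
  · rintro s t ⟨δ, hδ, h⟩ ⟨δ', hδ', h'⟩
    refine ⟨min δ δ', lt_min hδ hδ', ?_⟩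
    rintro w (hw | hw) z hz
    · exact h w hw z (hz.trans_le (min_le_left _ _))
    · exact h' w hw z (hz.trans_le (min_le_right _ _))
  intro w₀ hw₀
  have hη2 : (0 : ℝ) < η / 2 := by positivity
  obtain ⟨r, hr, hr'⟩ := Metric.eventually_nhds_iff_ball.1
    ((hf w₀ (hKΛ hw₀)).isLittleO.def hη2)
  have hG := (continuousOn_gradient hΛ hf).continuousAt (hΛ.mem_nhds (hKΛ hw₀))
  obtain ⟨r', hr0', hrG⟩ := Metric.continuousAt_iff.1 hG _ hη2
  refine ⟨Metric.ball w₀ (min (r / 2) r'), mem_nhdsWithin_of_mem_nhds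
    (Metric.ball_mem_nhds _ (by positivity)), r / 2, by positivity, fun w hw z hz => ?_⟩
  have hw' := lt_min_iff.1 (Metric.mem_ball.1 hw)
  have h1 := hr' (w + z, w) (by
    rw [← ball_prod_same]
    refine ⟨?_, ?_⟩ <;> rw [Metric.mem_ball]
    · calc dist (w + z) w₀ ≤ dist (w + z) w + dist w w₀ := dist_triangle _ _ _
        _ < r := by rw [dist_eq_norm, add_sub_cancel_left]; linarith
    · linarith)
  have h2 : ‖G w - G w₀‖ < η / 2 := by rw [← dist_eq_norm]; exact hrG hw'.2
  simp only [add_sub_cancel_left, innerSL_apply_apply, Real.norm_eq_abs] at h1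
  have h3 := (abs_le.1 h1).2
  have h4 : -(‖G w - G w₀‖ * ‖z‖) ≤ inner ℝ (G w - G w₀) z :=
    (abs_le.1 (abs_real_inner_le_norm _ _)).1
  rw [inner_sub_left] at h4
  have h5 := mul_le_mul_of_nonneg_right h2.le (norm_nonneg z)
  linarith

variable [CompleteSpace H] {P : Type*} [TopologicalSpace P] [CompactSpace P] [Nonempty P]

theorem exists_almost_critical {f : H → ℝ} {G : H → H} {Λ : Set H} (hΛ : IsOpen Λ)
    (hf : ∀ w ∈ Λ, HasStrictFDerivAt f (innerSL ℝ (G w)) w) (hf0 : ∀ w ∈ Λ, 0 ≤ f w)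
    (hcl : ∀ C, closure {w ∈ Λ | f w ≤ C} ⊆ Λ) {F : Set C(P, H)}
    (hF : ∀ h ∈ F, ∀ p, h p ∈ Λ)
    (hclopen : ∀ h : C(P, H), (∀ p, h p ∈ Λ) → ∃ δ > 0, ∀ h' : C(P, H), dist h' h < δ →
      (∀ p, h' p ∈ Λ) ∧ (h ∈ F ↔ h' ∈ F)) {h₀ : C(P, H)} (hh₀ : h₀ ∈ F)
    {κ : ℝ} (hκ : 0 < κ) :
    ∃ w ∈ Λ, f w ≤ ⨆ p, f (h₀ p) ∧ ‖G w‖ ≤ κ ∧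
      ∀ L, (∀ h ∈ F, ∃ p, L ≤ f (h p)) → L - κ ≤ f w := by
  have hfc : ContinuousOn f Λ := fun w hw => (hf w hw).continuousAt.continuousWithinAt
  have hcont : ∀ h : C(P, H), (∀ p, h p ∈ Λ) → Continuous fun p => f (h p) := fun h hh =>
    hfc.comp_continuous h.continuous hh
  have hbdd : ∀ h : C(P, H), (∀ p, h p ∈ Λ) → BddAbove (Set.range fun p => f (h p)) :=
    fun h hh => (isCompact_range (hcont h hh)).bddAbove
  set C₀ := ⨆ p, f (h₀ p)
  let X : Set C(P, H) := {h | h ∈ F ∧ ∀ p, f (h p) ≤ C₀}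
  have hXcl : IsClosed X := by
    refine isClosed_of_closure_subset fun h hh => ?_
    have hev : ∀ p, Continuous fun g : C(P, H) => g p := fun p =>
      continuous_eval_const p
    have hΛ' : ∀ p, h p ∈ Λ := fun p => by
      apply hcl C₀
      refine closure_mono ?_ (image_closure_subset_closure_image (hev p) ⟨h, hh, rfl⟩)
      rintro _ ⟨g, hg, rfl⟩
      exact ⟨hF g hg.1 p, hg.2 p⟩
    refine ⟨?_, fun p => ?_⟩
    · obtain ⟨δ, hδ, h'⟩ := hclopen h hΛ'
      obtain ⟨g, hg, hd⟩ := Metric.mem_closure_iff.1 hh δ hδ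
      exact ((h' g (by rwa [dist_comm])).2).2 hg.1
    · obtain ⟨u, hu, hlim⟩ := mem_closure_iff_seq_limit.1 hh
      have h1 : Tendsto (fun n => f (u n p)) atTop (𝓝 (f (h p))) :=
        ((hf _ (hΛ' p)).continuousAt.tendsto).comp (((hev p).tendsto h).comp hlim)
      exact le_of_tendsto' h1 fun n => (hu n).2 p
  have : CompleteSpace X := hXcl.completeSpace_coe
  have : Nonempty X := ⟨⟨h₀, hh₀, le_ciSup (hbdd h₀ (hF h₀ hh₀))⟩⟩
  let J : X → ℝ := fun h => ⨆ p, f (h.1 p)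
  have hJ : LowerSemicontinuous J := by
    refine lowerSemicontinuous_ciSup (fun h => hbdd h.1 (hF h.1 h.2.1)) fun p => ?_
    exact (hfc.comp_continuous ((continuous_eval_const p).comp
      continuous_subtype_val) fun h : X => hF h.1 h.2.1 p).lowerSemicontinuous
  have hJ0 : ∀ h, 0 ≤ J h := fun h =>
    Real.iSup_nonneg fun p => hf0 _ (hF h.1 h.2.1 p)
  obtain ⟨⟨h, hhF, hhC⟩, hmin⟩ := exists_lt_add_dist hJ hJ0 (half_pos hκ)
  have hhΛ := hF h hhF
  set j : ℝ := ⨆ p, f (h p) with hj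
  have hjle : ∀ p, f (h p) ≤ j := le_ciSup (hbdd h hhΛ)
  have hjC : j ≤ C₀ := ciSup_le hhC
  suffices hex : ∃ p, j - κ ≤ f (h p) ∧ ‖G (h p)‖ ≤ κ by
    obtain ⟨p, hp, hG⟩ := hex
    refine ⟨h p, hhΛ p, hhC p, hG, fun L hL => ?_⟩
    obtain ⟨q, hq⟩ := hL h hhF
    linarith [hjle q]
  by_contra! hno
  have hGc : Continuous fun p => G (h p) :=
    (continuousOn_gradient hΛ hf).comp_continuous h.continuous hhΛ
  have hmax : ∀ p, 0 < max κ ‖G (h p)‖ := fun p => lt_max_of_lt_left hκ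
  let ν : C(P, H) := ⟨fun p => (max κ ‖G (h p)‖)⁻¹ • G (h p),
    ((continuous_const.max hGc.norm).inv₀ fun p => (hmax p).ne').smul hGc⟩
  have hν : ∀ p, ‖ν p‖ ≤ 1 := fun p => by
    change ‖(max κ ‖G (h p)‖)⁻¹ • G (h p)‖ ≤ 1
    rw [norm_smul, norm_inv, Real.norm_of_nonneg (hmax p).le, inv_mul_le_one₀ (hmax p)]
    exact le_max_right _ _
  have hinner : ∀ p, 0 ≤ (inner ℝ (G (h p)) (ν p) : ℝ) := fun p => by
    change 0 ≤ (inner ℝ (G (h p)) ((max κ ‖G (h p)‖)⁻¹ • G (h p)) : ℝ)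
    rw [inner_smul_right]
    exact mul_nonneg (inv_nonneg.2 (hmax p).le) real_inner_self_nonneg
  have hinner' : ∀ p, κ < ‖G (h p)‖ → κ ≤ (inner ℝ (G (h p)) (ν p) : ℝ) := fun p hp => by
    change κ ≤ (inner ℝ (G (h p)) ((max κ ‖G (h p)‖)⁻¹ • G (h p)) : ℝ)
    rw [inner_smul_right, real_inner_self_eq_norm_sq, max_eq_right hp.le, sq, inv_mul_cancel_left₀]
    · exact hp.le
    · exact (hκ.trans hp).ne'
  obtain ⟨δ₁, hδ₁, hdesc⟩ := exists_uniform_descent hΛ hf (isCompact_range h.continuous)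
    (by rintro _ ⟨p, rfl⟩; exact hhΛ p) (η := κ / 4) (by positivity)
  obtain ⟨δ₂, hδ₂, hopen⟩ := hclopen h hhΛ
  set s := min (1 / 2) (min (δ₁ / 2) (δ₂ / 2)) with hs
  have hs0 : 0 < s := by positivity
  have hs1 : s ≤ 1 / 2 := min_le_left _ _
  have hs2 : s ≤ δ₁ / 2 := (min_le_right _ _).trans (min_le_left _ _)
  have hs3 : s ≤ δ₂ / 2 := (min_le_right _ _).trans (min_le_right _ _)
  let h' : C(P, H) := h - s • ν
  have hh' : ∀ p, h' p = h p + -(s • ν p) := fun p => by simp [h', sub_eq_add_neg]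
  have hsν : ∀ p, ‖-(s • ν p)‖ ≤ s := fun p => by
    rw [norm_neg, norm_smul, Real.norm_of_nonneg hs0.le]
    exact mul_le_of_le_one_right hs0.le (hν p)
  have hdist : dist h h' ≤ s := by
    rw [ContinuousMap.dist_le hs0.le]
    intro p
    rw [hh', dist_self_add_right]
    exact hsν p
  have hh'F : h' ∈ F := ((hopen h' (by rw [dist_comm]; linarith)).2).1 hhF
  have hval : ∀ p, f (h' p) ≤ j - 3 / 4 * s * κ := fun p => by
    have h1 := hdesc (h p) ⟨p, rfl⟩ (-(s • ν p)) ((hsν p).trans_lt (by linarith))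
    rw [← hh', inner_neg_right, inner_smul_right] at h1
    have h2 := mul_le_mul_of_nonneg_left (hsν p) (by positivity : 0 ≤ κ / 4)
    by_cases hp : j - κ ≤ f (h p)
    · have h3 := mul_le_mul_of_nonneg_left (hinner' p (hno p hp)) hs0.le
      linarith [hjle p]
    · have h3 := mul_nonneg hs0.le (hinner p)
      push Not at hp
      nlinarith
  have hsκ : 0 < s * κ := by positivity
  have hh'X : h' ∈ X := ⟨hh'F, fun p => (hval p).trans (by linarith)⟩
  have hne : (⟨h', hh'X⟩ : X) ≠ ⟨h, hhF, hhC⟩ := by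
    intro heq
    have heq' : h' = h := congrArg Subtype.val heq
    have : j ≤ j - 3 / 4 * s * κ := by
      conv_lhs => rw [hj]
      exact ciSup_le fun p => by rw [← heq']; exact hval p
    linarith
  have h1 := hmin _ hne
  have h2 : J ⟨h', hh'X⟩ ≤ j - 3 / 4 * s * κ := ciSup_le hval
  have h3 : dist (⟨h, hhF, hhC⟩ : X) ⟨h', hh'X⟩ ≤ s := hdist
  have h4 : J ⟨h, hhF, hhC⟩ = j := rfl
  rw [h4] at h1
  nlinarith

end Hilbert

end Minimax

namespace Minimax

open Topology

variable {H Y : Type*} [NormedAddCommGroup H] [InnerProductSpace ℝ H] [CompleteSpace H]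
  [NormedAddCommGroup Y] [NormedSpace ℝ Y] {P : Type*} [TopologicalSpace P] [CompactSpace P]
  [Nonempty P]

/-- The minimax principle for the functional `½‖w‖² - Φ(A w)` with `A` a compact operator. -/
theorem exists_critical {A : H →L[ℝ] Y} (hA : IsCompactOperator A) {Ω : Set Y} (hΩ : IsOpen Ω)
    {Φ : Y → ℝ} {Φ' : Y → Y →L[ℝ] ℝ} (hΦ : ∀ u ∈ Ω, HasStrictFDerivAt Φ (Φ' u) u)
    (hΦ0 : ∀ u ∈ Ω, Φ u ≤ 0)
    (hcl : ∀ C, closure {u | ∃ w, A w = u ∧ u ∈ Ω ∧ 1 / 2 * ‖w‖ ^ 2 - Φ u ≤ C} ⊆ Ω)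
    {F : Set C(P, H)} (hF : ∀ h ∈ F, ∀ p, A (h p) ∈ Ω) (hne : F.Nonempty)
    (hclopen : ∀ h : C(P, H), (∀ p, A (h p) ∈ Ω) → ∃ δ > 0, ∀ h' : C(P, H), dist h' h < δ →
      (∀ p, A (h' p) ∈ Ω) ∧ (h ∈ F ↔ h' ∈ F)) :
    ∃ w, A w ∈ Ω ∧ (∀ φ, inner ℝ w φ = Φ' (A w) (A φ)) ∧
      ∀ L, (∀ h ∈ F, ∃ p, L ≤ 1 / 2 * ‖h p‖ ^ 2 - Φ (A (h p))) →
        L ≤ 1 / 2 * ‖w‖ ^ 2 - Φ (A w) := by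
  let f : H → ℝ := fun w => 1 / 2 * ‖w‖ ^ 2 - Φ (A w)
  let R : Y → H := fun u => (InnerProductSpace.toDual ℝ H).symm ((Φ' u).comp A)
  let G : H → H := fun w => w - R (A w)
  have hRc : ContinuousOn R Ω := by
    have h1 := continuousOn_of_hasStrictFDerivAt hΩ hΦ
    have h2 : Continuous fun l : Y →L[ℝ] ℝ => (InnerProductSpace.toDual ℝ H).symm (l.comp A) :=
      (InnerProductSpace.toDual ℝ H).symm.continuous.comp (by fun_prop)
    exact h2.comp_continuousOn h1
  have hR : ∀ u φ, inner ℝ (R u) φ = Φ' u (A φ) := fun u φ =>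
    InnerProductSpace.toDual_symm_apply (𝕜 := ℝ)
  have hΛ : IsOpen (A ⁻¹' Ω) := hΩ.preimage A.continuous
  have hf : ∀ w ∈ A ⁻¹' Ω, HasStrictFDerivAt f (innerSL ℝ (G w)) w := by
    intro w hw
    have h1 := ((hasStrictFDerivAt_norm_sq w).const_mul (1 / 2 : ℝ)).sub
      ((hΦ (A w) hw).comp w A.hasStrictFDerivAt)
    refine h1.congr_fderiv ?_
    ext φ
    simp [G, hR]
  have hf0 : ∀ w ∈ A ⁻¹' Ω, 1 / 2 * ‖w‖ ^ 2 ≤ f w := fun w hw => by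
    have := hΦ0 _ hw
    simp only [f]; linarith
  have hcl' : ∀ C, closure {w ∈ A ⁻¹' Ω | f w ≤ C} ⊆ A ⁻¹' Ω := fun C w hw => by
    apply hcl C
    refine closure_mono ?_ (image_closure_subset_closure_image A.continuous ⟨w, hw, rfl⟩)
    rintro _ ⟨v, hv, rfl⟩
    exact ⟨v, rfl, hv.1, hv.2⟩
  obtain ⟨h₀, hh₀⟩ := hne
  have hstep := fun n : ℕ => exists_almost_critical hΛ hf
    (fun w hw => le_trans (by positivity) (hf0 w hw)) hcl' hF hclopen hh₀
    (κ := 1 / (n + 1 : ℝ)) (by positivity)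
  choose w hwΛ hwC hwG hwL using hstep
  set C₀ := ⨆ p, f (h₀ p)
  have hwb : ∀ n, w n ∈ Metric.closedBall (0 : H) (√(2 * C₀)) := fun n => by
    rw [mem_closedBall_zero_iff]
    apply Real.le_sqrt_of_sq_le
    linarith [hf0 _ (hwΛ n), hwC n]
  obtain ⟨u, -, ψ, hψ, hlim⟩ := (hA.isCompact_closure_image_closedBall (√(2 * C₀))).tendsto_subseq
    (fun n => subset_closure (Set.mem_image_of_mem A (hwb n)))
  have huΩ : u ∈ Ω := hcl C₀ (mem_closure_of_tendsto hlim
    (Eventually.of_forall fun n => ⟨w (ψ n), rfl, hwΛ _, hwC _⟩))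
  have hε : Tendsto (fun n => 1 / ((ψ n : ℕ) + 1 : ℝ)) atTop (𝓝 0) :=
    tendsto_one_div_add_atTop_nhds_zero_nat.comp hψ.tendsto_atTop
  have hG0 : Tendsto (fun n => G (w (ψ n))) atTop (𝓝 0) :=
    squeeze_zero_norm (fun n => hwG (ψ n)) hε
  have hwlim : Tendsto (fun n => w (ψ n)) atTop (𝓝 (R u)) := by
    have h1 := hG0.add (((hRc.continuousAt (hΩ.mem_nhds huΩ)).tendsto).comp hlim)
    rw [zero_add] at h1
    refine h1.congr fun n => ?_
    simp [G]
  have hAu : A (R u) = u := tendsto_nhds_unique ((A.continuous.tendsto _).comp hwlim) hlim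
  have hmem : R u ∈ A ⁻¹' Ω := by rw [Set.mem_preimage, hAu]; exact huΩ
  refine ⟨R u, hmem, fun φ => by rw [hAu, hR], fun L hL => ?_⟩
  have h1 : Tendsto (fun n => L - 1 / ((ψ n : ℕ) + 1 : ℝ)) atTop (𝓝 (L - 0)) :=
    tendsto_const_nhds.sub hε
  rw [sub_zero] at h1
  exact le_of_tendsto_of_tendsto' h1 (((hf _ hmem).continuousAt.tendsto).comp hwlim)
    fun n => hwL (ψ n) L hL

end Minimax

namespace HalfPeriod

open Topology ENNReal

/-- The closed interval `[0, τ]` as a type. -/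
abbrev Seg (τ : ℝ) : Type := Set.Icc (0 : ℝ) τ

variable {τ : ℝ}

instance : MeasureSpace (Seg τ) := Measure.Subtype.measureSpace

lemma volume_univ : volume (Set.univ : Set (Seg τ)) = ENNReal.ofReal τ := by
  rw [← volume_image_subtype_coe measurableSet_Icc, Set.image_univ, Subtype.range_coe,
    Real.volume_Icc, sub_zero]

instance : IsFiniteMeasure (volume : Measure (Seg τ)) := ⟨by rw [volume_univ]; simp⟩

lemma volume_Ioc (s t : Seg τ) : volume (Set.Ioc s t) = ENNReal.ofReal (t - s) := by
  rw [← volume_image_subtype_coe measurableSet_Icc, Set.image_subtype_val_Ioc, Real.volume_Ioc]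

lemma setIntegral_Iic {E : Type*} [NormedAddCommGroup E] [NormedSpace ℝ E]
    (u : ℝ → E) (t : Seg τ) :
    ∫ s in Set.Iic t, u s = ∫ s in (0 : ℝ)..t, u s := by
  have h := (MeasurableEmbedding.subtype_coe
    (measurableSet_Icc (a := (0 : ℝ)) (b := τ))).setIntegral_map
    (μ := Measure.comap Subtype.val volume) u (Set.Iic (t : ℝ))
  rw [map_comap_subtype_coe measurableSet_Icc, Measure.restrict_restrict measurableSet_Iic] at h
  rw [intervalIntegral.integral_of_le t.2.1, ← integral_Icc_eq_integral_Ioc]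
  have h1 : Set.Iic (t : ℝ) ∩ Set.Icc 0 τ = Set.Icc (0 : ℝ) t := by
    ext x
    simp only [Set.mem_inter_iff, Set.mem_Iic, Set.mem_Icc]
    exact ⟨fun h => ⟨h.2.1, h.1⟩, fun h => ⟨h.2, h.1, h.2.trans t.2.2⟩⟩
  rw [h1] at h
  exact h.symm

lemma integral_eq_intervalIntegral {E : Type*} [NormedAddCommGroup E] [NormedSpace ℝ E]
    (hτ : 0 ≤ τ) (u : ℝ → E) : ∫ s : Seg τ, u s = ∫ s in (0 : ℝ)..τ, u s := by
  have h := setIntegral_Iic u ⟨τ, hτ, le_rfl⟩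
  rwa [show Set.Iic (⟨τ, hτ, le_rfl⟩ : Seg τ) = Set.univ from
    Set.eq_univ_of_forall fun s => s.2.2, setIntegral_univ] at h

/-- Square integrable functions on `[0, τ]`. -/
abbrev L2 (τ : ℝ) (E : Type*) [NormedAddCommGroup E] : Type _ :=
  Lp E 2 (volume : Measure (Seg τ))

lemma integrable {E : Type*} [NormedAddCommGroup E] (w : L2 τ E) : Integrable w :=
  (Lp.memLp w).integrable one_le_two

variable {E : Type*} [NormedAddCommGroup E] [InnerProductSpace ℝ E]

/-- The primitive of `w` that takes opposite values at the two ends. -/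
def prim (w : L2 τ E) (t : Seg τ) : E := (∫ s in Set.Iic t, w s) - (1 / 2 : ℝ) • ∫ s, w s

lemma prim_sub_prim (w : L2 τ E) {s t : Seg τ} (hst : s ≤ t) :
    prim w t - prim w s = ∫ r in Set.Ioc s t, w r := by
  have h := setIntegral_union (μ := volume) (f := w) (s := Set.Iic s) (t := Set.Ioc s t)
    (Set.Iic_disjoint_Ioc le_rfl) measurableSet_Ioc (integrable w).integrableOn
    (integrable w).integrableOn
  rw [Set.Iic_union_Ioc_eq_Iic hst] at h
  simp only [prim, h]
  abel

lemma prim_right (hτ : 0 ≤ τ) (w : L2 τ E) :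
    prim w ⟨τ, hτ, le_rfl⟩ = -prim w ⟨0, le_rfl, hτ⟩ := by
  have h1 : Set.Iic (⟨τ, hτ, le_rfl⟩ : Seg τ) = Set.univ :=
    Set.eq_univ_of_forall fun s => s.2.2
  have h2 : Set.Iic (⟨0, le_rfl, hτ⟩ : Seg τ) = {⟨0, le_rfl, hτ⟩} := by
    ext s
    simp only [Set.mem_Iic, Set.mem_singleton_iff]
    exact ⟨fun h => le_antisymm h s.2.1, fun h => h.le⟩
  have h3 : volume ({⟨0, le_rfl, hτ⟩} : Set (Seg τ)) = 0 := by
    rw [← volume_image_subtype_coe measurableSet_Icc]; simp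
  simp only [prim]
  rw [h1, h2, setIntegral_measure_zero _ h3, setIntegral_univ]
  module

variable [CompleteSpace E]

lemma norm_setIntegral_le (w : L2 τ E) {S : Set (Seg τ)} (hS : MeasurableSet S) :
    ‖∫ s in S, w s‖ ≤ √(volume.real S) * ‖w‖ := by
  set c := ∫ s in S, w s with hc
  have h1 := L2.inner_indicatorConstLp_eq_inner_setIntegral ℝ hS (measure_ne_top volume S) c w
  rw [← hc, real_inner_self_eq_norm_sq] at h1
  have h2 := real_inner_le_norm (indicatorConstLp 2 hS (measure_ne_top volume S) c) w
  rw [h1, norm_indicatorConstLp (by simp) (by simp), sq] at h2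
  rcases (norm_nonneg c).eq_or_lt with h0 | h0
  · rw [← h0]; positivity
  · rw [Real.sqrt_eq_rpow]
    simp only [ENNReal.toReal_ofNat] at h2
    refine le_of_mul_le_mul_left ?_ h0
    linarith

lemma norm_prim_sub_le (w : L2 τ E) {s t : Seg τ} (hst : s ≤ t) :
    ‖prim w t - prim w s‖ ≤ √(t - s) * ‖w‖ := by
  rw [prim_sub_prim w hst]
  refine (norm_setIntegral_le w measurableSet_Ioc).trans_eq ?_
  rw [Measure.real, volume_Ioc, ENNReal.toReal_ofReal (sub_nonneg.2 hst)]

lemma dist_prim_le (w : L2 τ E) (s t : Seg τ) :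
    dist (prim w s) (prim w t) ≤ √(dist s t) * ‖w‖ := by
  rcases le_total s t with h | h
  · rw [dist_comm, dist_eq_norm, Subtype.dist_eq, dist_comm, Real.dist_eq,
      abs_of_nonneg (sub_nonneg.2 (Subtype.coe_le_coe.2 h))]
    exact norm_prim_sub_le w h
  · rw [dist_eq_norm, Subtype.dist_eq, Real.dist_eq,
      abs_of_nonneg (sub_nonneg.2 (Subtype.coe_le_coe.2 h))]
    exact norm_prim_sub_le w h

lemma continuous_prim (w : L2 τ E) : Continuous (prim w) := by
  rw [continuous_iff_continuousAt]
  intro t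
  rw [ContinuousAt, tendsto_iff_dist_tendsto_zero]
  refine squeeze_zero (fun _ => dist_nonneg) (fun s => dist_prim_le w s t) ?_
  have : Continuous fun s : Seg τ => √(dist s t) * ‖w‖ := by fun_prop
  have h := this.tendsto t
  rwa [dist_self, Real.sqrt_zero, zero_mul] at h

lemma norm_prim_le (w : L2 τ E) (t : Seg τ) : ‖prim w t‖ ≤ 2 * √τ * ‖w‖ := by
  have hτ : 0 ≤ τ := t.2.1.trans t.2.2
  have hS : ∀ S : Set (Seg τ), volume.real S ≤ τ := fun S => by
    calc volume.real S ≤ volume.real (Set.univ : Set (Seg τ)) :=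
          measureReal_mono (Set.subset_univ _)
      _ = τ := by rw [Measure.real, volume_univ, ENNReal.toReal_ofReal hτ]
  have h1 : ∀ S : Set (Seg τ), MeasurableSet S → ‖∫ s in S, w s‖ ≤ √τ * ‖w‖ := fun S hm =>
    (norm_setIntegral_le w hm).trans
      (mul_le_mul_of_nonneg_right (Real.sqrt_le_sqrt (hS S)) (norm_nonneg _))
  have h2 := h1 _ (measurableSet_Iic (a := t))
  have h3 := h1 _ MeasurableSet.univ
  rw [setIntegral_univ] at h3
  have h4 : 0 ≤ √τ * ‖w‖ := by positivity
  calc ‖prim w t‖ ≤ _ := norm_sub_le _ _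
    _ ≤ √τ * ‖w‖ + 1 / 2 * (√τ * ‖w‖) := by
      rw [norm_smul]; norm_num; linarith
    _ ≤ _ := by linarith

/-- The primitive operator `w ↦ prim w`, into continuous functions. -/
def primL (τ : ℝ) (E : Type*) [NormedAddCommGroup E] [InnerProductSpace ℝ E] [CompleteSpace E] :
    L2 τ E →L[ℝ] C(Seg τ, E) :=
  LinearMap.mkContinuous
    { toFun := fun w => ⟨prim w, continuous_prim w⟩
      map_add' := fun w v => by
        ext t
        have h := Lp.coeFn_add w v
        change prim (w + v) t = prim w t + prim v t
        simp only [prim]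
        rw [integral_congr_ae h, integral_congr_ae (ae_restrict_of_ae h)]
        simp only [Pi.add_apply]
        rw [integral_add (integrable w) (integrable v),
          integral_add (integrable w).integrableOn (integrable v).integrableOn]
        module
      map_smul' := fun c w => by
        ext t
        have h := Lp.coeFn_smul c w
        change prim (c • w) t = c • prim w t
        simp only [prim]
        rw [integral_congr_ae h, integral_congr_ae (ae_restrict_of_ae h)]
        simp only [Pi.smul_apply]
        rw [integral_smul, integral_smul]
        module } (2 * √τ) fun w =>
    (ContinuousMap.norm_le _ (by positivity)).2 (norm_prim_le w)

@[simp] lemma primL_apply (w : L2 τ E) (t : Seg τ) : primL τ E w t = prim w t := rfl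

lemma isCompactOperator_primL [FiniteDimensional ℝ E] : IsCompactOperator (primL τ E) := by
  have : ProperSpace E := FiniteDimensional.proper ℝ E
  let e := ContinuousMap.isometryEquivBoundedOfCompact (Seg τ) E
  let S : Set (BoundedContinuousFunction (Seg τ) E) :=
    (fun w => e (primL τ E w)) '' Metric.ball 0 1
  have hS : IsCompact (closure S) := by
    refine BoundedContinuousFunction.arzela_ascoli (Metric.closedBall 0 (2 * √τ))
      (isCompact_closedBall _ _) S ?_ ?_
    · rintro _ t ⟨w, hw, rfl⟩
      rw [mem_closedBall_zero_iff]
      rw [mem_ball_zero_iff] at hw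
      exact (norm_prim_le w t).trans (mul_le_of_le_one_right (by positivity) hw.le)
    · refine Metric.equicontinuous_of_continuity_modulus (fun r => √r) ?_ _ ?_
      · simpa using (Real.continuous_sqrt.tendsto 0)
      · rintro s t ⟨_, w, hw, rfl⟩
        rw [mem_ball_zero_iff] at hw
        exact (dist_prim_le w s t).trans (mul_le_of_le_one_right (by positivity) hw.le)
  refine ⟨e.symm '' closure S, hS.image e.symm.continuous, ?_⟩
  filter_upwards [Metric.ball_mem_nhds (0 : L2 τ E) one_pos] with w hw
  exact ⟨e (primL τ E w), subset_closure ⟨w, hw, rfl⟩, e.symm_apply_apply _⟩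

end HalfPeriod

namespace HalfPeriod

open Topology ENNReal

variable {τ : ℝ} {E : Type*} [NormedAddCommGroup E] [InnerProductSpace ℝ E]

/-- The inclusion of continuous functions in square integrable functions. -/
abbrev incl (τ : ℝ) (E : Type*) [NormedAddCommGroup E] [InnerProductSpace ℝ E] :
    C(Seg τ, E) →L[ℝ] L2 τ E :=
  ContinuousMap.toLp 2 volume ℝ

lemma inner_incl (u v : C(Seg τ, E)) :
    inner ℝ (incl τ E u) (incl τ E v) = ∫ t, inner ℝ (u t) (v t) := by
  rw [L2.inner_def]
  refine integral_congr_ae ?_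
  filter_upwards [ContinuousMap.coeFn_toLp (p := 2) (𝕜 := ℝ) volume u,
    ContinuousMap.coeFn_toLp (p := 2) (𝕜 := ℝ) volume v] with t h1 h2
  rw [h1, h2]

/-- The primitive of a continuous function on the line that takes opposite values at `0` and `τ`. -/
def antiprim (τ : ℝ) (g : ℝ → E) (t : ℝ) : E :=
  (∫ s in (0 : ℝ)..t, g s) - (1 / 2 : ℝ) • ∫ s in (0 : ℝ)..τ, g s

lemma prim_incl (hτ : 0 ≤ τ) {g : ℝ → E} {u : C(Seg τ, E)} (hu : ∀ t : Seg τ, u t = g t)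
    (t : Seg τ) : prim (incl τ E u) t = antiprim τ g t := by
  have h : incl τ E u =ᵐ[volume] fun s : Seg τ => g s :=
    (ContinuousMap.coeFn_toLp (p := 2) (𝕜 := ℝ) volume u).trans
      (Eventually.of_forall fun s => hu s)
  rw [prim, antiprim, integral_congr_ae (ae_restrict_of_ae h), integral_congr_ae h,
    setIntegral_Iic, integral_eq_intervalIntegral hτ]

lemma hasDerivAt_antiprim [CompleteSpace E] {g : ℝ → E} (hg : Continuous g) (t : ℝ) :
    HasDerivAt (antiprim τ g) (g t) t :=
  (intervalIntegral.integral_hasDerivAt_right (hg.intervalIntegrable _ _)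
    hg.stronglyMeasurable.stronglyMeasurableAtFilter hg.continuousAt).sub_const _

lemma antiprim_right (g : ℝ → E) : antiprim τ g τ = -antiprim τ g 0 := by
  simp only [antiprim, intervalIntegral.integral_same]
  module

variable [CompleteSpace E]

lemma continuous_antiprim {g : ℝ → E} (hg : Continuous g) : Continuous (antiprim τ g) :=
  continuous_iff_continuousAt.2 fun t => (hasDerivAt_antiprim hg t).continuousAt

lemma integral_inner_antiprim {f g : ℝ → E} (hf : Continuous f) (hg : Continuous g) :
    ∫ t in (0 : ℝ)..τ, inner ℝ (f t) (antiprim τ g t) =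
      -∫ t in (0 : ℝ)..τ, inner ℝ (antiprim τ f t) (g t) := by
  have hF := continuous_antiprim (τ := τ) hf
  have hG := continuous_antiprim (τ := τ) hg
  have h1 : Continuous fun t => inner ℝ (antiprim τ f t) (g t) := hF.inner hg
  have h2 : Continuous fun t => inner ℝ (f t) (antiprim τ g t) := hf.inner hG
  have h := intervalIntegral.integral_eq_sub_of_hasDerivAt
    (fun t _ => (hasDerivAt_antiprim (τ := τ) hf t).inner ℝ (hasDerivAt_antiprim (τ := τ) hg t))
    ((h1.add h2).intervalIntegrable 0 τ)
  rw [intervalIntegral.integral_add (h1.intervalIntegrable _ _) (h2.intervalIntegrable _ _),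
    antiprim_right, antiprim_right, inner_neg_neg, sub_self] at h
  linarith

/-- The primitive of a `C¹` function with opposite values at the ends is the function itself. -/
lemma antiprim_deriv {v g : ℝ → E} (hg : Continuous g) (hv : ∀ t, HasDerivAt v (g t) t)
    (hanti : v τ = -v 0) (t : ℝ) : antiprim τ g t = v t := by
  rw [antiprim, intervalIntegral.integral_eq_sub_of_hasDerivAt (fun s _ => hv s)
    (hg.intervalIntegrable _ _), intervalIntegral.integral_eq_sub_of_hasDerivAt (fun s _ => hv s)
    (hg.intervalIntegrable _ _), hanti]
  module

theorem eq_neg_incl_primL (hτ : 0 ≤ τ) {w : L2 τ E} {g : C(Seg τ, E)}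
    (h : ∀ φ, inner ℝ w φ = ∫ t, inner ℝ (g t) (primL τ E φ t)) :
    w = -incl τ E (primL τ E (incl τ E g)) := by
  suffices hs : (fun φ : L2 τ E => (inner ℝ w φ : ℝ)) =
      fun φ => inner ℝ (-incl τ E (primL τ E (incl τ E g))) φ from
    ext_inner_right ℝ fun φ => congrFun hs φ
  have : SecondCountableTopologyEither (Seg τ) E := inferInstance
  refine (ContinuousMap.toLp_denseRange (p := 2) (μ := volume) E ℝ (by simp)).equalizer
    (by fun_prop) (by fun_prop) ?_
  ext v
  change inner ℝ w (incl τ E v) = inner ℝ (-incl τ E (primL τ E (incl τ E g))) (incl τ E v)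
  rw [h, inner_neg_left, inner_incl]
  let g' : ℝ → E := Set.IccExtend hτ g
  let v' : ℝ → E := Set.IccExtend hτ v
  have hg' : ∀ t : Seg τ, g t = g' t := fun t => (Set.IccExtend_val hτ g t).symm
  have hv' : ∀ t : Seg τ, v t = v' t := fun t => (Set.IccExtend_val hτ v t).symm
  have hgc : Continuous g' := g.continuous.Icc_extend'
  have hvc : Continuous v' := v.continuous.Icc_extend'
  simp only [primL_apply, prim_incl hτ hg', prim_incl hτ hv', hg', hv']
  rw [integral_eq_intervalIntegral hτ (fun t => inner ℝ (g' t) (antiprim τ v' t)),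
    integral_eq_intervalIntegral hτ (fun t => inner ℝ (antiprim τ g' t) (v' t))]
  exact integral_inner_antiprim hgc hvc

end HalfPeriod

namespace HalfPeriod

open Topology

section Tube

variable {X E : Type*} [MetricSpace X] [CompactSpace X] [NormedAddCommGroup E]

lemma isOpen_forall_mem {O : Set E} (hO : IsOpen O) : IsOpen {u : C(X, E) | ∀ t, u t ∈ O} := by
  simpa [Set.MapsTo] using ContinuousMap.isOpen_setOfPred_mapsTo (isCompact_univ (X := X)) hO

lemma exists_ball_subset {U : Set (X × E)} (hU : IsOpen U) {u : C(X, E)}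
    (hu : ∀ t, (t, u t) ∈ U) : ∃ r > 0, ∀ t y, dist y (u t) < r → (t, y) ∈ U := by
  have hK : IsCompact (Set.range fun t => (t, u t)) :=
    isCompact_range (continuous_id.prodMk u.continuous)
  obtain ⟨r, hr, h⟩ := hK.exists_thickening_subset_open hU (by rintro _ ⟨t, rfl⟩; exact hu t)
  refine ⟨r, hr, fun t y hy => h ?_⟩
  rw [Metric.mem_thickening_iff]
  refine ⟨(t, u t), ⟨t, rfl⟩, ?_⟩
  rw [Prod.dist_eq]
  simpa [hr] using hy

end Tube

section Superposition

variable {X : Type*} [MetricSpace X] [CompactSpace X] [MeasurableSpace X] [BorelSpace X]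
  {μ : Measure X} [IsFiniteMeasure μ]

lemma integrable_of_continuous {F : Type*} [NormedAddCommGroup F] {f : X → F}
    (hf : Continuous f) : Integrable f μ :=
  hf.integrable_of_hasCompactSupport (HasCompactSupport.of_compactSpace f)

variable {E : Type*} [NormedAddCommGroup E] [NormedSpace ℝ E]

/-- Integration against a continuous field of linear forms. -/
def integralForm (μ : Measure X) [IsFiniteMeasure μ] (L : C(X, E →L[ℝ] ℝ)) : C(X, E) →L[ℝ] ℝ :=
  LinearMap.mkContinuous
    { toFun := fun φ => ∫ t, L t (φ t) ∂μ
      map_add' := fun φ ψ => by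
        simp only [ContinuousMap.add_apply, map_add]
        exact integral_add
          (integrable_of_continuous (L.continuous.clm_apply φ.continuous))
          (integrable_of_continuous (L.continuous.clm_apply ψ.continuous))
      map_smul' := fun c φ => by
        simp only [ContinuousMap.smul_apply, map_smul]
        exact integral_smul _ _ } (‖L‖ * μ.real Set.univ) fun φ => by
    calc ‖∫ t, L t (φ t) ∂μ‖ ≤ ‖L‖ * ‖φ‖ * μ.real Set.univ := by
          refine norm_integral_le_of_norm_le_const (Eventually.of_forall fun t => ?_)
          exact (L t).le_of_opNorm_le_of_le (L.norm_coe_le_norm t) (φ.norm_coe_le_norm t)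
      _ = _ := by ring

lemma integralForm_apply (L : C(X, E →L[ℝ] ℝ)) (φ : C(X, E)) :
    integralForm μ L φ = ∫ t, L t (φ t) ∂μ := rfl

theorem hasStrictFDerivAt_integral {O : Set E} (hO : IsOpen O) {W : X → E → ℝ}
    {D : X → E → E →L[ℝ] ℝ} (hW : ContinuousOn (fun p : X × E => W p.1 p.2) (Set.univ ×ˢ O))
    (hD : ContinuousOn (fun p : X × E => D p.1 p.2) (Set.univ ×ˢ O))
    (hWD : ∀ t, ∀ x ∈ O, HasFDerivAt (W t) (D t x) x) {u : C(X, E)} (hu : ∀ t, u t ∈ O)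
    (L : C(X, E →L[ℝ] ℝ)) (hL : ∀ t, L t = D t (u t)) :
    HasStrictFDerivAt (fun v : C(X, E) => ∫ t, W t (v t) ∂μ) (integralForm μ L) u := by
  refine .of_isLittleO (Asymptotics.IsLittleO.of_bound fun c hc => ?_)
  set m := μ.real Set.univ
  have hm : 0 ≤ m := measureReal_nonneg
  set c' := c / (m + 1) with hc'
  have hc0 : 0 < c' := by positivity
  have hOo : IsOpen ((Set.univ : Set X) ×ˢ O) := isOpen_univ.prod hO
  have hU : IsOpen (((Set.univ : Set X) ×ˢ O) ∩
      (fun p : X × E => ‖D p.1 p.2 - L p.1‖) ⁻¹' Set.Iio c') :=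
    (hD.sub (L.continuous.comp continuous_fst).continuousOn).norm.isOpen_inter_preimage hOo
      isOpen_Iio
  obtain ⟨r, hr, hball⟩ := exists_ball_subset hU (u := u) fun t => by
    refine ⟨⟨trivial, hu t⟩, ?_⟩
    simp [hL, hc0]
  filter_upwards [prod_mem_nhds (Metric.ball_mem_nhds u hr) (Metric.ball_mem_nhds u hr)]
    with p ⟨hp1, hp2⟩
  have hpt : ∀ v ∈ Metric.ball u r, ∀ t, v t ∈ Metric.ball (u t) r := fun v hv t =>
    (ContinuousMap.dist_apply_le_dist t).trans_lt hv
  have hcont : ∀ v ∈ Metric.ball u r, Integrable (fun t => W t (v t)) μ := fun v hv =>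
    integrable_of_continuous (hW.comp_continuous (continuous_id.prodMk v.continuous)
      fun t => (hball t _ (hpt v hv t)).1)
  have hest : ∀ t, ‖W t (p.1 t) - W t (p.2 t) - L t ((p.1 - p.2) t)‖ ≤ c' * ‖p.1 - p.2‖ := by
    intro t
    have h1 := (convex_ball (u t) r).norm_image_sub_le_of_norm_hasFDerivWithin_le'
      (f := W t) (f' := D t) (φ := L t) (C := c')
      (fun x hx => (hWD t x (hball t x hx).1.2).hasFDerivWithinAt)
      (fun x hx => (hball t x hx).2.le)
      (hpt _ hp2 t) (hpt _ hp1 t)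
    refine h1.trans (mul_le_mul_of_nonneg_left ?_ hc0.le)
    exact (p.1 - p.2).norm_coe_le_norm t
  have hLi : Integrable (fun t => L t ((p.1 - p.2) t)) μ :=
    integrable_of_continuous (L.continuous.clm_apply (p.1 - p.2).continuous)
  rw [integralForm_apply, ← integral_sub (hcont _ hp1) (hcont _ hp2),
    ← integral_sub (f := fun t => W t (p.1 t) - W t (p.2 t))
      ((hcont _ hp1).sub (hcont _ hp2)) hLi]
  calc _ ≤ c' * ‖p.1 - p.2‖ * m := norm_integral_le_of_norm_le_const (Eventually.of_forall hest)
    _ = c * (m / (m + 1)) * ‖p.1 - p.2‖ := by rw [hc']; field_simp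
    _ ≤ c * ‖p.1 - p.2‖ := by
      refine mul_le_mul_of_nonneg_right (mul_le_of_le_one_right hc.le ?_) (norm_nonneg _)
      rw [div_le_one (by positivity)]; linarith

end Superposition

end HalfPeriod

namespace NBody

open Topology

lemma hasFDerivAt_unique_of_comp_neg {E : Type*} [NormedAddCommGroup E] [NormedSpace ℝ E]
    {f g : E → ℝ} {f' g' : E →L[ℝ] ℝ} {x : E} (hfg : ∀ y, f (-y) = g y)
    (hf : HasFDerivAt f f' (-x)) (hg : HasFDerivAt g g' x) : f' = -g' := by
  have h1 : HasFDerivAt (fun y : E => -y) (-ContinuousLinearMap.id ℝ E) x := (hasFDerivAt_id x).neg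
  have h2 := hf.comp x h1
  rw [← funext hfg] at hg
  rw [hg.unique h2]
  ext y
  simp

variable {N k : ℕ}

/-- The configuration space of `N` bodies in `k`-dimensional space. -/
abbrev Conf (N k : ℕ) : Type := PiLp 2 fun _ : Fin N => EuclideanSpace ℝ (Fin k)

/-- The configurations without collisions. -/
def free (N k : ℕ) : Set (Conf N k) := {x | ∀ i j, i ≠ j → x i ≠ x j}

lemma isOpen_free : IsOpen (free N k) := by
  have : free N k = ⋂ i, ⋂ j, {x : Conf N k | i ≠ j → x i ≠ x j} := by
    ext x; simp [free]
  rw [this]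
  refine isOpen_iInter_of_finite fun i => isOpen_iInter_of_finite fun j => ?_
  by_cases hij : i = j
  · simp [hij]
  · simp only [ne_eq, hij, not_false_eq_true, forall_const]
    exact isOpen_ne_fun (by fun_prop) (by fun_prop)

lemma neg_mem_free {x : Conf N k} (hx : x ∈ free N k) : -x ∈ free N k := fun i j hij => by
  simpa using hx i j hij

variable {Vij : Fin N → Fin N → ℝ → EuclideanSpace ℝ (Fin k) → ℝ}

/-- Hypotheses (V1)-(V6) on the potential, with half-period `τ`. -/
structure Admissible (τ : ℝ) (Vij : Fin N → Fin N → ℝ → EuclideanSpace ℝ (Fin k) → ℝ) : Prop where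
  pos : 0 < τ
  contDiffOn : ∀ i j, i ≠ j →
    ContDiffOn ℝ 1 (fun p : ℝ × EuclideanSpace ℝ (Fin k) => Vij i j p.1 p.2)
      (Set.univ ×ˢ {(0 : EuclideanSpace ℝ (Fin k))}ᶜ)
  lt_neg : ∀ i j, i ≠ j → ∀ M : ℝ, ∃ δ > (0:ℝ), ∀ t : ℝ,
    ∀ ξ : EuclideanSpace ℝ (Fin k), ξ ≠ 0 → ‖ξ‖ < δ → Vij i j t ξ < -M
  nonpos : ∀ i j, i ≠ j → ∀ (t : ℝ) (ξ : EuclideanSpace ℝ (Fin k)), ξ ≠ 0 → Vij i j t ξ ≤ 0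
  strong : ∀ i j, i ≠ j → ∃ 𝒩 : Set (EuclideanSpace ℝ (Fin k)),
    IsOpen 𝒩 ∧ (0 : EuclideanSpace ℝ (Fin k)) ∈ 𝒩 ∧
    ∃ U : EuclideanSpace ℝ (Fin k) → ℝ, ContDiffOn ℝ 1 U (𝒩 \ {0}) ∧
      Tendsto U (nhdsWithin 0 (𝒩 \ {0})) atTop ∧
      ∀ t : ℝ, ∀ ξ ∈ 𝒩 \ {0}, ‖gradient U ξ‖ ^ 2 ≤ -Vij i j t ξ
  symm : ∀ i j t ξ, Vij i j (t + τ) (-ξ) = Vij i j t ξ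

variable {τ : ℝ} (h : Admissible τ Vij)

include h

lemma Admissible.contDiffOn_Vtot :
    ContDiffOn ℝ 1 (fun p : ℝ × Conf N k => Vtot Vij p.1 p.2) (Set.univ ×ˢ free N k) := by
  unfold Vtot
  refine contDiffOn_const.mul (ContDiffOn.sum fun i _ => ContDiffOn.sum fun j _ => ?_)
  by_cases hij : i = j
  · simpa [hij] using contDiffOn_const
  · simp only [ne_eq, hij, not_false_eq_true, if_true]
    refine (h.contDiffOn i j hij).comp (f := fun p : ℝ × Conf N k => (p.1, p.2 i - p.2 j)) ?_ ?_
    · exact ContDiff.contDiffOn (by fun_prop)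
    · rintro ⟨t, x⟩ ⟨-, hx⟩
      exact ⟨trivial, by simpa [sub_eq_zero] using hx i j hij⟩

omit h in
/-- The differential of the potential in the space variable. -/
def dV (Vij : Fin N → Fin N → ℝ → EuclideanSpace ℝ (Fin k) → ℝ) (t : ℝ) (x : Conf N k) :
    Conf N k →L[ℝ] ℝ :=
  (fderiv ℝ (fun p : ℝ × Conf N k => Vtot Vij p.1 p.2) (t, x)).comp
    (ContinuousLinearMap.inr ℝ ℝ (Conf N k))

omit h in
lemma isOpen_univ_prod_free : IsOpen ((Set.univ : Set ℝ) ×ˢ free N k) :=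
  isOpen_univ.prod isOpen_free

lemma Admissible.hasFDerivAt (t : ℝ) {x : Conf N k} (hx : x ∈ free N k) :
    HasFDerivAt (fun x : Conf N k => Vtot Vij t x) (dV Vij t x) x := by
  have h1 := ((h.contDiffOn_Vtot.contDiffAt
    (isOpen_univ_prod_free.mem_nhds (Set.mk_mem_prod trivial hx))).differentiableAt
      one_ne_zero).hasFDerivAt (x := (t, x))
  have h2 : HasFDerivAt (fun x : Conf N k => ((t, x) : ℝ × Conf N k))
    (ContinuousLinearMap.inr ℝ ℝ (Conf N k)) x := hasFDerivAt_prodMk_right t x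
  exact h1.comp x h2

lemma Admissible.continuousOn_dV :
    ContinuousOn (fun p : ℝ × Conf N k => dV Vij p.1 p.2) (Set.univ ×ˢ free N k) := by
  have h1 := h.contDiffOn_Vtot.continuousOn_fderiv_of_isOpen isOpen_univ_prod_free le_rfl
  exact (ContinuousLinearMap.precomp ℝ
    (ContinuousLinearMap.inr ℝ ℝ (Conf N k))).continuous.comp_continuousOn h1

lemma Admissible.Vtot_symm (t : ℝ) (x : Conf N k) :
    Vtot Vij (t + τ) (-x : Conf N k) = Vtot Vij t x := by
  simp only [Vtot, PiLp.neg_apply]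
  refine congrArg _ (Finset.sum_congr rfl fun i _ => Finset.sum_congr rfl fun j _ => ?_)
  rw [← h.symm i j t, neg_sub, neg_sub_neg]

lemma Admissible.dV_symm (t : ℝ) {x : Conf N k} (hx : x ∈ free N k) :
    dV Vij (t + τ) (-x) = -dV Vij t x := by
  exact hasFDerivAt_unique_of_comp_neg (f := fun x : Conf N k => Vtot Vij (t + τ) x)
    (g := fun x : Conf N k => Vtot Vij t x) (h.Vtot_symm t)
    (h.hasFDerivAt (t + τ) (neg_mem_free hx)) (h.hasFDerivAt t hx)

lemma Admissible.Vtot_nonpos (t : ℝ) {x : Conf N k} (hx : x ∈ free N k) : Vtot Vij t x ≤ 0 := by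
  unfold Vtot
  refine mul_nonpos_of_nonneg_of_nonpos (by norm_num)
    (Finset.sum_nonpos fun i _ => Finset.sum_nonpos fun j _ => ?_)
  split_ifs with hij
  · exact h.nonpos i j hij t _ (sub_ne_zero.2 (hx i j hij))
  · rfl

lemma Admissible.Vtot_le (t : ℝ) {x : Conf N k} (hx : x ∈ free N k) {i j : Fin N} (hij : i ≠ j) :
    Vtot Vij t x ≤ 1 / 2 * Vij i j t (x i - x j) := by
  unfold Vtot
  refine mul_le_mul_of_nonneg_left ?_ (by norm_num)
  have hterm : ∀ i j, (if i ≠ j then Vij i j t (x i - x j) else 0) ≤ 0 := fun i j => by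
    split_ifs with hij
    · exact h.nonpos i j hij t _ (sub_ne_zero.2 (hx i j hij))
    · rfl
  calc _ ≤ ∑ j, (if i ≠ j then Vij i j t (x i - x j) else 0) := by
        rw [← Finset.add_sum_erase _ _ (Finset.mem_univ i)]
        exact add_le_of_nonpos_right
          (Finset.sum_nonpos fun i _ => Finset.sum_nonpos fun j _ => hterm i j)
    _ ≤ (if i ≠ j then Vij i j t (x i - x j) else 0) := by
        rw [← Finset.add_sum_erase _ _ (Finset.mem_univ j)]
        exact add_le_of_nonpos_right (Finset.sum_nonpos fun j _ => hterm i j)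
    _ = _ := by rw [if_pos hij]

/-- The gradient of the potential in the space variable. -/
def gradV (Vij : Fin N → Fin N → ℝ → EuclideanSpace ℝ (Fin k) → ℝ) (t : ℝ) (x : Conf N k) :
    Conf N k :=
  (InnerProductSpace.toDual ℝ (Conf N k)).symm (dV Vij t x)

omit h in
lemma inner_gradV (t : ℝ) (x y : Conf N k) : inner ℝ (gradV Vij t x) y = dV Vij t x y :=
  InnerProductSpace.toDual_symm_apply (𝕜 := ℝ)

lemma Admissible.gradV_symm (t : ℝ) {x : Conf N k} (hx : x ∈ free N k) :
    gradV Vij (t + τ) (-x) = -gradV Vij t x := by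
  rw [gradV, h.dV_symm t hx, map_neg, gradV]

lemma Admissible.continuousOn_gradV :
    ContinuousOn (fun p : ℝ × Conf N k => gradV Vij p.1 p.2) (Set.univ ×ˢ free N k) :=
  (InnerProductSpace.toDual ℝ (Conf N k)).symm.continuous.comp_continuousOn h.continuousOn_dV

lemma Admissible.gradient_update (t : ℝ) {x : Conf N k} (hx : x ∈ free N k) (i : Fin N) :
    gradient (fun y => Vtot Vij t (Function.update x i y)) (x i) = gradV Vij t x i := by
  have h1 : HasFDerivAt (fun y => WithLp.toLp 2 (Function.update x i y) :
      EuclideanSpace ℝ (Fin k) → Conf N k)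
      ((PiLp.continuousLinearEquiv 2 ℝ
        fun _ : Fin N => EuclideanSpace ℝ (Fin k)).symm.toContinuousLinearMap.comp
        (ContinuousLinearMap.pi (Pi.single i (ContinuousLinearMap.id ℝ _)))) (x i) :=
    (PiLp.continuousLinearEquiv 2 ℝ fun _ : Fin N =>
      EuclideanSpace ℝ (Fin k)).symm.hasFDerivAt.comp _ (hasFDerivAt_update _ _)
  have hx' : WithLp.toLp 2 (Function.update x i (x i)) = x := by
    rw [Function.update_eq_self]
  have h0 : HasFDerivAt (fun x : Conf N k => Vtot Vij t x) (dV Vij t x)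
      (WithLp.toLp 2 (Function.update x i (x i))) := by
    rw [hx']; exact h.hasFDerivAt t hx
  have h2 := HasFDerivAt.comp (x i) h0 h1
  refine HasGradientAt.gradient ?_
  rw [hasGradientAt_iff_hasFDerivAt]
  refine h2.congr_fderiv ?_
  ext y
  rw [InnerProductSpace.toDual_apply_apply]
  change dV Vij t x _ = _
  rw [← inner_gradV, PiLp.inner_apply, Finset.sum_eq_single i]
  · simp
  · intro j _ hj
    simp [hj]
  · simp

end NBody

namespace HalfPeriod

open Topology

/-- A chain-rule estimate along curves that are merely primitives of integrable functions. -/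
lemma abs_sub_le_integral {E : Type*} [NormedAddCommGroup E] [NormedSpace ℝ E] {O : Set E}
    {U : E → ℝ} {U' : E → E →L[ℝ] ℝ} (hU : ∀ x ∈ O, HasFDerivAt U (U' x) x)
    (hU' : ContinuousOn U' O) {ξ : ℝ → E} {a b : ℝ} (hab : a ≤ b)
    (hξ : ContinuousOn ξ (Set.Icc a b)) (hO : ∀ r ∈ Set.Icc a b, ξ r ∈ O) {p q : ℝ → ℝ}
    (hp : IntegrableOn p (Set.Icc a b)) (hq : IntegrableOn q (Set.Icc a b)) (hq0 : ∀ r, 0 ≤ q r)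
    (hv : ∀ r ∈ Set.Icc a b, ∀ s ∈ Set.Icc a b, r ≤ s → ‖ξ s - ξ r‖ ≤ ∫ σ in r..s, q σ)
    (hpq : ∀ σ ∈ Set.Icc a b, (‖U' (ξ σ)‖ + 1) * q σ ≤ p σ) :
    |U (ξ b) - U (ξ a)| ≤ ∫ σ in a..b, p σ := by
  have hii : ∀ {f : ℝ → ℝ}, IntegrableOn f (Set.Icc a b) → ∀ {r s}, r ∈ Set.Icc a b →
      s ∈ Set.Icc a b → IntervalIntegrable f volume r s := fun {f} hf {r s} hr hs => by
    rw [intervalIntegrable_iff]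
    exact hf.mono_set (Set.uIoc_subset_uIcc.trans (Set.uIcc_subset_Icc hr hs))
  have hUc : ContinuousOn U O := fun x hx => (hU x hx).continuousAt.continuousWithinAt
  have hclosed : IsClosed ({r | |U (ξ r) - U (ξ a)| ≤ ∫ σ in a..r, p σ} ∩ Set.Icc a b) := by
    have h1 : ContinuousOn (fun r => (|U (ξ r) - U (ξ a)|, ∫ σ in a..r, p σ)) (Set.Icc a b) := by
      refine (((hUc.comp hξ hO).sub continuousOn_const).abs).prodMk ?_
      have := intervalIntegral.continuousOn_primitive_interval (f := p) (μ := volume)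
        (a := a) (b := b)
        (by rwa [Set.uIcc_of_le hab])
      rwa [Set.uIcc_of_le hab] at this
    rw [Set.inter_comm]
    exact h1.preimage_isClosed_of_isClosed isClosed_Icc OrderClosedTopology.isClosed_le'
  refine hclosed.Icc_subset_of_forall_exists_gt (by simp) ?_ (Set.right_mem_Icc.2 hab)
  rintro x ⟨hx, hxab⟩ y (hy : x < y)
  have hx' := Set.Ico_subset_Icc_self hxab
  have e1 : ∀ᶠ z in 𝓝[O] ξ x, |U z - U (ξ x)| ≤ (‖U' (ξ x)‖ + 1 / 2) * ‖z - ξ x‖ := by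
    have h1 := ((hU _ (hO x hx')).isLittleO.def (c := 1 / 2) (by norm_num))
    filter_upwards [nhdsWithin_le_nhds h1] with z hz
    rw [Real.norm_eq_abs] at hz
    have h2 := (U' (ξ x)).le_opNorm (z - ξ x)
    rw [Real.norm_eq_abs] at h2
    rw [abs_le] at hz h2 ⊢
    constructor <;> linarith
  have e2 : ∀ᶠ z in 𝓝[O] ξ x, ‖U' (ξ x)‖ - 1 / 2 < ‖U' z‖ :=
    (hU' _ (hO x hx')).norm.eventually (lt_mem_nhds (by linarith))
  have e3 : Tendsto ξ (𝓝[>] x) (𝓝[O] ξ x) := by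
    refine Tendsto.mono_left ?_ (nhdsWithin_le_of_mem (Icc_mem_nhdsGT_of_mem hxab))
    exact (hξ x hx').tendsto_nhdsWithin hO
  have e4 : Set.Ioc x (min y b) ∈ 𝓝[>] x := Ioc_mem_nhdsGT (lt_min hy hxab.2)
  obtain ⟨c, hxc, hc⟩ := mem_nhdsGT_iff_exists_Ioc_subset.1
    (inter_mem (e3.eventually (e1.and e2)) e4)
  have hxc : x < c := hxc
  have hc' := hc ⟨hxc, le_rfl⟩
  have hcab : c ∈ Set.Icc a b := ⟨hx'.1.trans hxc.le, hc'.2.2.trans (min_le_right _ _)⟩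
  have haab : a ∈ Set.Icc a b := ⟨le_rfl, hab⟩
  refine ⟨c, ?_, hxc, hc'.2.2.trans (min_le_left _ _)⟩
  have h1 : |U (ξ c) - U (ξ x)| ≤ ∫ σ in x..c, p σ := by
    calc |U (ξ c) - U (ξ x)| ≤ (‖U' (ξ x)‖ + 1 / 2) * ‖ξ c - ξ x‖ := hc'.1.1
      _ ≤ (‖U' (ξ x)‖ + 1 / 2) * ∫ σ in x..c, q σ := by
        gcongr; exact hv x hx' c hcab hxc.le
      _ = ∫ σ in x..c, (‖U' (ξ x)‖ + 1 / 2) * q σ := (intervalIntegral.integral_const_mul _ _).symm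
      _ ≤ _ := by
        refine intervalIntegral.integral_mono_on hxc.le ((hii hq hx' hcab).const_mul _)
          (hii hp hx' hcab) fun σ hσ => ?_
        refine le_trans ?_ (hpq σ ⟨hx'.1.trans hσ.1, hσ.2.trans hcab.2⟩)
        refine mul_le_mul_of_nonneg_right ?_ (hq0 σ)
        rcases hσ.1.eq_or_lt with h | h
        · rw [h]; linarith
        · have := (hc ⟨h, hσ.2⟩).1.2
          linarith
  have h2 : |U (ξ x) - U (ξ a)| ≤ ∫ σ in a..x, p σ := hx
  change |U (ξ c) - U (ξ a)| ≤ ∫ σ in a..c, p σ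
  rw [← intervalIntegral.integral_add_adjacent_intervals (hii hp haab hx') (hii hp hx' hcab)]
  calc _ ≤ |U (ξ c) - U (ξ x)| + |U (ξ x) - U (ξ a)| := abs_sub_le _ _ _
    _ ≤ _ := by linarith

variable {τ : ℝ}

lemma integrableOn_Icc {F : Type*} [NormedAddCommGroup F] {u : ℝ → F} :
    IntegrableOn u (Set.Icc 0 τ) ↔ Integrable (fun s : Seg τ => u s) := by
  have h := (MeasurableEmbedding.subtype_coe
    (measurableSet_Icc (a := (0 : ℝ)) (b := τ))).integrable_map_iff
    (μ := Measure.comap Subtype.val volume) (g := u)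
  rw [map_comap_subtype_coe measurableSet_Icc] at h
  exact h

lemma setIntegral_Ioc {E : Type*} [NormedAddCommGroup E] [NormedSpace ℝ E]
    (u : ℝ → E) {s t : Seg τ} (hst : s ≤ t) :
    ∫ r in Set.Ioc s t, u r = ∫ r in (s : ℝ)..t, u r := by
  have h := (MeasurableEmbedding.subtype_coe
    (measurableSet_Icc (a := (0 : ℝ)) (b := τ))).setIntegral_map
    (μ := Measure.comap Subtype.val volume) u (Set.Ioc (s : ℝ) t)
  rw [map_comap_subtype_coe measurableSet_Icc, Measure.restrict_restrict measurableSet_Ioc] at h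
  rw [intervalIntegral.integral_of_le hst]
  have h1 : Set.Ioc (s : ℝ) t ∩ Set.Icc 0 τ = Set.Ioc (s : ℝ) t :=
    Set.inter_eq_left.2 fun x hx => ⟨s.2.1.trans hx.1.le, hx.2.trans t.2.2⟩
  rw [h1] at h
  exact h.symm

end HalfPeriod

namespace HalfPeriod

open Topology

variable {τ : ℝ}

lemma exists_crossing {φ : Seg τ → ℝ} (hφ : Continuous φ) {d : ℝ} {t₀ t₁ : Seg τ}
    (h0 : φ t₀ < d) (h1 : d ≤ φ t₁) :
    ∃ r, φ r = d ∧ ∀ σ : Seg τ, (σ : ℝ) ∈ Set.uIcc (r : ℝ) t₀ → φ σ ≤ d := by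
  have hτ : 0 ≤ τ := t₀.2.1.trans t₀.2.2
  have hc : IsCompact {t | d ≤ φ t} := (isClosed_le continuous_const hφ).isCompact
  obtain ⟨r, hr, hmin⟩ := hc.exists_isMinOn ⟨t₁, h1⟩
    (f := fun t : Seg τ => |(t : ℝ) - t₀|) (by fun_prop)
  have heq : ∀ σ : Seg τ, (σ : ℝ) ∈ Set.uIcc (r : ℝ) t₀ → d ≤ φ σ → σ = r := fun σ hσ hd => by
    have h2 : |(r : ℝ) - t₀| ≤ |(σ : ℝ) - t₀| := hmin hd
    refine Subtype.ext ?_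
    rcases le_total (r : ℝ) t₀ with h | h
    · rw [Set.uIcc_of_le h] at hσ
      rw [abs_of_nonpos (by linarith), abs_of_nonpos (by linarith [hσ.2])] at h2
      linarith [hσ.1]
    · rw [Set.uIcc_of_ge h] at hσ
      rw [abs_of_nonneg (by linarith), abs_of_nonneg (by linarith [hσ.1])] at h2
      linarith [hσ.2]
  have hr0 : φ r = d := by
    have h3 : ContinuousOn (Set.IccExtend hτ φ) (Set.uIcc (r : ℝ) t₀) :=
      hφ.Icc_extend'.continuousOn
    obtain ⟨s, hs, hsd⟩ := intermediate_value_uIcc h3 (show d ∈ _ by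
      rw [Set.IccExtend_val, Set.IccExtend_val, Set.uIcc_of_ge (h0.le.trans hr)]
      exact ⟨h0.le, hr⟩)
    have hs' : s ∈ Set.Icc 0 τ := Set.uIcc_subset_Icc r.2 t₀.2 hs
    rw [Set.IccExtend_of_mem hτ φ hs'] at hsd
    rwa [← heq ⟨s, hs'⟩ hs hsd.ge]
  refine ⟨r, hr0, fun σ hσ => ?_⟩
  by_contra! h
  rw [heq σ hσ h.le, hr0] at h
  exact lt_irrefl _ h

variable {E : Type*} [NormedAddCommGroup E] [InnerProductSpace ℝ E] [CompleteSpace E]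

omit [CompleteSpace E] in
lemma integral_norm_sq (v : L2 τ E) : ∫ t, ‖v t‖ ^ 2 = ‖v‖ ^ 2 := by
  rw [← real_inner_self_eq_norm_sq, L2.inner_def]
  simp only [real_inner_self_eq_norm_sq]

omit [InnerProductSpace ℝ E] [CompleteSpace E] in
lemma integrable_norm_sq (v : L2 τ E) : Integrable fun t => ‖v t‖ ^ 2 :=
  (memLp_two_iff_integrable_sq_norm (Lp.aestronglyMeasurable v)).1 (Lp.memLp v)

lemma abs_comp_prim_sub_le {O : Set E} (hO : IsOpen O) {U : E → ℝ} (hU : ContDiffOn ℝ 1 U O)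
    (v : L2 τ E) {D : Seg τ → ℝ} (hD : Integrable D) (hD0 : ∀ t, 0 ≤ D t)
    (hUD : ∀ t, prim v t ∈ O → ‖fderiv ℝ U (prim v t)‖ ^ 2 ≤ D t) {a b : Seg τ} (hab : a ≤ b)
    (hmem : ∀ t ∈ Set.Icc a b, prim v t ∈ O) :
    |U (prim v b) - U (prim v a)| ≤ (∫ t, D t) + τ + 1 / 2 * ‖v‖ ^ 2 := by
  have hτ : 0 ≤ τ := a.2.1.trans a.2.2
  have hsub : Set.Icc (a : ℝ) b ⊆ Set.Icc 0 τ := Set.Icc_subset_Icc a.2.1 b.2.2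
  set p : Seg τ → ℝ := fun t => D t + 1 + 1 / 2 * ‖v t‖ ^ 2 with hp
  have hD1 : Integrable fun t => D t + 1 := hD.add (integrable_const 1)
  have hpi : Integrable p := hD1.add ((integrable_norm_sq v).const_mul _)
  have hext : ∀ {F : Type _} [NormedAddCommGroup F] {f : Seg τ → F}, Integrable f →
      IntegrableOn (Set.IccExtend hτ f) (Set.Icc 0 τ) := fun hf => by
    rw [integrableOn_Icc]; simpa using hf
  have h1 := abs_sub_le_integral (O := O) (U := U) (U' := fderiv ℝ U)
    (fun x hx => ((hU.contDiffAt (hO.mem_nhds hx)).differentiableAt one_ne_zero).hasFDerivAt)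
    (hU.continuousOn_fderiv_of_isOpen hO le_rfl) (ξ := Set.IccExtend hτ (prim v))
    (a := a) (b := b) hab (continuous_prim v).Icc_extend'.continuousOn (fun r hr => by
      rw [Set.IccExtend_of_mem hτ _ (hsub hr)]; exact hmem _ hr)
    (p := Set.IccExtend hτ p) (q := Set.IccExtend hτ fun t => ‖v t‖)
    ((hext hpi).mono_set hsub) ((hext (integrable v).norm).mono_set hsub)
    (fun r => norm_nonneg _) (fun r hr s hs hrs => by
      rw [Set.IccExtend_of_mem hτ _ (hsub hr), Set.IccExtend_of_mem hτ _ (hsub hs),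
        prim_sub_prim v (s := ⟨r, hsub hr⟩) (t := ⟨s, hsub hs⟩) hrs]
      have := setIntegral_Ioc (Set.IccExtend hτ fun t => ‖v t‖) (s := ⟨r, hsub hr⟩)
        (t := ⟨s, hsub hs⟩) hrs
      rw [← this]
      simp only [Set.IccExtend_val]
      exact norm_integral_le_integral_norm _) (fun r hr => by
      rw [Set.IccExtend_of_mem hτ _ (hsub hr), Set.IccExtend_of_mem hτ _ (hsub hr),
        Set.IccExtend_of_mem hτ _ (hsub hr)]
      have h2 := hUD ⟨r, hsub hr⟩ (hmem _ hr)
      simp only [hp]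
      nlinarith [sq_nonneg (‖fderiv ℝ U (prim v ⟨r, hsub hr⟩)‖ + 1 - ‖v ⟨r, hsub hr⟩‖),
        sq_nonneg (‖fderiv ℝ U (prim v ⟨r, hsub hr⟩)‖ - 1)])
  rw [Set.IccExtend_val, Set.IccExtend_val, ← setIntegral_Ioc _ hab] at h1
  simp only [Set.IccExtend_val] at h1
  refine h1.trans ((setIntegral_le_integral hpi (Eventually.of_forall fun t => by
    have := hD0 t
    simp only [hp, Pi.zero_apply]; positivity)).trans_eq ?_)
  simp only [hp]
  rw [integral_add hD1 ((integrable_norm_sq v).const_mul _),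
    integral_add hD (integrable_const 1), integral_const_mul, integral_norm_sq, integral_const,
    Measure.real, volume_univ, ENNReal.toReal_ofReal hτ]
  simp

/-- Gordon's estimate: a strong force keeps curves of bounded action away from the origin. -/
theorem exists_le_norm_prim [FiniteDimensional ℝ E] (hτ : 0 < τ) {W : ℝ → E → ℝ}
    (hW : ContinuousOn (fun p : ℝ × E => W p.1 p.2) (Set.univ ×ˢ {0}ᶜ))
    (hlt : ∀ M : ℝ, ∃ δ > (0 : ℝ), ∀ t ξ, ξ ≠ 0 → ‖ξ‖ < δ → W t ξ < -M)
    (hnonpos : ∀ t ξ, ξ ≠ 0 → W t ξ ≤ 0)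
    (hstrong : ∃ 𝒩 : Set E, IsOpen 𝒩 ∧ (0 : E) ∈ 𝒩 ∧ ∃ U : E → ℝ, ContDiffOn ℝ 1 U (𝒩 \ {0}) ∧
      Tendsto U (𝓝[𝒩 \ {0}] 0) atTop ∧ ∀ t, ∀ ξ ∈ 𝒩 \ {0}, ‖gradient U ξ‖ ^ 2 ≤ -W t ξ) (C : ℝ) :
    ∃ ρ > 0, ∀ v : L2 τ E, (∀ t, prim v t ≠ 0) → ‖v‖ ^ 2 ≤ C →
      ∫ t : Seg τ, -W t (prim v t) ≤ C → ∀ t, ρ ≤ ‖prim v t‖ := by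
  obtain ⟨𝒩, h𝒩, h0, U, hU, hU0, hUW⟩ := hstrong
  have hO : IsOpen (𝒩 \ {0}) := h𝒩.sdiff isClosed_singleton
  obtain ⟨ε, hε, hball⟩ := Metric.isOpen_iff.1 h𝒩 0 h0
  obtain ⟨δ, hδ, hWδ⟩ := hlt ((C + 1) / τ)
  set d := min δ (ε / 2) with hd
  have hd0 : 0 < d := lt_min hδ (half_pos hε)
  have hmem : ∀ x : E, x ≠ 0 → ‖x‖ ≤ d → x ∈ 𝒩 \ {0} := fun x hx hxd =>
    ⟨hball (by
      rw [mem_ball_zero_iff]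
      have := min_le_right δ (ε / 2)
      linarith), hx⟩
  have hsph : Metric.sphere (0 : E) d ⊆ 𝒩 \ {0} := fun x hx => by
    have hx' : ‖x‖ = d := by simpa using hx
    exact hmem x (norm_pos_iff.1 (by linarith)) hx'.le
  obtain ⟨K, hK⟩ := (isCompact_sphere (0 : E) d).bddAbove_image (hU.continuousOn.mono hsph)
  obtain ⟨ρ, hρ, hUρ⟩ := Metric.mem_nhdsWithin_iff.1
    (hU0.eventually_gt_atTop (K + (C + τ + 1 / 2 * C)))
  refine ⟨min ρ d, lt_min hρ hd0, fun v hv hvC hWC t₀ => ?_⟩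
  have hWi : Integrable fun t : Seg τ => -W t (prim v t) := by
    refine integrable_of_continuous (Continuous.neg ?_)
    exact hW.comp_continuous (f := fun t : Seg τ => ((t : ℝ), prim v t))
      (continuous_subtype_val.prodMk (continuous_prim v)) fun t => ⟨trivial, hv t⟩
  by_contra! hlt'
  have ht0 : ‖prim v t₀‖ < d := hlt'.trans_le (min_le_right _ _)
  obtain ⟨t₁, ht1⟩ : ∃ t₁, d ≤ ‖prim v t₁‖ := by
    by_contra! hall
    have h1 : ∫ _ : Seg τ, (C + 1) / τ ≤ ∫ t : Seg τ, -W t (prim v t) :=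
      integral_mono (integrable_const _) hWi fun t => by
        have := hWδ t _ (hv t) ((hall t).trans_le (min_le_left _ _))
        dsimp only
        linarith
    rw [integral_const, Measure.real, volume_univ, ENNReal.toReal_ofReal hτ.le, smul_eq_mul,
      mul_div_cancel₀ _ hτ.ne'] at h1
    linarith
  obtain ⟨r, hr, hrσ⟩ := exists_crossing (continuous_prim v).norm ht0 ht1
  have hUr : U (prim v r) ≤ K := hK ⟨_, by simpa using hr, rfl⟩
  have hUt : K + (C + τ + 1 / 2 * C) < U (prim v t₀) := hUρ
    ⟨by rw [mem_ball_zero_iff]; exact hlt'.trans_le (min_le_left _ _), hmem _ (hv _) ht0.le⟩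
  have hgrad : ∀ t, prim v t ∈ 𝒩 \ {0} → ‖fderiv ℝ U (prim v t)‖ ^ 2 ≤ -W t (prim v t) :=
    fun t ht => by
      have h1 := hUW t _ ht
      rwa [gradient, LinearIsometryEquiv.norm_map] at h1
  have habs : |U (prim v t₀) - U (prim v r)| ≤ C + τ + 1 / 2 * C := by
    have hfin : (∫ t : Seg τ, -W t (prim v t)) + τ + 1 / 2 * ‖v‖ ^ 2 ≤ C + τ + 1 / 2 * C := by
      linarith
    have hW0 : ∀ t : Seg τ, 0 ≤ -W t (prim v t) := fun t => by linarith [hnonpos t _ (hv t)]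
    rcases le_total r t₀ with h | h
    · refine (abs_comp_prim_sub_le hO hU v hWi hW0 hgrad h fun t ht => ?_).trans hfin
      exact hmem _ (hv t) (hrσ t (by rw [Set.uIcc_of_le (Subtype.coe_le_coe.2 h)]; exact ht))
    · rw [abs_sub_comm]
      refine (abs_comp_prim_sub_le hO hU v hWi hW0 hgrad h fun t ht => ?_).trans hfin
      exact hmem _ (hv t) (hrσ t (by rw [Set.uIcc_of_ge (Subtype.coe_le_coe.2 h)]; exact ht))
  linarith [le_abs_self (U (prim v t₀) - U (prim v r))]

/-- A curve that oscillates many times with a fixed amplitude has large energy. -/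
lemma mul_sq_le_of_oscillating (v : L2 τ E) {n : ℕ} {t : Fin (n + 1) → Seg τ} (ht : Monotone t)
    {d : ℝ} (hd : 0 ≤ d)
    (hosc : ∀ i : Fin n, d ≤ ‖prim v (t i.succ) - prim v (t i.castSucc)‖) :
    n * d ^ 2 ≤ τ * ‖v‖ ^ 2 := by
  have h1 : ∀ i : Fin n, d ^ 2 ≤ ((t i.succ : ℝ) - t i.castSucc) * ‖v‖ ^ 2 := fun i => by
    have hle : t i.castSucc ≤ t i.succ := ht i.castSucc_lt_succ.le
    have h2 := pow_le_pow_left₀ hd ((hosc i).trans (norm_prim_sub_le v hle)) 2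
    rwa [mul_pow, Real.sq_sqrt (sub_nonneg.2 hle)] at h2
  have h2 : ∑ i : Fin n, ((t i.succ : ℝ) - t i.castSucc) = t (Fin.last n) - t 0 := by
    have := Fin.sum_univ_castSucc fun i => (t i : ℝ)
    rw [Fin.sum_univ_succ] at this
    rw [Finset.sum_sub_distrib]
    linarith
  have h3 := Finset.sum_le_sum fun i (_ : i ∈ Finset.univ) => h1 i
  rw [← Finset.sum_mul, h2, Finset.sum_const, Finset.card_univ, Fintype.card_fin,
    nsmul_eq_mul] at h3
  refine h3.trans (mul_le_mul_of_nonneg_right ?_ (sq_nonneg _))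
  linarith [(t (Fin.last n)).2.2, (t 0).2.1]

lemma prim_compLp {F : Type*} [NormedAddCommGroup F] [InnerProductSpace ℝ F] [CompleteSpace F]
    (L : E →L[ℝ] F) (w : L2 τ E) (t : Seg τ) : prim (L.compLp w) t = L (prim w t) := by
  have h := L.coeFn_compLp w
  simp only [prim, map_sub, map_smul]
  rw [integral_congr_ae h, integral_congr_ae (ae_restrict_of_ae h),
    L.integral_comp_comm (integrable w), L.integral_comp_comm (integrable w).integrableOn]

end HalfPeriod

namespace NBody

open Topology HalfPeriod

variable {N k : ℕ} {τ : ℝ} {Vij : Fin N → Fin N → ℝ → EuclideanSpace ℝ (Fin k) → ℝ}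

/-- The relative position of two bodies. -/
def rel (i j : Fin N) : Conf N k →L[ℝ] EuclideanSpace ℝ (Fin k) :=
  PiLp.proj (𝕜 := ℝ) 2 (fun _ : Fin N => EuclideanSpace ℝ (Fin k)) i -
    PiLp.proj (𝕜 := ℝ) 2 (fun _ : Fin N => EuclideanSpace ℝ (Fin k)) j

@[simp] lemma rel_apply (i j : Fin N) (x : Conf N k) : rel i j x = x i - x j := rfl

/-- The collision-free continuous paths. -/
def freePaths (τ : ℝ) (N k : ℕ) : Set C(Seg τ, Conf N k) := {u | ∀ t, u t ∈ free N k}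

/-- The integral of the potential along a path. -/
def potential (Vij : Fin N → Fin N → ℝ → EuclideanSpace ℝ (Fin k) → ℝ) (u : C(Seg τ, Conf N k)) :
    ℝ :=
  ∫ t : Seg τ, Vtot Vij t (u t)

/-- The action of unit masses over half a period, in terms of the velocity. -/
def halfAction (Vij : Fin N → Fin N → ℝ → EuclideanSpace ℝ (Fin k) → ℝ) (w : L2 τ (Conf N k)) : ℝ :=
  1 / 2 * ‖w‖ ^ 2 - potential Vij (primL τ (Conf N k) w)

lemma isOpen_freePaths : IsOpen (freePaths τ N k) := isOpen_forall_mem isOpen_free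

variable (h : Admissible τ Vij)

include h

lemma Admissible.continuousOn_Vtot :
    ContinuousOn (fun p : Seg τ × Conf N k => Vtot Vij p.1 p.2) (Set.univ ×ˢ free N k) :=
  h.contDiffOn_Vtot.continuousOn.comp (f := fun p : Seg τ × Conf N k => ((p.1 : ℝ), p.2))
    (by fun_prop) fun p hp => ⟨trivial, hp.2⟩

/-- The differential of the potential along a path. -/
def Admissible.dPotential {u : C(Seg τ, Conf N k)} (hu : u ∈ freePaths τ N k) :
    C(Seg τ, Conf N k →L[ℝ] ℝ) :=
  ⟨fun t => dV Vij t (u t), h.continuousOn_dV.comp_continuous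
    (f := fun t : Seg τ => ((t : ℝ), u t)) (by fun_prop) fun t => ⟨trivial, hu t⟩⟩

lemma Admissible.hasStrictFDerivAt_potential {u : C(Seg τ, Conf N k)} (hu : u ∈ freePaths τ N k) :
    HasStrictFDerivAt (potential Vij) (integralForm volume (h.dPotential hu)) u :=
  hasStrictFDerivAt_integral (W := fun (t : Seg τ) (x : Conf N k) => Vtot Vij t x)
    (D := fun (t : Seg τ) (x : Conf N k) => dV Vij t x) isOpen_free h.continuousOn_Vtot
    (h.continuousOn_dV.comp (f := fun p : Seg τ × Conf N k => ((p.1 : ℝ), p.2))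
      (by fun_prop) fun p hp => ⟨trivial, hp.2⟩)
    (fun t x hx => h.hasFDerivAt t hx) hu _ fun _ => rfl

lemma Admissible.continuous_Vtot {u : C(Seg τ, Conf N k)} (hu : u ∈ freePaths τ N k) :
    Continuous fun t : Seg τ => Vtot Vij t (u t) :=
  h.continuousOn_Vtot.comp_continuous (f := fun t : Seg τ => (t, u t)) (by fun_prop)
    fun t => ⟨trivial, hu t⟩

lemma Admissible.potential_nonpos {u : C(Seg τ, Conf N k)} (hu : u ∈ freePaths τ N k) :
    potential Vij u ≤ 0 :=
  integral_nonpos fun t => h.Vtot_nonpos t (hu t)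

lemma Admissible.bounds_of_halfAction_le {C : ℝ} {w : L2 τ (Conf N k)}
    (hw : primL τ (Conf N k) w ∈ freePaths τ N k) (hC : halfAction Vij w ≤ C) :
    ‖w‖ ^ 2 ≤ 2 * C ∧ ∀ i j, i ≠ j →
      ∫ t : Seg τ, -Vij i j t (prim w t i - prim w t j) ≤ 2 * C := by
  have h1 := h.potential_nonpos hw
  unfold halfAction at hC
  refine ⟨by linarith, fun i j hij => ?_⟩
  have h2 : ∫ t : Seg τ, -Vij i j t (prim w t i - prim w t j) ≤
      ∫ t : Seg τ, -(2 * Vtot Vij t (primL τ (Conf N k) w t)) := by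
    refine integral_mono ?_ ?_ fun t => ?_
    · refine integrable_of_continuous (Continuous.neg ?_)
      refine (h.contDiffOn i j hij).continuousOn.comp_continuous
        (f := fun t : Seg τ => ((t : ℝ), prim w t i - prim w t j)) ?_ fun t => ⟨trivial, ?_⟩
      · exact continuous_subtype_val.prodMk ((rel i j).continuous.comp (continuous_prim w))
      · exact sub_ne_zero.2 (hw t i j hij)
    · exact integrable_of_continuous ((h.continuous_Vtot hw).const_mul 2).neg
    · have := h.Vtot_le t (hw t) hij
      simp only [primL_apply] at this ⊢
      linarith
  have h4 : ∫ t : Seg τ, -(2 * Vtot Vij t (primL τ (Conf N k) w t)) =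
      -(2 * potential Vij (primL τ (Conf N k) w)) := by
    rw [integral_neg, integral_const_mul, potential]
  rw [h4] at h2
  have h3 : 0 ≤ ‖w‖ ^ 2 := sq_nonneg _
  linarith

lemma Admissible.exists_separation (C : ℝ) :
    ∃ ρ > 0, ∀ w : L2 τ (Conf N k), primL τ (Conf N k) w ∈ freePaths τ N k →
      halfAction Vij w ≤ C → ∀ i j, i ≠ j → ∀ t, ρ ≤ ‖prim w t i - prim w t j‖ := by
  have key : ∀ i j : Fin N, i ≠ j → ∃ ρ > 0, ∀ w : L2 τ (Conf N k),
      primL τ (Conf N k) w ∈ freePaths τ N k →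
      halfAction Vij w ≤ C → ∀ t, ρ ≤ ‖prim w t i - prim w t j‖ := fun i j hij => by
    set K := ‖(rel i j : Conf N k →L[ℝ] EuclideanSpace ℝ (Fin k)).compLpL 2
      (volume : Measure (Seg τ))‖ with hK
    obtain ⟨ρ, hρ, hsep⟩ := exists_le_norm_prim h.pos (W := Vij i j)
      (h.contDiffOn i j hij).continuousOn (h.lt_neg i j hij) (h.nonpos i j hij)
      (h.strong i j hij) (max (2 * C) (K ^ 2 * (2 * C)))
    refine ⟨ρ, hρ, fun w hw hwC t => ?_⟩
    obtain ⟨b1, b2⟩ := h.bounds_of_halfAction_le hw hwC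
    have hp : ∀ t, prim ((rel i j).compLp w) t = prim w t i - prim w t j := prim_compLp _ w
    have := hsep ((rel i j).compLp w) (fun t => by
      rw [hp]; exact sub_ne_zero.2 (hw t i j hij)) (le_max_of_le_right ?_)
      (le_max_of_le_left (by simp only [hp]; exact b2 i j hij)) t
    · rwa [hp] at this
    · calc ‖(rel i j).compLp w‖ ^ 2 ≤ (K * ‖w‖) ^ 2 := by
            gcongr
            exact ((rel i j).compLpL 2 (volume : Measure (Seg τ))).le_opNorm w
        _ ≤ _ := by rw [mul_pow]; gcongr
  have hev : ∀ᶠ ρ in 𝓝[>] (0 : ℝ), 0 < ρ ∧ ∀ i j : Fin N, i ≠ j → ∀ w : L2 τ (Conf N k),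
      primL τ (Conf N k) w ∈ freePaths τ N k →
      halfAction Vij w ≤ C → ∀ t, ρ ≤ ‖prim w t i - prim w t j‖ := by
    refine eventually_and.2 ⟨self_mem_nhdsWithin,
      eventually_all.2 fun i => eventually_all.2 fun j => ?_⟩
    by_cases hij : i = j
    · exact Eventually.of_forall fun _ h => absurd hij h
    · obtain ⟨ρ, hρ, hsep⟩ := key i j hij
      filter_upwards [Ioc_mem_nhdsGT hρ] with r hr _ w hw hwC t
      exact hr.2.trans (hsep w hw hwC t)
  obtain ⟨ρ, hρ, hsep⟩ := hev.exists
  exact ⟨ρ, hρ, fun w hw hwC i j hij t => hsep i j hij w hw hwC t⟩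

lemma Admissible.closure_subset (C : ℝ) :
    closure {u | ∃ w, primL τ (Conf N k) w = u ∧ u ∈ freePaths τ N k ∧
      1 / 2 * ‖w‖ ^ 2 - potential Vij u ≤ C} ⊆ freePaths τ N k := by
  obtain ⟨ρ, hρ, hsep⟩ := h.exists_separation C
  have hclosed : IsClosed {u : C(Seg τ, Conf N k) | ∀ i j, i ≠ j → ∀ t, ρ ≤ ‖rel i j (u t)‖} := by
    simp only [Set.ofPred_forall]
    refine isClosed_iInter fun i => isClosed_iInter fun j => isClosed_iInter fun _ =>
      isClosed_iInter fun t => ?_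
    exact isClosed_le continuous_const
      ((rel i j).continuous.comp (continuous_eval_const t)).norm
  refine (closure_minimal ?_ hclosed).trans fun u hu t i j hij hx => ?_
  · rintro u ⟨w, rfl, hw, hwC⟩ i j hij t
    exact hsep w hw hwC i j hij t
  · have := hu i j hij t
    rw [rel_apply, hx, sub_self, norm_zero] at this
    linarith

/-- Many alternations of a relative position force a large action. -/
lemma Admissible.exists_lt_halfAction {i j : Fin N} (hij : i ≠ j) (C : ℝ) :
    ∃ n₀ : ℕ, ∀ n ≥ n₀, ∀ w : L2 τ (Conf N k), primL τ (Conf N k) w ∈ freePaths τ N k →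
      (∃ t : Fin (n + 1) → Seg τ, Monotone t ∧ ∃ u : EuclideanSpace ℝ (Fin k), ∀ l, ∃ c > 0,
        prim w (t l) i - prim w (t l) j = ((-1) ^ l.val * c : ℝ) • u) → C < halfAction Vij w := by
  obtain ⟨ρ, hρ, hsep⟩ := h.exists_separation C
  set K := ‖(rel i j : Conf N k →L[ℝ] EuclideanSpace ℝ (Fin k)).compLpL 2
      (volume : Measure (Seg τ))‖ with hK
  obtain ⟨n₀, hn₀⟩ := exists_nat_gt (τ * (K ^ 2 * (2 * C)) / ρ ^ 2)
  refine ⟨n₀, fun n hn w hw ⟨t, ht, u, halt⟩ => ?_⟩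
  by_contra! hwC
  have hp : ∀ t, prim ((rel i j).compLp w) t = prim w t i - prim w t j := prim_compLp _ w
  have h1 := mul_sq_le_of_oscillating ((rel i j).compLp w) ht hρ.le fun l => by
    obtain ⟨c, hc, hcu⟩ := halt l.castSucc
    obtain ⟨c', hc', hcu'⟩ := halt l.succ
    have h2 := hsep w hw hwC i j hij (t l.castSucc)
    rw [hp, hp, hcu, hcu', ← sub_smul, norm_smul]
    rw [hcu, norm_smul] at h2
    refine h2.trans (mul_le_mul_of_nonneg_right ?_ (norm_nonneg _))
    rw [Fin.val_succ, Fin.val_castSucc, pow_succ,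
      show (-1 : ℝ) ^ l.val * -1 * c' - (-1) ^ l.val * c =
      (-1) ^ l.val * -(c' + c) by ring, Real.norm_eq_abs, Real.norm_eq_abs, abs_mul, abs_mul,
      abs_neg, abs_of_pos hc, abs_of_pos (add_pos hc' hc)]
    exact mul_le_mul_of_nonneg_left (by linarith) (abs_nonneg _)
  have h3 : ‖(rel i j).compLp w‖ ^ 2 ≤ K ^ 2 * (2 * C) := by
    calc ‖(rel i j).compLp w‖ ^ 2 ≤ (K * ‖w‖) ^ 2 := by
          gcongr
          exact ((rel i j).compLpL 2 (volume : Measure (Seg τ))).le_opNorm w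
      _ ≤ _ := by
        rw [mul_pow]
        exact mul_le_mul_of_nonneg_left (h.bounds_of_halfAction_le hw hwC).1 (sq_nonneg _)
  have h4 : (n : ℝ) * ρ ^ 2 ≤ τ * (K ^ 2 * (2 * C)) :=
    h1.trans (mul_le_mul_of_nonneg_left h3 h.pos.le)
  rw [div_lt_iff₀ (by positivity)] at hn₀
  have h5 : (n₀ : ℝ) * ρ ^ 2 ≤ n * ρ ^ 2 := by gcongr
  linarith

end NBody

namespace Alternation

variable {n q : ℕ}

/-- The derivative of `amp`. -/
def ampDeriv (q : ℕ) (c : Fin (2 * q + 1) → ℝ) (t : ℝ) : ℝ :=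
  ∑ m : Fin (2 * q + 1), (-1) ^ m.val * deriv (windowBump q m) t * c m

lemma hasDerivAt_amp (q : ℕ) (c : Fin (2 * q + 1) → ℝ) (t : ℝ) :
    HasDerivAt (amp q c) (ampDeriv q c t) t := by
  refine HasDerivAt.fun_sum fun m _ => HasDerivAt.mul_const (HasDerivAt.const_mul _ ?_) _
  exact (((windowBump q m).contDiff (n := 1)).differentiable one_ne_zero t).hasDerivAt

lemma amp_eq_zero {q : ℕ} {c : Fin (2 * q + 1) → ℝ} {t : ℝ} (ht : t ≤ 0 ∨ 1 ≤ t) :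
    amp q c t = 0 := by
  refine Finset.sum_eq_zero fun m _ => ?_
  rw [(windowBump q m).zero_of_le_dist, mul_zero, zero_mul]
  change (1 / (4 * (2 * (q : ℝ) + 1))) ≤ _
  have hm : (m : ℝ) + 1 ≤ 2 * q + 1 := by exact_mod_cast m.isLt
  have h0 : (0 : ℝ) ≤ m := Nat.cast_nonneg _
  have hq : (0 : ℝ) < 2 * q + 1 := by positivity
  have h1 : 1 / (4 * (2 * (q : ℝ) + 1)) ≤ mid q m := by
    unfold mid
    rw [div_le_div_iff₀ (by positivity) (by positivity)]
    nlinarith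
  have h2 : 1 / (4 * (2 * (q : ℝ) + 1)) ≤ 1 - mid q m := by
    have : 1 - mid q m = (2 * (2 * q + 1) - (2 * m + 1)) / (2 * (2 * q + 1)) := by
      unfold mid; field_simp
    rw [this, div_le_div_iff₀ (by positivity) (by positivity)]
    nlinarith
  rw [Real.dist_eq]
  rcases ht with ht | ht
  · rw [abs_sub_comm]
    exact le_trans (by linarith) (le_abs_self _)
  · exact le_trans (by linarith) (le_abs_self _)

lemma expl_right (p : Torus n q) : expl p 1 = -expl p 0 := by
  ext j
  refine Fin.cases ?_ (fun j => ?_) j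
  · change amp q _ 1 = -amp q _ 0
    rw [amp_eq_zero (Or.inr le_rfl), amp_eq_zero (Or.inl le_rfl), neg_zero]
  · refine Fin.cases ?_ (fun j => ?_) j
    · change -Real.cos _ = -(-Real.cos _)
      have : Real.pi * (2 * q + 1) * 1 = (q : ℕ) * (2 * Real.pi) + Real.pi := by ring
      rw [this, Real.cos_nat_mul_two_pi_add_pi, mul_zero, Real.cos_zero]
    · change amp q _ 1 = -amp q _ 0
      rw [amp_eq_zero (Or.inr le_rfl), amp_eq_zero (Or.inl le_rfl), neg_zero]

/-- The velocity of the explicit family. -/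
def explDeriv (p : Torus n q) (t : ℝ) : Amb n :=
  WithLp.toLp 2 (Fin.cons (ampDeriv q (fun m => height (p m)) t)
    (Fin.cons (Real.sin (Real.pi * (2 * q + 1) * t) * (Real.pi * (2 * q + 1)))
      fun j => ampDeriv q (fun m => (p m j : ℂ).im) t))

lemma hasDerivAt_expl (p : Torus n q) (t : ℝ) : HasDerivAt (expl p) (explDeriv p t) t := by
  refine HasFDerivAt.comp_hasDerivAt (f := fun t => WithLp.ofLp (expl p t)) t
    (PiLp.hasFDerivAt_toLp (𝕜 := ℝ) 2 _) (hasDerivAt_pi.2 fun j => ?_)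
  refine Fin.cases ?_ (fun j => ?_) j
  · exact hasDerivAt_amp _ _ _
  · refine Fin.cases ?_ (fun j => ?_) j
    · have h := ((hasDerivAt_id t).const_mul (Real.pi * (2 * q + 1))).cos.fun_neg
      simp only [id, mul_one, neg_mul, neg_neg] at h
      exact h
    · exact hasDerivAt_amp _ _ _

lemma continuous_explDeriv : Continuous fun x : Torus n q × ℝ => explDeriv x.1 x.2 := by
  refine (PiLp.continuous_toLp 2 _).comp ?_
  have hb : ∀ m : Fin (2 * q + 1), Continuous (deriv (windowBump q m)) :=
    fun m => ((windowBump q m).contDiff (n := 1)).continuous_deriv le_rfl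
  refine continuous_pi fun j => ?_
  refine Fin.cases ?_ (fun j => ?_) j
  · simp only [Fin.cons_zero, ampDeriv, height]
    fun_prop
  · refine Fin.cases ?_ (fun j => ?_) j
    · simp only [Fin.cons_succ, Fin.cons_zero]
      fun_prop
    · simp only [Fin.cons_succ, ampDeriv]
      fun_prop

end Alternation

namespace HalfPeriod

theorem exists_critical {E : Type*} [NormedAddCommGroup E] [InnerProductSpace ℝ E]
    [FiniteDimensional ℝ E] {τ : ℝ} {P : Type*} [TopologicalSpace P] [CompactSpace P] [Nonempty P]
    {Ω : Set C(Seg τ, E)} (hΩ : IsOpen Ω) {Φ : C(Seg τ, E) → ℝ}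
    {D : ∀ u ∈ Ω, C(Seg τ, E →L[ℝ] ℝ)}
    (hΦ : ∀ u hu, HasStrictFDerivAt Φ (integralForm volume (D u hu)) u) (hΦ0 : ∀ u ∈ Ω, Φ u ≤ 0)
    (hcl : ∀ C, closure {u | ∃ w, primL τ E w = u ∧ u ∈ Ω ∧ 1 / 2 * ‖w‖ ^ 2 - Φ u ≤ C} ⊆ Ω)
    {F : Set C(P, L2 τ E)} (hF : ∀ h ∈ F, ∀ p, primL τ E (h p) ∈ Ω) (hne : F.Nonempty)
    (hclopen : ∀ h : C(P, L2 τ E), (∀ p, primL τ E (h p) ∈ Ω) →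
      ∃ δ > 0, ∀ h' : C(P, L2 τ E), dist h' h < δ →
        (∀ p, primL τ E (h' p) ∈ Ω) ∧ (h ∈ F ↔ h' ∈ F)) :
    ∃ w, ∃ hw : primL τ E w ∈ Ω,
      (∀ φ, inner ℝ w φ = integralForm volume (D _ hw) (primL τ E φ)) ∧
      ∀ L, (∀ h ∈ F, ∃ p, L ≤ 1 / 2 * ‖h p‖ ^ 2 - Φ (primL τ E (h p))) →
        L ≤ 1 / 2 * ‖w‖ ^ 2 - Φ (primL τ E w) := by
  have hΦ' := fun u hu => (hΦ u hu).hasFDerivAt.fderiv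
  obtain ⟨w, hw, hcrit, hlevel⟩ := Minimax.exists_critical (A := primL τ E)
    isCompactOperator_primL hΩ (Φ := Φ) (Φ' := fderiv ℝ Φ)
    (fun u hu => (hΦ u hu).congr_fderiv (hΦ' u hu).symm) hΦ0 hcl hF hne hclopen
  exact ⟨w, hw, fun φ => by rw [hcrit, hΦ'], hlevel⟩

open Alternation in
/-- The velocities of the images of the explicit paths under a linear map. -/
lemma exists_prim_eq_expl {E : Type*} [NormedAddCommGroup E] [InnerProductSpace ℝ E]
    [CompleteSpace E] {τ : ℝ} (hτ : 0 < τ) {n q : ℕ} (S : Amb n →L[ℝ] E) :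
    ∃ h : C(Torus n q, L2 τ E), ∀ p t, prim (h p) t = S (expl p (t / τ)) := by
  let g : Torus n q → ℝ → E := fun p t => S (τ⁻¹ • explDeriv p (t / τ))
  have hgc : Continuous fun x : Torus n q × ℝ => g x.1 x.2 := by
    have h1 : Continuous fun x : Torus n q × ℝ => explDeriv x.1 (x.2 / τ) :=
      continuous_explDeriv.comp (f := fun x : Torus n q × ℝ => (x.1, x.2 / τ)) (by fun_prop)
    exact S.continuous.comp (h1.const_smul τ⁻¹)
  have hv : ∀ p t, HasDerivAt (fun t => S (expl p (t / τ))) (g p t) t := fun p t => by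
    have h1 : HasDerivAt (fun t : ℝ => t / τ) τ⁻¹ t := by
      simpa using (hasDerivAt_id t).div_const τ
    exact S.hasFDerivAt.comp_hasDerivAt t (HasDerivAt.scomp (g₁ := expl p) t
      (hasDerivAt_expl p (t / τ)) h1)
  let V : C(Torus n q, C(Seg τ, E)) := ContinuousMap.curry
    ⟨fun x : Torus n q × Seg τ => g x.1 x.2, hgc.comp (f := fun x : Torus n q × Seg τ =>
      (x.1, (x.2 : ℝ))) (by fun_prop)⟩
  refine ⟨⟨fun p => incl τ E (V p), (incl τ E).continuous.comp V.continuous⟩, fun p t => ?_⟩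
  refine (prim_incl hτ.le (u := V p) (g := g p) (fun _ => rfl) t).trans ?_
  refine antiprim_deriv (hgc.comp (f := fun t : ℝ => (p, t)) (by fun_prop)) (hv p) ?_ t
  rw [div_self hτ.ne', zero_div, expl_right, map_neg]

end HalfPeriod

namespace NBody

open Topology HalfPeriod Alternation unitInterval

variable {N n q : ℕ} {τ : ℝ}

/-- The collinear configuration spanned by a vector. -/
def spread (N k : ℕ) : EuclideanSpace ℝ (Fin k) →L[ℝ] Conf N k :=
  ((PiLp.continuousLinearEquiv 2 ℝ fun _ : Fin N =>
    EuclideanSpace ℝ (Fin k)).symm : (Fin N → EuclideanSpace ℝ (Fin k)) →L[ℝ] Conf N k) ∘L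
    ContinuousLinearMap.pi fun i : Fin N =>
      -(i.val : ℝ) • ContinuousLinearMap.id ℝ (EuclideanSpace ℝ (Fin k))

lemma spread_apply {k : ℕ} (v : EuclideanSpace ℝ (Fin k)) (i : Fin N) :
    spread N k v i = -(i.val : ℝ) • v := rfl

lemma spread_mem_free {k : ℕ} {v : EuclideanSpace ℝ (Fin k)} (hv : v ≠ 0) :
    spread N k v ∈ free N k := fun i j hij h => by
  rw [spread_apply, spread_apply, smul_left_inj hv, neg_inj, Nat.cast_inj] at h
  exact hij (Fin.ext h)

/-- The point of `[0, τ]` that divides it in a given ratio. -/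
def scale (hτ : 0 ≤ τ) (s : I) : Seg τ :=
  ⟨τ * s, mul_nonneg hτ s.2.1, mul_le_of_le_one_right hτ s.2.2⟩

lemma continuous_scale (hτ : 0 ≤ τ) : Continuous (scale hτ) := by
  unfold scale; fun_prop

lemma scale_mono (hτ : 0 ≤ τ) : Monotone (scale hτ) := fun _ _ h =>
  mul_le_mul_of_nonneg_left (Subtype.coe_le_coe.2 h) hτ

lemma scale_zero (hτ : 0 ≤ τ) : scale hτ 0 = ⟨0, le_rfl, hτ⟩ := Subtype.ext (by simp [scale])

lemma scale_one (hτ : 0 ≤ τ) : scale hτ 1 = ⟨τ, hτ, le_rfl⟩ := Subtype.ext (by simp [scale])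

/-- The relative motion of two bodies in a family of paths given by their velocities. -/
def relMap (hτ : 0 ≤ τ) (i j : Fin N) (h : C(Torus n q, L2 τ (Conf N (n + 2)))) :
    C(Torus n q × I, Amb n) :=
  ⟨fun x => rel i j (primL τ (Conf N (n + 2)) (h x.1) (scale hτ x.2)), by
    refine (rel i j).continuous.comp (f := fun x : Torus n q × I =>
      primL τ (Conf N (n + 2)) (h x.1) (scale hτ x.2)) ?_
    exact (((primL τ (Conf N (n + 2))).continuous.comp h.continuous).comp continuous_fst).eval
      ((continuous_scale hτ).comp continuous_snd)⟩

lemma relMap_apply (hτ : 0 ≤ τ) (i j : Fin N) (h : C(Torus n q, L2 τ (Conf N (n + 2))))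
    (x : Torus n q × I) :
    relMap hτ i j h x = rel i j (primL τ (Conf N (n + 2)) (h x.1) (scale hτ x.2)) := rfl

lemma relMap_one (hτ : 0 ≤ τ) (i j : Fin N) (h : C(Torus n q, L2 τ (Conf N (n + 2))))
    (p : Torus n q) : relMap hτ i j h (p, 1) = -relMap hτ i j h (p, 0) := by
  rw [relMap_apply, relMap_apply, scale_zero, scale_one, primL_apply, primL_apply, prim_right hτ,
    map_neg]

lemma norm_relMap_sub_le (hτ : 0 ≤ τ) (i j : Fin N)
    (h h' : C(Torus n q, L2 τ (Conf N (n + 2)))) (x : Torus n q × I) :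
    ‖relMap hτ i j h' x - relMap hτ i j h x‖ ≤
      ‖(rel i j : Conf N (n + 2) →L[ℝ] _)‖ * (‖primL τ (Conf N (n + 2))‖ * dist h' h) := by
  rw [relMap_apply, relMap_apply, ← map_sub]
  refine (rel i j).le_opNorm_of_le ?_
  rw [← ContinuousMap.sub_apply, ← map_sub]
  refine (ContinuousMap.norm_coe_le_norm _ _).trans ((primL τ (Conf N (n + 2))).le_opNorm_of_le ?_)
  rw [← dist_eq_norm]
  exact ContinuousMap.dist_apply_le_dist x.1

/-- The families of collision-free paths along which two bodies wind as in the explicit one. -/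
def Families (hτ : 0 ≤ τ) (i j : Fin N) (n q : ℕ) : Set C(Torus n q, L2 τ (Conf N (n + 2))) :=
  {h | (∀ p, primL τ (Conf N (n + 2)) (h p) ∈ freePaths τ N (n + 2)) ∧
    Standard (relMap hτ i j h)}

lemma exists_ball_mem_Families_iff (hτ : 0 ≤ τ) {i j : Fin N} (hij : i ≠ j)
    (h : C(Torus n q, L2 τ (Conf N (n + 2))))
    (hh : ∀ p, primL τ (Conf N (n + 2)) (h p) ∈ freePaths τ N (n + 2)) :
    ∃ δ > 0, ∀ h' : C(Torus n q, L2 τ (Conf N (n + 2))), dist h' h < δ →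
      (∀ p, primL τ (Conf N (n + 2)) (h' p) ∈ freePaths τ N (n + 2)) ∧
      (h ∈ Families hτ i j n q ↔ h' ∈ Families hτ i j n q) := by
  have hopen : IsOpen {h' : C(Torus n q, L2 τ (Conf N (n + 2))) |
      ∀ p, primL τ (Conf N (n + 2)) (h' p) ∈ freePaths τ N (n + 2)} := by
    have := ContinuousMap.isOpen_setOfPred_mapsTo (isCompact_univ (X := Torus n q))
      (isOpen_freePaths.preimage (primL τ (Conf N (n + 2))).continuous)
    simpa [Set.MapsTo] using this
  obtain ⟨δ₁, hδ₁, hball⟩ := Metric.isOpen_iff.1 hopen h hh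
  have hne : ∀ x, 0 < ‖relMap hτ i j h x‖ := fun x =>
    norm_pos_iff.2 (sub_ne_zero.2 (hh x.1 (scale hτ x.2) i j hij))
  obtain ⟨r, hr, hrle⟩ := (isCompact_univ (X := Torus n q × I)).exists_forall_le'
    (relMap hτ i j h).continuous.norm.continuousOn (a := 0) fun x _ => hne x
  set K := ‖(rel i j : Conf N (n + 2) →L[ℝ] _)‖ * ‖primL τ (Conf N (n + 2))‖
  have hK : 0 ≤ K := by positivity
  refine ⟨min δ₁ (r / (2 * (K + 1))), by positivity, fun h' hd => ?_⟩
  have h1 := hball (show h' ∈ Metric.ball h δ₁ from hd.trans_le (min_le_left _ _))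
  have hclose : ∀ x, ‖relMap hτ i j h' x - relMap hτ i j h x‖ < r / 2 := fun x => by
    refine (norm_relMap_sub_le hτ i j h h' x).trans_lt ?_
    have h2 : dist h' h < r / (2 * (K + 1)) := hd.trans_le (min_le_right _ _)
    rw [← mul_assoc]
    calc K * dist h' h ≤ K * (r / (2 * (K + 1))) := by gcongr
      _ = r / 2 * (K / (K + 1)) := by field_simp
      _ < r / 2 * 1 := by gcongr; rw [div_lt_one (by positivity)]; linarith
      _ = r / 2 := mul_one _
  refine ⟨h1,
    ⟨fun hF => ⟨h1, hF.2.of_near (relMap_one hτ i j h) (relMap_one hτ i j h') fun x => ?_⟩,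
    fun hF => ⟨hh, hF.2.of_near (relMap_one hτ i j h') (relMap_one hτ i j h) fun x => ?_⟩⟩⟩
  · exact (hclose x).trans_le (by linarith [hrle x trivial])
  · have h2 := hclose x
    have h3 := norm_sub_norm_le (relMap hτ i j h x) (relMap hτ i j h' x)
    rw [norm_sub_rev]
    rw [norm_sub_rev] at h3
    linarith [hrle x trivial]

lemma families_nonempty (hτ : 0 < τ) {i j : Fin N} (hij : j.val = i.val + 1) :
    (Families hτ.le i j n q).Nonempty := by
  obtain ⟨h₀, hprim⟩ := exists_prim_eq_expl hτ (q := q) (spread N (n + 2))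
  refine ⟨h₀, fun p t => ?_, ?_⟩
  · rw [primL_apply, hprim]
    refine spread_mem_free (expl_ne_zero p ⟨div_nonneg t.2.1 hτ.le, ?_⟩)
    exact (div_le_one hτ).2 t.2.2
  · convert standard_explMap (n := n) (q := q)
    ext1 x
    rw [relMap_apply, primL_apply, hprim, rel_apply, spread_apply, spread_apply, hij, ← sub_smul]
    change _ = expl x.1 x.2
    have : (scale hτ.le x.2 : ℝ) / τ = x.2 := mul_div_cancel_left₀ _ hτ.ne'
    rw [this]
    push_cast
    module

variable {Vij : Fin N → Fin N → ℝ → EuclideanSpace ℝ (Fin (n + 2)) → ℝ}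

/-- There are collision-free critical points of arbitrarily large action. -/
theorem Admissible.exists_critical (h : Admissible τ Vij) (hN : 2 ≤ N) (L : ℝ) :
    ∃ w : L2 τ (Conf N (n + 2)), ∃ hw : primL τ (Conf N (n + 2)) w ∈ freePaths τ N (n + 2),
      (∀ φ, inner ℝ w φ = integralForm volume (h.dPotential hw) (primL τ (Conf N (n + 2)) φ)) ∧
      L ≤ halfAction Vij w := by
  have hij : (⟨0, by omega⟩ : Fin N) ≠ ⟨1, by omega⟩ := by simp
  obtain ⟨q, hq⟩ := h.exists_lt_halfAction hij L
  obtain ⟨w, hw, hcrit, hlevel⟩ := HalfPeriod.exists_critical isOpen_freePaths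
    (fun u hu => h.hasStrictFDerivAt_potential hu) (fun u hu => h.potential_nonpos hu)
    h.closure_subset (F := Families h.pos.le ⟨0, by omega⟩ ⟨1, by omega⟩ n q)
    (fun f hf => hf.1) (families_nonempty h.pos rfl)
    (exists_ball_mem_Families_iff h.pos.le hij)
  refine ⟨w, hw, hcrit, hlevel L fun f hf => ?_⟩
  obtain ⟨p, t, u, ht, -, halt⟩ := hf.2.exists_alternating
  exact ⟨p, (hq (2 * q) (by omega) (f p) (hf.1 p) ⟨fun l => scale h.pos.le (t l),
    (scale_mono h.pos.le).comp ht.monotone, u, halt⟩).le⟩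

end NBody

namespace HalfPeriod

variable {τ : ℝ}

lemma forall_of_forall_seg (hτ : 0 < τ) {P : ℝ → Prop} (h : ∀ t : Seg τ, P t)
    (hP : ∀ t, P (t + τ) ↔ P t) (t : ℝ) : P t := by
  have hper : Function.Periodic P τ := fun t => propext (hP t)
  obtain ⟨s, hs, hts⟩ := hper.exists_mem_Ico₀ hτ t
  rw [hts]
  exact h ⟨s, hs.1, hs.2.le⟩

variable {E : Type*} [NormedAddCommGroup E]

/-- A path with opposite values at its ends extends to a continuous antiperiodic function. -/
lemma exists_antiperiodic_extension (hτ : 0 < τ) (u : C(Seg τ, E))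
    (hu : u ⟨τ, hτ.le, le_rfl⟩ = -u ⟨0, le_rfl, hτ.le⟩) :
    ∃ U : ℝ → E, Continuous U ∧ Function.Antiperiodic U τ ∧ ∀ t : Seg τ, U t = u t := by
  let v : ℝ → E := Set.IccExtend hτ.le u
  have hv : Continuous v := u.continuous.Icc_extend'
  have hvt : ∀ t : Seg τ, v t = u t := fun t => Set.IccExtend_val hτ.le u t
  have hv0 : v τ = -v 0 := by rw [hvt ⟨τ, hτ.le, le_rfl⟩, hvt ⟨0, le_rfl, hτ.le⟩, hu]
  let f : ℝ → E := fun t => if t ≤ τ then v t else -v (t - τ)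
  have hf : Continuous f := hv.if_le (by fun_prop) continuous_id continuous_const fun t ht => by
    rw [ht, sub_self, hv0]
  have hf0 : f 0 = f (τ + τ) := by
    simp only [f]
    rw [if_pos hτ.le, if_neg (by linarith), add_sub_cancel_right, hv0, neg_neg]
  have : Fact (0 < τ + τ) := ⟨by linarith⟩
  let U : ℝ → E := fun t => AddCircle.liftIco (τ + τ) 0 f t
  have hU : ∀ t, 0 ≤ t → t < τ + τ → U t = f t := fun t h0 h1 =>
    AddCircle.liftIco_zero_coe_apply ⟨h0, h1⟩
  have hper : Function.Periodic U (τ + τ) := fun t => by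
    simp only [U]
    rw [AddCircle.coe_add_period]
  have hseg : ∀ t : Seg τ, U t = u t := fun t => by
    rw [hU t t.2.1 (by linarith [t.2.2]), ← hvt]
    exact if_pos t.2.2
  have hshift : ∀ t : Seg τ, U (t + τ) = -U t := fun t => by
    have h0 := t.2.1
    rcases t.2.2.lt_or_eq with h1 | h1
    · rw [hU _ (by linarith) (by linarith), hseg, ← hvt]
      simp only [f]
      split_ifs with h2
      · have : (t : ℝ) = 0 := by linarith
        rw [this, zero_add, hv0]
      · rw [add_sub_cancel_right]
    · have h2 : U (τ + τ) = U 0 := by simpa using hper 0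
      rw [h1, h2, hseg ⟨0, le_rfl, hτ.le⟩, hseg ⟨τ, hτ.le, le_rfl⟩, hu, neg_neg]
  refine ⟨U, ?_, ?_, hseg⟩
  · exact (AddCircle.liftIco_zero_continuous hf0 hf.continuousOn).comp (AddCircle.continuous_mk' _)
  · refine forall_of_forall_seg hτ hshift fun t => ?_
    rw [add_assoc, hper t, eq_neg_iff_add_eq_zero, eq_neg_iff_add_eq_zero, add_comm]

variable [InnerProductSpace ℝ E]

lemma antiperiodic_antiprim {g : ℝ → E} (hg : Continuous g)
    (hanti : Function.Antiperiodic g τ) : Function.Antiperiodic (antiprim τ g) τ := fun t => by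
  have h1 : ∫ s in τ..t + τ, g s = -∫ s in (0 : ℝ)..t, g s := by
    have h2 := intervalIntegral.integral_comp_add_right (a := 0) (b := t) g τ
    rw [zero_add] at h2
    rw [← h2, ← intervalIntegral.integral_neg]
    exact intervalIntegral.integral_congr fun s _ => hanti s
  rw [antiprim, antiprim, ← intervalIntegral.integral_add_adjacent_intervals
    (hg.intervalIntegrable 0 τ) (hg.intervalIntegrable τ (t + τ)), h1]
  module

/-- `X` is a classical solution of `X'' = -F(t, X)` with velocity `V`, antiperiodic and in `O`. -/
structure IsAntiperiodicSolution (τ : ℝ) (O : Set E) (F : ℝ → E → E) (X V : ℝ → E) : Prop where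
  hasDerivAt (t : ℝ) : HasDerivAt X (V t) t
  hasDerivAt_velocity (t : ℝ) : HasDerivAt V (-F t (X t)) t
  continuous_force : Continuous fun t => F t (X t)
  antiperiodic : Function.Antiperiodic X τ
  mem (t : ℝ) : X t ∈ O

section

variable {O : Set E} {F : ℝ → E → E} {X V : ℝ → E} (h : IsAntiperiodicSolution τ O F X V)
  {G : Type*} [NormedAddCommGroup G] [NormedSpace ℝ G] (L : E →L[ℝ] G)

include h

lemma IsAntiperiodicSolution.continuous : Continuous X :=
  continuous_iff_continuousAt.2 fun t => (h.hasDerivAt t).continuousAt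

lemma IsAntiperiodicSolution.continuous_velocity : Continuous V :=
  continuous_iff_continuousAt.2 fun t => (h.hasDerivAt_velocity t).continuousAt

lemma IsAntiperiodicSolution.deriv_comp : deriv (fun t => L (X t)) = fun t => L (V t) :=
  funext fun t => (L.hasFDerivAt.comp_hasDerivAt t (h.hasDerivAt t)).deriv

lemma IsAntiperiodicSolution.deriv_velocity_comp :
    deriv (fun t => L (V t)) = fun t => -L (F t (X t)) :=
  funext fun t => (L.hasFDerivAt.comp_hasDerivAt t (h.hasDerivAt_velocity t)).deriv.trans
    (map_neg L _)

lemma IsAntiperiodicSolution.contDiff : ContDiff ℝ 2 X := by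
  have h1 : ContDiff ℝ 1 V := by
    refine contDiff_one_iff_deriv.2 ⟨fun t => (h.hasDerivAt_velocity t).differentiableAt, ?_⟩
    rw [show deriv V = fun t => -F t (X t) from funext fun t => (h.hasDerivAt_velocity t).deriv]
    exact h.continuous_force.neg
  rw [show (2 : WithTop ℕ∞) = 1 + 1 by norm_num, contDiff_succ_iff_deriv]
  refine ⟨fun t => (h.hasDerivAt t).differentiableAt, by simp, ?_⟩
  rwa [show deriv X = V from funext fun t => (h.hasDerivAt t).deriv]

lemma IsAntiperiodicSolution.contDiff_comp : ContDiff ℝ 2 fun t => L (X t) :=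
  L.contDiff.comp h.contDiff

end

/-- Weak solutions of `X'' = -F(t, X)` extend to antiperiodic classical solutions. -/
theorem exists_classical_solution [FiniteDimensional ℝ E] (hτ : 0 < τ) {O : Set E}
    (hO : ∀ x ∈ O, -x ∈ O) {F : ℝ → E → E}
    (hF : ContinuousOn (fun p : ℝ × E => F p.1 p.2) (Set.univ ×ˢ O))
    (hsymm : ∀ t, ∀ x ∈ O, F (t + τ) (-x) = -F t x) {w : L2 τ E} (hw : ∀ t, prim w t ∈ O)
    (hcrit : ∀ φ : L2 τ E, inner ℝ w φ = ∫ t : Seg τ, inner ℝ (F t (prim w t)) (prim φ t)) :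
    ∃ X V : ℝ → E, IsAntiperiodicSolution τ O F X V ∧
      (∀ t : Seg τ, X t = prim w t) ∧ ‖w‖ ^ 2 = ∫ t in (0 : ℝ)..τ, ‖V t‖ ^ 2 := by
  obtain ⟨U, hUc, hUa, hUs⟩ := exists_antiperiodic_extension hτ (primL τ E w) (prim_right hτ.le w)
  have hUO : ∀ t, U t ∈ O := by
    refine forall_of_forall_seg hτ (fun t => by rw [hUs]; exact hw t) fun t => ?_
    rw [hUa t]
    exact ⟨fun h => by simpa using hO _ h, hO _⟩
  let G : ℝ → E := fun t => F t (U t)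
  have hG : Continuous G := hF.comp_continuous (f := fun t => (t, U t)) (by fun_prop)
    fun t => ⟨trivial, hUO t⟩
  have hGa : Function.Antiperiodic G τ := fun t => by
    simp only [G]
    rw [hUa t, hsymm t _ (hUO t)]
  let V : ℝ → E := fun t => -antiprim τ G t
  have hV : Continuous V := (continuous_antiprim hG).neg
  have hVa : Function.Antiperiodic V τ := fun t => by
    simp only [V]
    rw [antiperiodic_antiprim hG hGa t]
  let g : C(Seg τ, E) := ⟨fun t => G t, by fun_prop⟩
  let c : C(Seg τ, E) := ⟨fun t => V t, by fun_prop⟩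
  have hwc : w = incl τ E c := by
    have h1 := eq_neg_incl_primL hτ.le (w := w) (g := g) fun φ => by
      rw [hcrit]
      refine integral_congr_ae (Eventually.of_forall fun t => ?_)
      change inner ℝ (F t (prim w t)) (prim φ t) = inner ℝ (F t (U t)) (prim φ t)
      rw [hUs]
      rfl
    rw [← map_neg] at h1
    rw [h1]
    congr 1
    ext1 t
    change -prim (incl τ E g) t = -antiprim τ G t
    rw [prim_incl hτ.le (g := G) fun _ => rfl]
  have hXU : ∀ t, antiprim τ V t = U t := by
    refine forall_of_forall_seg hτ (fun t => ?_) fun t => ?_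
    · rw [hUs, primL_apply]
      conv_rhs => rw [hwc]
      exact (prim_incl hτ.le (fun _ => rfl) t).symm
    · rw [antiperiodic_antiprim hV hVa t, hUa t, neg_inj]
  have hUV : ∀ t, HasDerivAt U (V t) t := fun t => by
    have h1 := hasDerivAt_antiprim (τ := τ) hV t
    rwa [show antiprim τ V = U from funext hXU] at h1
  refine ⟨U, V, ⟨hUV, fun t => (hasDerivAt_antiprim hG t).neg, hG, hUa, hUO⟩, hUs, ?_⟩
  conv_lhs => rw [hwc]
  rw [← real_inner_self_eq_norm_sq, inner_incl]
  simp only [real_inner_self_eq_norm_sq]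
  exact integral_eq_intervalIntegral hτ.le fun t => ‖V t‖ ^ 2

end HalfPeriod

namespace NBody

open HalfPeriod

variable {N n : ℕ} {Vij : Fin N → Fin N → ℝ → EuclideanSpace ℝ (Fin (n + 2)) → ℝ} {τ : ℝ}

theorem Admissible.exists_solution (h : Admissible τ Vij) (hN : 2 ≤ N) (L : ℝ) :
    ∃ X V : ℝ → Conf N (n + 2),
      IsAntiperiodicSolution τ (free N (n + 2)) (gradV Vij) X V ∧
      L ≤ 1 / 2 * (∫ t in (0 : ℝ)..τ, ‖V t‖ ^ 2) - ∫ t in (0 : ℝ)..τ, Vtot Vij t (X t) := by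
  obtain ⟨w, hw, hcrit, hL⟩ := h.exists_critical hN L
  obtain ⟨X, V, hX, hXw, hnorm⟩ := exists_classical_solution h.pos
    (O := free N (n + 2)) (fun x hx => neg_mem_free hx) (F := gradV Vij) h.continuousOn_gradV
    (fun t x hx => h.gradV_symm t hx) (w := w) hw (fun φ => by
      rw [hcrit, integralForm_apply]
      exact integral_congr_ae (Eventually.of_forall fun t => (inner_gradV _ _ _).symm))
  refine ⟨X, V, hX, hL.trans_eq ?_⟩
  rw [halfAction, hnorm, potential,
    ← integral_eq_intervalIntegral h.pos.le fun t => Vtot Vij t (X t)]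
  congr 1
  exact integral_congr_ae (Eventually.of_forall fun t => by
    simp only [hXw, primL_apply])

variable {X V : ℝ → Conf N (n + 2)}
  (hX : IsAntiperiodicSolution τ (free N (n + 2)) (gradV Vij) X V)

include hX

lemma deriv_apply (i : Fin N) : deriv (fun s => X s i) = fun t => V t i :=
  hX.deriv_comp (PiLp.proj (𝕜 := ℝ) 2 (fun _ : Fin N => EuclideanSpace ℝ (Fin (n + 2))) i)

lemma deriv_velocity_apply (i : Fin N) :
    deriv (fun s => V s i) = fun t => -gradV Vij t (X t) i :=
  hX.deriv_velocity_comp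
    (PiLp.proj (𝕜 := ℝ) 2 (fun _ : Fin N => EuclideanSpace ℝ (Fin (n + 2))) i)

lemma contDiff_apply (i : Fin N) : ContDiff ℝ 2 fun t => X t i :=
  hX.contDiff_comp (PiLp.proj (𝕜 := ℝ) 2 (fun _ : Fin N => EuclideanSpace ℝ (Fin (n + 2))) i)

lemma continuous_velocity_apply (i : Fin N) : Continuous fun t => V t i :=
  (PiLp.proj (𝕜 := ℝ) 2 (fun _ : Fin N => EuclideanSpace ℝ (Fin (n + 2))) i).continuous.comp
    hX.continuous_velocity

lemma apply_add (t : ℝ) (i : Fin N) : X (t + τ) i = -X t i := by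
  rw [hX.antiperiodic t, PiLp.neg_apply]

lemma equation (h : Admissible τ Vij) (t : ℝ) (i : Fin N) :
    deriv (deriv fun s => X s i) t
      + gradient (fun y => Vtot Vij t (Function.update (X t) i y)) (X t i) = 0 := by
  rw [deriv_apply hX, deriv_velocity_apply hX,
    h.gradient_update t (hX.mem t), neg_add_cancel]

lemma continuous_Vtot_comp (h : Admissible τ Vij) :
    Continuous fun t => Vtot Vij t (X t) :=
  h.contDiffOn_Vtot.continuousOn.comp_continuous (f := fun t => (t, X t))
    (continuous_id.prodMk hX.continuous)
    fun t => ⟨trivial, hX.mem t⟩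

lemma le_action (h : Admissible τ Vij) {m : Fin N → ℝ} {μ : ℝ} (hμ0 : 0 ≤ μ)
    (hμ1 : μ ≤ 1) (hμ : ∀ i, μ ≤ m i) :
    μ * (1 / 2 * (∫ t in (0 : ℝ)..τ, ‖V t‖ ^ 2) - ∫ t in (0 : ℝ)..τ, Vtot Vij t (X t)) ≤
      action (τ + τ) m Vij fun t i => X t i := by
  have hτ := h.pos
  have hVi (i : Fin N) : Continuous fun t => ‖V t i‖ ^ 2 :=
    (continuous_velocity_apply hX i).norm.pow 2
  have hW := continuous_Vtot_comp hX h
  have hsum : ∫ t in (0 : ℝ)..τ, ‖V t‖ ^ 2 = ∑ i, ∫ t in (0 : ℝ)..τ, ‖V t i‖ ^ 2 := by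
    rw [← intervalIntegral.integral_finsetSum fun i _ => (hVi i).intervalIntegrable _ _]
    exact intervalIntegral.integral_congr fun t _ => PiLp.norm_sq_eq_of_L2 _ _
  have hmono {f : ℝ → ℝ} (hf : Continuous f) (h0 : ∀ t, 0 ≤ f t) :
      ∫ t in (0 : ℝ)..τ, f t ≤ ∫ t in (0 : ℝ)..τ + τ, f t :=
    intervalIntegral.integral_mono_interval le_rfl hτ.le (by linarith)
      (Eventually.of_forall h0) (hf.intervalIntegrable _ _)
  have hkin (i : Fin N) : μ * (1 / 2 * ∫ t in (0 : ℝ)..τ, ‖V t i‖ ^ 2) ≤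
      m i / 2 * ∫ t in (0 : ℝ)..τ + τ, ‖V t i‖ ^ 2 := by
    have h1 : 0 ≤ ∫ t in (0 : ℝ)..τ, ‖V t i‖ ^ 2 :=
      intervalIntegral.integral_nonneg hτ.le fun t _ => by positivity
    have h2 := mul_le_mul (hμ i) (hmono (hVi i) fun t => by positivity) h1 (hμ0.trans (hμ i))
    linarith
  have hpot : μ * -∫ t in (0 : ℝ)..τ, Vtot Vij t (X t) ≤
      -∫ t in (0 : ℝ)..τ + τ, Vtot Vij t (X t) := by
    have h0 (t : ℝ) : 0 ≤ -Vtot Vij t (X t) := neg_nonneg.2 (h.Vtot_nonpos t (hX.mem t))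
    have h1 := hmono hW.neg h0
    have h2 : 0 ≤ ∫ t in (0 : ℝ)..τ, -Vtot Vij t (X t) :=
      intervalIntegral.integral_nonneg hτ.le fun t _ => h0 t
    rw [← intervalIntegral.integral_neg, ← intervalIntegral.integral_neg]
    exact (mul_le_of_le_one_left h2 hμ1).trans h1
  have hkin' := Finset.sum_le_sum fun i (_ : i ∈ Finset.univ) => hkin i
  rw [← Finset.mul_sum, ← Finset.mul_sum] at hkin'
  simp only [action, deriv_apply hX]
  rw [hsum]
  linarith

omit hX

/-- Symmetric non-collision solutions of arbitrarily large action. -/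
theorem Admissible.exists_seq_solution (h : Admissible τ Vij) (hN : 2 ≤ N) {m : Fin N → ℝ}
    (hm : ∀ i, 0 < m i) :
    ∃ X V : ℕ → ℝ → Conf N (n + 2),
      (∀ l, IsAntiperiodicSolution τ (free N (n + 2)) (gradV Vij) (X l) (V l)) ∧
      Tendsto (fun l => action (τ + τ) m Vij fun t i => X l t i) atTop atTop := by
  choose X V hX hL using fun l : ℕ => h.exists_solution hN l
  refine ⟨X, V, hX, ?_⟩
  have : Nonempty (Fin N) := ⟨⟨0, by omega⟩⟩
  obtain ⟨i₀, hi₀⟩ := Finite.exists_min m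
  have hμ : 0 < min 1 (m i₀) := lt_min one_pos (hm i₀)
  refine tendsto_atTop_mono (fun l => ?_) (tendsto_natCast_atTop_atTop.const_mul_atTop hμ)
  exact (mul_le_mul_of_nonneg_left (hL l) hμ.le).trans (le_action (hX l) h hμ.le (min_le_left _ _)
    fun i => (min_le_right _ _).trans (hi₀ i))

end NBody

theorem nbody_nonpositive_unbounded_actions
    {N k : ℕ} (hN : 2 ≤ N) (hk : 2 ≤ k)
    (T : ℝ) (hT : 0 < T)
    (m : Fin N → ℝ) (hm : ∀ i, 0 < m i)
    (Vij : Fin N → Fin N → ℝ → EuclideanSpace ℝ (Fin k) → ℝ)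
    -- (V1)-(V2): each `V_{ij}` is `C¹` on `ℝ × (ℝ^k ∖ {0})`
    (hC1 : ∀ i j, i ≠ j →
      ContDiffOn ℝ 1 (fun p : ℝ × EuclideanSpace ℝ (Fin k) => Vij i j p.1 p.2)
        (Set.univ ×ˢ {(0 : EuclideanSpace ℝ (Fin k))}ᶜ))
    -- `T`-periodicity in time
    (hper : ∀ i j t ξ, Vij i j (t + T) ξ = Vij i j t ξ)
    -- (V3): `V_{ij}(t,ξ) → -∞` uniformly in `t` as `|ξ| → 0`
    (hV3 : ∀ i j, i ≠ j → ∀ M : ℝ, ∃ δ > (0:ℝ), ∀ t : ℝ,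
      ∀ ξ : EuclideanSpace ℝ (Fin k), ξ ≠ 0 → ‖ξ‖ < δ → Vij i j t ξ < -M)
    -- (V4): non-positivity
    (hV4 : ∀ i j, i ≠ j → ∀ (t : ℝ) (ξ : EuclideanSpace ℝ (Fin k)), ξ ≠ 0 →
      Vij i j t ξ ≤ 0)
    -- (V5): Gordon's strong force condition
    (hV5 : ∀ i j, i ≠ j → ∃ 𝒩 : Set (EuclideanSpace ℝ (Fin k)),
      IsOpen 𝒩 ∧ (0 : EuclideanSpace ℝ (Fin k)) ∈ 𝒩 ∧
      ∃ U : EuclideanSpace ℝ (Fin k) → ℝ, ContDiffOn ℝ 1 U (𝒩 \ {0}) ∧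
        Tendsto U (nhdsWithin 0 (𝒩 \ {0})) atTop ∧
        ∀ t : ℝ, ∀ ξ ∈ 𝒩 \ {0}, ‖gradient U ξ‖ ^ 2 ≤ -Vij i j t ξ)
    -- (V6): the symmetry `V_{ij}(t + T/2, -ξ) = V_{ij}(t, ξ)`
    (hV6 : ∀ i j t ξ, Vij i j (t + T / 2) (-ξ) = Vij i j t ξ) :
    ∃ X : ℕ → ℝ → Fin N → EuclideanSpace ℝ (Fin k),
      (∀ n : ℕ,
        (∀ i, ContDiff ℝ 2 fun t => X n t i) ∧
        (∀ t i, X n (t + T) i = X n t i) ∧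
        (∀ t i, X n (t + T / 2) i = -X n t i) ∧
        (∀ t, ∀ i j, i ≠ j → X n t i ≠ X n t j) ∧
        (∀ t i, deriv (deriv fun s => X n s i) t
          + gradient (fun y => Vtot Vij t (Function.update (X n t) i y)) (X n t i) = 0)) ∧
      Tendsto (fun n => action T m Vij (X n)) atTop atTop := by
  obtain ⟨n, rfl⟩ : ∃ n, k = n + 2 := ⟨k - 2, by omega⟩
  have h : NBody.Admissible (T / 2) Vij := ⟨half_pos hT, hC1, hV3, hV4, hV5, hV6⟩
  obtain ⟨X, V, hX, hlim⟩ := h.exists_seq_solution hN hm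
  rw [add_halves] at hlim
  refine ⟨fun l t i => X l t i, fun l => ⟨NBody.contDiff_apply (hX l), fun t i => ?_,
    NBody.apply_add (hX l), fun t => (hX l).mem t, NBody.equation (hX l) h⟩, hlim⟩
  simp only
  rw [← add_halves T, ← add_assoc, NBody.apply_add (hX l), NBody.apply_add (hX l), neg_neg]

end
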